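/- There exist absolute constants c, C > 0 with the following property. Let q be a prime power and n an integer with n > C, and let G be any group with SL_n(q) ≤ G ≤ GL_n(q). Let k be an integer with k > q^C, and choose x_0, x_1, …, x_k independently and uniformly at random from G. Then with probability at least 1 − q^{−c·n} there exists a word w in the free group F_{k+1} of reduced length at most q²·n^C such that w(x_0, x_1, …, x_k) is a transvection. -/

import Mathlib

/-- A transvection: determinant 1 and `rank(g - 1) = 1`. -/
def IsTransvection {n : ℕ} {F : Type} [Field F] (g : Matrix (Fin n) (Fin n) F) : Prop :=
  g.det = 1 ∧ (g - 1).rank = 1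

namespace TransvectionWords

open Module

section LinearAlgebra

variable {F V : Type*} [Field F] [AddCommGroup V] [Module F V]

/-- The group generated by the transvections whose linear form vanishes on `R`. -/
def transvectionGroup (R : Submodule F V) : Subgroup (V ≃ₗ[F] V) :=
  Subgroup.closure {g | ∃ (φ : Dual F V) (u : V) (h : φ u = 0),
    (∀ x ∈ R, φ x = 0) ∧ g = LinearEquiv.transvection h}

theorem transvection_mem_transvectionGroup {R : Submodule F V} {φ : Dual F V} {u : V}
    (h : φ u = 0) (hR : ∀ x ∈ R, φ x = 0) :
    LinearEquiv.transvection h ∈ transvectionGroup R :=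
  Subgroup.subset_closure ⟨φ, u, h, hR, rfl⟩

theorem transvectionGroup_anti {R R' : Submodule F V} (h : R ≤ R') :
    transvectionGroup R' ≤ transvectionGroup R := by
  refine Subgroup.closure_mono ?_
  rintro g ⟨φ, u, hu, hR, rfl⟩
  exact ⟨φ, u, hu, fun x hx => hR x (h hx), rfl⟩

theorem apply_of_mem_transvectionGroup {R : Submodule F V} {g : V ≃ₗ[F] V}
    (hg : g ∈ transvectionGroup R) {x : V} (hx : x ∈ R) : g x = x := by
  induction hg using Subgroup.closure_induction with
  | mem g hg =>
    obtain ⟨φ, u, hu, hR, rfl⟩ := hg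
    rw [LinearEquiv.transvection.apply, hR x hx, zero_smul, add_zero]
  | one => rfl
  | mul a b _ _ ha hb => rw [LinearEquiv.mul_apply, hb, ha]
  | inv a _ ha => exact (LinearEquiv.symm_apply_eq a).2 ha.symm

theorem det_of_mem_transvectionGroup [FiniteDimensional F V] {R : Submodule F V} {g : V ≃ₗ[F] V}
    (hg : g ∈ transvectionGroup R) : LinearEquiv.det g = 1 := by
  induction hg using Subgroup.closure_induction with
  | mem g hg =>
    obtain ⟨φ, u, hu, hR, rfl⟩ := hg
    exact LinearEquiv.transvection.det_eq_one hu
  | one => simp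
  | mul a b _ _ ha hb => rw [map_mul, ha, hb, one_mul]
  | inv a _ ha => rw [map_inv, ha, inv_one]

theorem exists_dual_eq_one {p : Submodule F V} {v : V} (hv : v ∉ p) :
    ∃ φ : Dual F V, φ v = 1 ∧ ∀ x ∈ p, φ x = 0 := by
  obtain ⟨φ, h1, h2⟩ := Submodule.exists_le_ker_of_notMem hv
  refine ⟨(φ v)⁻¹ • φ, by simp [h1], fun x hx => ?_⟩
  have : φ x = 0 := h2 hx
  simp [this]

theorem exists_transvection_apply_eq {R : Submodule F V} {z z' : V} (hz : z ∉ R)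
    (hz' : z' ∉ R ⊔ F ∙ z) : ∃ p ∈ transvectionGroup R, p z = z' := by
  have hn : z ∉ R ⊔ F ∙ (z' - z) := by
    intro h
    obtain ⟨r, hr, y, hy, hry⟩ := Submodule.mem_sup.1 h
    obtain ⟨c, rfl⟩ := Submodule.mem_span_singleton.1 hy
    by_cases hc : c = 0
    · subst hc
      apply hz
      rw [← hry]
      simpa using hr
    · apply hz'
      have : z' = (-c⁻¹) • r + (1 + c⁻¹) • z := by
        have h2 : c • z' = z - r + c • z := by
          linear_combination (norm := module) hry
        have h3 : z' = c⁻¹ • (c • z') := by rw [smul_smul, inv_mul_cancel₀ hc, one_smul]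
        rw [h3, h2, smul_add, smul_sub, smul_smul, inv_mul_cancel₀ hc]
        module
      rw [this]
      exact Submodule.add_mem_sup (R.smul_mem _ hr)
        (Submodule.smul_mem _ _ (Submodule.mem_span_singleton_self z))
  obtain ⟨φ, h1, h2⟩ := exists_dual_eq_one hn
  have hu : φ (z' - z) = 0 :=
    h2 _ (Submodule.mem_sup_right (Submodule.mem_span_singleton_self _))
  refine ⟨LinearEquiv.transvection hu,
    transvection_mem_transvectionGroup hu fun x hx => h2 x (Submodule.mem_sup_left hx), ?_⟩
  rw [LinearEquiv.transvection.apply, h1, one_smul]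
  abel

theorem exists_notMem_of_finrank_lt {R : Submodule F V} (h : finrank F R < finrank F V) :
    ∃ z, z ∉ R := by
  by_contra! H
  have : R = ⊤ := eq_top_iff.2 fun x _ => H x
  subst this
  simp at h

theorem notMem_sup_span_of_linearIndependent_mkQ {R : Submodule F V} {t : ℕ} {κ : Fin (t + 1) → V}
    (h : LinearIndependent F (fun i => R.mkQ (κ i))) :
    κ (Fin.last t) ∉ R ⊔ Submodule.span F (Set.range (Fin.init κ)) := by
  rw [linearIndependent_finSucc'] at h
  intro hmem
  apply h.2
  have : R.mkQ (κ (Fin.last t)) ∈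
      (R ⊔ Submodule.span F (Set.range (Fin.init κ))).map R.mkQ :=
    Submodule.mem_map_of_mem hmem
  rw [Submodule.map_sup, Submodule.map_span, ← Set.range_comp] at this
  have hb : R.map R.mkQ = ⊥ := by
    rw [← LinearMap.le_ker_iff_map, Submodule.ker_mkQ]
  rw [hb, bot_sup_eq] at this
  exact this

variable [FiniteDimensional F V]

theorem finrank_sup_span_singleton_le (R : Submodule F V) (z : V) :
    finrank F ↥(R ⊔ F ∙ z) ≤ finrank F R + 1 :=
  (Submodule.finrank_add_le_finrank_add_finrank _ _).trans
    (Nat.add_le_add_left ((finrank_span_le_card ({z} : Set V)).trans (by simp)) _)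

theorem exists_mem_transvectionGroup_apply_eq {R : Submodule F V}
    (hR : finrank F R + 2 ≤ finrank F V) {z z' : V} (hz : z ∉ R) (hz' : z' ∉ R) :
    ∃ p ∈ transvectionGroup R, p z = z' := by
  by_cases h : z' ∈ R ⊔ F ∙ z
  · obtain ⟨y, hy⟩ := exists_notMem_of_finrank_lt (R := R ⊔ F ∙ z)
      ((finrank_sup_span_singleton_le R z).trans_lt (by omega))
    obtain ⟨p, hp, hpz⟩ := exists_transvection_apply_eq hz hy
    have hy' : y ∉ R ⊔ F ∙ z' := fun hyz => hy <| by
      refine (sup_le le_sup_left ?_ : R ⊔ F ∙ z' ≤ R ⊔ F ∙ z) hyz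
      rwa [Submodule.span_singleton_le_iff_mem]
    obtain ⟨p', hp', hpz'⟩ := exists_transvection_apply_eq hz' hy'
    refine ⟨p'⁻¹ * p, mul_mem (inv_mem hp') hp, ?_⟩
    rw [LinearEquiv.mul_apply, hpz, ← hpz']
    exact p'.symm_apply_apply z'
  · exact exists_transvection_apply_eq hz h

theorem exists_mem_transvectionGroup_apply_tuple_eq {R : Submodule F V} {t : ℕ}
    (hR : finrank F R + t + 1 ≤ finrank F V) {κ κ' : Fin t → V}
    (h : LinearIndependent F (fun i => R.mkQ (κ i)))
    (h' : LinearIndependent F (fun i => R.mkQ (κ' i))) :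
    ∃ p ∈ transvectionGroup R, ∀ i, p (κ i) = κ' i := by
  induction t with
  | zero => exact ⟨1, one_mem _, fun i => i.elim0⟩
  | succ t ih =>
    obtain ⟨p, hp, hpκ⟩ := ih (κ := Fin.init κ) (κ' := Fin.init κ') (by omega)
      ((linearIndependent_finSucc'.1 h).1) ((linearIndependent_finSucc'.1 h').1)
    set S := R ⊔ Submodule.span F (Set.range (Fin.init κ')) with hS
    have h1 : κ' (Fin.last t) ∉ S := notMem_sup_span_of_linearIndependent_mkQ h'
    have h2 : p (κ (Fin.last t)) ∉ S := by
      intro hm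
      apply notMem_sup_span_of_linearIndependent_mkQ h
      have hle : S ≤ (R ⊔ Submodule.span F (Set.range (Fin.init κ))).map
          (p : V →ₗ[F] V) := by
        rw [Submodule.map_sup, Submodule.map_span, ← Set.range_comp]
        refine sup_le_sup (fun x hx => ⟨x, hx, apply_of_mem_transvectionGroup hp hx⟩) ?_
        refine Submodule.span_mono ?_
        rintro _ ⟨i, rfl⟩
        exact ⟨i, hpκ i⟩
      obtain ⟨y, hy, hyp⟩ := hle hm
      rwa [p.injective hyp] at hy
    have h3 : finrank F S ≤ finrank F R + t := by
      refine (Submodule.finrank_add_le_finrank_add_finrank _ _).trans (Nat.add_le_add_left ?_ _)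
      exact (finrank_range_le_card _).trans (by simp)
    obtain ⟨p', hp', hpz⟩ := exists_mem_transvectionGroup_apply_eq (R := S) (by omega) h2 h1
    refine ⟨p' * p, mul_mem (transvectionGroup_anti le_sup_left hp') hp, fun i => ?_⟩
    rw [LinearEquiv.mul_apply]
    refine Fin.lastCases hpz (fun j => ?_) i
    have := hpκ j
    rw [Fin.init, Fin.init] at this
    rw [this]
    exact apply_of_mem_transvectionGroup hp'
      (Submodule.mem_sup_right (Submodule.subset_span ⟨j, rfl⟩))

theorem exists_transvection_eq_of_hyperplane {R : Submodule F V}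
    (hR : finrank F R + 1 = finrank F V) {g : V ≃ₗ[F] V} (hg : ∀ x ∈ R, g x = x)
    (hdet : LinearEquiv.det g = 1) : g ∈ transvectionGroup R := by
  obtain ⟨z, hz⟩ := exists_notMem_of_finrank_lt (R := R) (by omega)
  obtain ⟨φ, h1, h2⟩ := exists_dual_eq_one hz
  have hspan : ∀ x, x - φ x • z ∈ R := by
    intro x
    have htop : R ⊔ F ∙ z = ⊤ := by
      apply Submodule.eq_top_of_finrank_eq
      refine le_antisymm (Submodule.finrank_le _) ?_
      rw [← hR]
      refine Submodule.finrank_lt_finrank_of_lt (lt_of_le_of_ne le_sup_left fun h => hz ?_)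
      rw [h]
      exact Submodule.mem_sup_right (Submodule.mem_span_singleton_self z)
    obtain ⟨r, hr, y, hy, hry⟩ := Submodule.mem_sup.1 (htop ▸ Submodule.mem_top : x ∈ R ⊔ F ∙ z)
    obtain ⟨c, rfl⟩ := Submodule.mem_span_singleton.1 hy
    have : x - φ x • z = r := by
      rw [← hry, map_add, map_smul, h2 r hr, h1]
      simp
    rwa [this]
  have hform : ∀ x, g x = x + φ x • (g z - z) := by
    intro x
    have := hg _ (hspan x)
    rw [map_sub, map_smul, sub_eq_iff_eq_add] at this
    rw [this]
    module
  have hlin : (g : V →ₗ[F] V) = LinearMap.transvection φ (g z - z) := by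
    ext x
    rw [LinearMap.transvection.apply]
    exact hform x
  have hφ : φ (g z - z) = 0 := by
    have := congrArg Units.val hdet
    rw [LinearEquiv.coe_det, hlin, LinearMap.transvection.det] at this
    simpa using this
  have : g = LinearEquiv.transvection hφ := by
    ext x
    rw [hform, LinearEquiv.transvection.apply]
  rw [this]
  exact transvection_mem_transvectionGroup _ h2

theorem mem_transvectionGroup_of_fix {R : Submodule F V}
    (hR : finrank F R < finrank F V) {g : V ≃ₗ[F] V} (hg : ∀ x ∈ R, g x = x)
    (hdet : LinearEquiv.det g = 1) : g ∈ transvectionGroup R := by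
  obtain ⟨d, hd⟩ : ∃ d, finrank F V = finrank F R + d + 1 :=
    ⟨finrank F V - finrank F R - 1, by omega⟩
  induction d generalizing R g with
  | zero => exact exists_transvection_eq_of_hyperplane hd.symm hg hdet
  | succ d ih =>
    obtain ⟨z, hz⟩ := exists_notMem_of_finrank_lt hR
    have hgz : g z ∉ R := fun h => hz <| by
      have := hg _ h
      rwa [g.injective this] at h
    obtain ⟨p, hp, hpz⟩ := exists_mem_transvectionGroup_apply_eq (by omega) hz hgz
    have hlt : finrank F R < finrank F ↥(R ⊔ F ∙ z) :=
      Submodule.finrank_lt_finrank_of_lt (lt_of_le_of_ne le_sup_left fun h => hz <| by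
        rw [h]
        exact Submodule.mem_sup_right (Submodule.mem_span_singleton_self z))
    have hle := finrank_sup_span_singleton_le R z
    have key : p⁻¹ * g ∈ transvectionGroup (R ⊔ F ∙ z) := by
      refine ih (by omega) ?_ ?_ (by omega)
      · have hpi : ∀ x, p x = g x → (p⁻¹ * g) x = x := fun x hx => by
          rw [LinearEquiv.mul_apply, ← hx]
          exact p.symm_apply_apply x
        intro x hx
        obtain ⟨r, hr, y, hy, rfl⟩ := Submodule.mem_sup.1 hx
        obtain ⟨c, rfl⟩ := Submodule.mem_span_singleton.1 hy
        apply hpi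
        rw [map_add, map_add, map_smul, map_smul, hpz, hg r hr,
          apply_of_mem_transvectionGroup hp hr]
      · rw [map_mul, map_inv, hdet, det_of_mem_transvectionGroup hp]
        simp
    have := mul_mem hp (transvectionGroup_anti le_sup_left key)
    rwa [mul_inv_cancel_left] at this

end LinearAlgebra

end TransvectionWords

namespace TransvectionWords

open Module

section ClassAverage

open scoped ComplexConjugate

variable {Γ : Type*} [Group Γ]

/-- Functions of mean zero on every coset of `N`. -/
def zeroMean (N : Subgroup Γ) [Fintype N] : Submodule ℂ (Γ → ℂ) where
  carrier := {w | ∀ g, ∑ s : N, w (g * s) = 0}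
  zero_mem' := by simp
  add_mem' {w w'} hw hw' g := by simp [Finset.sum_add_distrib, hw g, hw' g]
  smul_mem' c w hw g := by simp [← Finset.mul_sum, hw g]

theorem translate_mem_zeroMean {N : Subgroup Γ} [Fintype N] [N.Normal] {w : Γ → ℂ}
    (hw : w ∈ zeroMean N) (a : Γ) : (fun g => w (g * a)) ∈ zeroMean N := by
  intro g
  rw [← hw (g * a), ← Equiv.sum_comp (MulAut.conjNormal (H := N) a).toEquiv]
  refine Finset.sum_congr rfl fun s _ => ?_
  simp [mul_assoc]

variable [Fintype Γ]

/-- Average of `w` over the translates of `g` by the conjugates of `h`. -/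
noncomputable def classAverage (h : Γ) : (Γ → ℂ) →ₗ[ℂ] (Γ → ℂ) where
  toFun w g := (Fintype.card Γ : ℂ)⁻¹ * ∑ y : Γ, w (g * (y * h * y⁻¹))
  map_add' w w' := by
    ext g
    simp [Finset.sum_add_distrib, mul_add]
  map_smul' c w := by
    ext g
    simp only [Pi.smul_apply, smul_eq_mul, RingHom.id_apply, ← Finset.mul_sum]
    ring

theorem classAverage_apply (h : Γ) (w : Γ → ℂ) (g : Γ) :
    classAverage h w g = (Fintype.card Γ : ℂ)⁻¹ * ∑ y : Γ, w (g * (y * h * y⁻¹)) := rfl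

/-- The symmetrisation of `classAverage`. -/
noncomputable def symmAverage (h : Γ) : (Γ → ℂ) →ₗ[ℂ] (Γ → ℂ) :=
  (2⁻¹ : ℂ) • (classAverage h + classAverage h⁻¹)

theorem symmAverage_apply (h : Γ) (w : Γ → ℂ) (g : Γ) :
    symmAverage h w g = 2⁻¹ * (classAverage h w g + classAverage h⁻¹ w g) := rfl

theorem classAverage_mem_zeroMean {N : Subgroup Γ} [Fintype N] [N.Normal] (h : Γ) {w : Γ → ℂ}
    (hw : w ∈ zeroMean N) : classAverage h w ∈ zeroMean N := by
  intro g
  simp only [classAverage_apply]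
  rw [← Finset.mul_sum, Finset.sum_comm]
  rw [Finset.sum_eq_zero fun y _ => translate_mem_zeroMean hw (y * h * y⁻¹) g, mul_zero]

theorem symmAverage_mem_zeroMean {N : Subgroup Γ} [Fintype N] [N.Normal] (h : Γ) {w : Γ → ℂ}
    (hw : w ∈ zeroMean N) : symmAverage h w ∈ zeroMean N :=
  Submodule.smul_mem _ _ (Submodule.add_mem _ (classAverage_mem_zeroMean h hw)
    (classAverage_mem_zeroMean h⁻¹ hw))

theorem sum_conj_classAverage_mul (h : Γ) (w w' : Γ → ℂ) :
    ∑ g, conj (classAverage h w g) * w' g = ∑ g, conj (w g) * classAverage h⁻¹ w' g := by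
  simp only [classAverage_apply, map_mul, map_sum, Finset.mul_sum, Finset.sum_mul]
  rw [Finset.sum_comm]
  conv_rhs => rw [Finset.sum_comm]
  refine Finset.sum_congr rfl fun y _ => ?_
  rw [← Equiv.sum_comp (Equiv.mulRight (y * h * y⁻¹)) (fun g => conj (w g) * _)]
  refine Finset.sum_congr rfl fun g _ => ?_
  have : g * (y * h * y⁻¹) * (y * h⁻¹ * y⁻¹) = g := by group
  simp only [Equiv.coe_mulRight, this]
  simp
  ring

theorem sum_conj_symmAverage_mul (h : Γ) (w w' : Γ → ℂ) :
    ∑ g, conj (symmAverage h w g) * w' g = ∑ g, conj (w g) * symmAverage h w' g := by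
  have h1 := sum_conj_classAverage_mul h w w'
  have h2 := sum_conj_classAverage_mul h⁻¹ w w'
  rw [inv_inv] at h2
  simp only [symmAverage_apply]
  calc _ = 2⁻¹ * (∑ g, conj (classAverage h w g) * w' g
        + ∑ g, conj (classAverage h⁻¹ w g) * w' g) := by
        rw [← Finset.sum_add_distrib, Finset.mul_sum]
        refine Finset.sum_congr rfl fun g _ => ?_
        simp only [map_mul, map_add, map_inv₀, Complex.conj_ofNat]
        ring
    _ = _ := by
        rw [h1, h2, ← Finset.sum_add_distrib, Finset.mul_sum]
        refine Finset.sum_congr rfl fun g _ => ?_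
        ring

theorem sum_mul_classAverage_of_class {f : Γ → ℝ} (hf : ∀ y g, f (y * g * y⁻¹) = f g) (h : Γ) :
    ∑ g, (f g : ℂ) * classAverage h (fun x => (f x : ℂ)) g =
      ((∑ g, f g * f (g * h) : ℝ) : ℂ) := by
  simp only [classAverage_apply, Finset.mul_sum]
  rw [Finset.sum_comm]
  have : ∀ y : Γ, ∑ g, (f g : ℂ) * ((Fintype.card Γ : ℂ)⁻¹ * (f (g * (y * h * y⁻¹)) : ℂ)) =
      (Fintype.card Γ : ℂ)⁻¹ * ((∑ g, f g * f (g * h) : ℝ) : ℂ) := by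
    intro y
    rw [← Equiv.sum_comp (MulAut.conj y).toEquiv]
    push_cast
    rw [Finset.mul_sum]
    refine Finset.sum_congr rfl fun g _ => ?_
    have h1 : f (MulAut.conj y g) = f g := hf y g
    have h2 : f (MulAut.conj y g * (y * h * y⁻¹)) = f (g * h) := by
      rw [← hf y (g * h)]
      congr 1
      simp [mul_assoc]
    simp only [MulEquiv.toEquiv_eq_coe, EquivLike.coe_coe, h1, h2]
    ring
  rw [Finset.sum_congr rfl fun y _ => this y, Finset.sum_const, Finset.card_univ, nsmul_eq_mul,
    ← mul_assoc, mul_inv_cancel₀, one_mul]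
  exact Nat.cast_ne_zero.2 Fintype.card_ne_zero

theorem sum_mul_symmAverage_of_class {f : Γ → ℝ} (hf : ∀ y g, f (y * g * y⁻¹) = f g) (h : Γ) :
    ∑ g, (f g : ℂ) * symmAverage h (fun x => (f x : ℂ)) g =
      ((∑ g, f g * f (g * h) : ℝ) : ℂ) := by
  have h1 := sum_mul_classAverage_of_class hf h
  have h2 := sum_mul_classAverage_of_class hf h⁻¹
  have h3 : ∑ g, f g * f (g * h⁻¹) = ∑ g, f g * f (g * h) := by
    rw [← Equiv.sum_comp (Equiv.mulRight h)]
    refine Finset.sum_congr rfl fun g _ => ?_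
    simp [mul_comm]
  rw [h3] at h2
  simp only [symmAverage_apply, mul_left_comm _ (2⁻¹ : ℂ), mul_add, Finset.sum_add_distrib]
  rw [← Finset.mul_sum, ← Finset.mul_sum, h1, h2]
  ring

/-- A bound for the eigenvalues of `symmAverage h` on `zeroMean N` bounds the correlation of a
class function with its translate by `h`. -/
theorem abs_sum_mul_translate_le {N : Subgroup Γ} [Fintype N] [N.Normal] {h : Γ} {Λ : ℝ}
    (hΛ : ∀ (μ : ℝ) (w : Γ → ℂ), w ∈ zeroMean N → w ≠ 0 → symmAverage h w = (μ : ℂ) • w → |μ| ≤ Λ)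
    {f : Γ → ℝ} (hf : ∀ y g, f (y * g * y⁻¹) = f g) (hN : ∀ g, ∑ s : N, f (g * s) = 0) :
    |∑ g, f g * f (g * h)| ≤ Λ * ∑ g, f g ^ 2 := by
  let e : EuclideanSpace ℂ Γ ≃ₗ[ℂ] (Γ → ℂ) := WithLp.linearEquiv 2 ℂ (Γ → ℂ)
  let B : EuclideanSpace ℂ Γ →ₗ[ℂ] EuclideanSpace ℂ Γ :=
    e.symm.toLinearMap ∘ₗ symmAverage h ∘ₗ e.toLinearMap
  let H : Submodule ℂ (EuclideanSpace ℂ Γ) := (zeroMean N).comap e.toLinearMap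
  have hB : B.IsSymmetric := by
    intro w w'
    rw [PiLp.inner_apply, PiLp.inner_apply]
    have := sum_conj_symmAverage_mul h (e w) (e w')
    simp only [RCLike.inner_apply, mul_comm _ (conj _)]
    exact this
  have hinv : ∀ v ∈ H, B v ∈ H := fun v hv => symmAverage_mem_zeroMean h hv
  have hT := hB.restrict_invariant hinv
  set T := B.restrict hinv with hTdef
  let b := hT.eigenvectorBasis rfl
  have hfmem : e.symm (fun x => (f x : ℂ)) ∈ H := by
    intro g
    have := hN g
    change ∑ s : N, ((f (g * s) : ℝ) : ℂ) = 0
    exact_mod_cast this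
  let φ : H := ⟨e.symm (fun x => (f x : ℂ)), hfmem⟩
  have heig : ∀ i, |hT.eigenvalues rfl i| ≤ Λ := by
    intro i
    have h1 := hT.apply_eigenvectorBasis rfl i
    refine hΛ _ (e (b i : EuclideanSpace ℂ Γ)) (b i).2 ?_ ?_
    · intro h0
      have : b i = 0 := Subtype.ext (e.map_eq_zero_iff.1 h0)
      exact b.toBasis.ne_zero i (by simpa using this)
    · have h2 := congrArg (fun v : H => e (v : EuclideanSpace ℂ Γ)) h1
      exact h2
  have hinner : inner ℂ φ (T φ) = ((∑ g, f g * f (g * h) : ℝ) : ℂ) := by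
    rw [← sum_mul_symmAverage_of_class hf h]
    change inner ℂ (φ : EuclideanSpace ℂ Γ) (B φ) = _
    rw [PiLp.inner_apply]
    refine Finset.sum_congr rfl fun g _ => ?_
    rw [RCLike.inner_apply, mul_comm]
    congr 1
    exact Complex.conj_ofReal (f g)
  have hnorm : ‖φ‖ ^ 2 = ∑ g, f g ^ 2 := by
    change ‖(φ : EuclideanSpace ℂ Γ)‖ ^ 2 = _
    rw [EuclideanSpace.norm_sq_eq]
    refine Finset.sum_congr rfl fun g _ => ?_
    change ‖(f g : ℂ)‖ ^ 2 = _
    rw [Complex.norm_real, Real.norm_eq_abs, sq_abs]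
  have hterm : ∀ i, ‖inner ℂ φ (b i) * inner ℂ (b i) (T φ)‖ ≤ Λ * ‖inner ℂ (b i) φ‖ ^ 2 := by
    intro i
    have h1 : inner ℂ (b i) (T φ) = (hT.eigenvalues rfl i : ℂ) * inner ℂ (b i) φ := by
      rw [← hT (b i) φ, hT.apply_eigenvectorBasis rfl i, inner_smul_left]
      simp [b]
    have h2 : ‖inner ℂ φ (b i)‖ = ‖inner ℂ (b i) φ‖ :=
      norm_inner_symm (𝕜 := ℂ) (E := H) φ (b i)
    rw [h1, norm_mul, norm_mul, h2, Complex.norm_real, Real.norm_eq_abs]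
    calc _ = |hT.eigenvalues rfl i| * ‖inner ℂ (b i) φ‖ ^ 2 := by ring
      _ ≤ _ := mul_le_mul_of_nonneg_right (heig i) (sq_nonneg _)
  rw [← hnorm, ← Real.norm_eq_abs, ← Complex.norm_real, ← hinner, ← b.sum_inner_mul_inner,
    ← b.sum_sq_norm_inner_right, Finset.mul_sum]
  exact norm_sum_le_of_le _ fun i _ => hterm i

theorem card_conj_eq_conj (h : Γ) [DecidableEq Γ] :
    ∑ y : Γ, ∑ y' : Γ, (if y * h * y⁻¹ = y' * h * y'⁻¹ then (1 : ℝ) else 0) =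
      Fintype.card Γ * Nat.card (Subgroup.centralizer {h}) := by
  classical
  have : ∀ y : Γ, ∑ y' : Γ, (if y * h * y⁻¹ = y' * h * y'⁻¹ then (1 : ℝ) else 0) =
      Nat.card (Subgroup.centralizer {h}) := by
    intro y
    rw [← Equiv.sum_comp (Equiv.mulLeft y)]
    rw [Finset.sum_boole, Nat.card_eq_fintype_card, Fintype.card_subtype]
    congr 2
    ext c
    rw [Finset.mem_filter, Finset.mem_filter]
    simp only [Finset.mem_univ, true_and, Equiv.coe_mulLeft,
      Subgroup.mem_centralizer_singleton_iff]
    rw [show y * c * h * (y * c)⁻¹ = y * (c * h * c⁻¹) * y⁻¹ by group]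
    rw [mul_left_inj, mul_right_inj, eq_mul_inv_iff_mul_eq]
    exact eq_comm
  rw [Finset.sum_congr rfl fun y _ => this y]
  simp

theorem sum_norm_sq_classAverage_le {I : Type*} [Fintype I] {v : I → EuclideanSpace ℂ Γ}
    (hv : Orthonormal ℂ v) (h g : Γ) :
    ∑ i, ‖classAverage h (v i) g‖ ^ 2 ≤
      (Fintype.card Γ : ℝ)⁻¹ * Nat.card (Subgroup.centralizer {h}) := by
  classical
  let a : EuclideanSpace ℂ Γ :=
    ∑ y : Γ, EuclideanSpace.single (g * (y * h * y⁻¹)) (1 : ℂ)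
  have hinner : ∀ u : EuclideanSpace ℂ Γ, inner ℂ a u = ∑ y : Γ, u (g * (y * h * y⁻¹)) := by
    intro u
    simp [a, EuclideanSpace.inner_single_left]
  have hcard : (0 : ℝ) < Fintype.card Γ := Nat.cast_pos.2 Fintype.card_pos
  have hna : ‖a‖ ^ 2 = Fintype.card Γ * Nat.card (Subgroup.centralizer {h}) := by
    have h1 : inner ℂ a a = ((‖a‖ ^ 2 : ℝ) : ℂ) := by
      rw [inner_self_eq_norm_sq_to_K]
      norm_cast
    rw [hinner] at h1
    apply Complex.ofReal_injective
    rw [← h1, ← card_conj_eq_conj]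
    push_cast
    refine Finset.sum_congr rfl fun y _ => ?_
    simp [a, Pi.single_apply, apply_ite Complex.ofReal]
  have hterm : ∀ i, ‖classAverage h (v i) g‖ ^ 2 =
      ((Fintype.card Γ : ℝ) ^ 2)⁻¹ * ‖inner ℂ (v i) a‖ ^ 2 := by
    intro i
    rw [norm_inner_symm, hinner, classAverage_apply, norm_mul, mul_pow]
    simp
  rw [Finset.sum_congr rfl fun i _ => hterm i, ← Finset.mul_sum]
  calc _ ≤ ((Fintype.card Γ : ℝ) ^ 2)⁻¹ * ‖a‖ ^ 2 := by
        gcongr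
        exact hv.sum_inner_products_le a
    _ = _ := by
        rw [hna]
        field_simp

/-- The dimension of an eigenspace of `symmAverage h` is controlled by the centralizer of `h`. -/
theorem sq_mul_card_le_card_centralizer {I : Type*} [Fintype I] {w : I → Γ → ℂ}
    (hne : ∀ i, w i ≠ 0) (horth : ∀ i j, i ≠ j → ∑ g, conj (w i g) * w j g = 0)
    {h : Γ} {μ : ℝ} (hw : ∀ i, symmAverage h (w i) = (μ : ℂ) • w i) :
    μ ^ 2 * Fintype.card I ≤ Nat.card (Subgroup.centralizer {h}) := by
  let u : I → EuclideanSpace ℂ Γ := fun i => WithLp.toLp 2 (w i)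
  have hu : ∀ i, ‖u i‖ ≠ 0 := fun i h0 => hne i <| by
    have := norm_eq_zero.1 h0
    exact congrArg WithLp.ofLp this
  let v : I → EuclideanSpace ℂ Γ := fun i => ((‖u i‖ : ℂ)⁻¹) • u i
  have hv : Orthonormal ℂ v := by
    refine ⟨fun i => ?_, fun i j hij => ?_⟩
    · simp [v, norm_smul, hu i]
    · simp only [v, inner_smul_left, inner_smul_right]
      have : inner ℂ (u i) (u j) = 0 := by
        rw [PiLp.inner_apply, ← horth i j hij]
        refine Finset.sum_congr rfl fun g _ => ?_
        rw [RCLike.inner_apply, mul_comm]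
      simp [this]
  have hvw : ∀ i, symmAverage h (v i) = (μ : ℂ) • (v i : Γ → ℂ) := by
    intro i
    have : (v i : Γ → ℂ) = ((‖u i‖ : ℂ)⁻¹) • w i := rfl
    rw [this, map_smul, hw, smul_comm]
  have hcard : (0 : ℝ) < Fintype.card Γ := Nat.cast_pos.2 Fintype.card_pos
  have hci : Subgroup.centralizer {h⁻¹} = Subgroup.centralizer {h} := by
    ext c
    rw [Subgroup.mem_centralizer_singleton_iff, Subgroup.mem_centralizer_singleton_iff]
    exact Commute.inv_right_iff
  have hpt : ∀ i g, μ ^ 2 * ‖v i g‖ ^ 2 ≤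
      2⁻¹ * (‖classAverage h (v i) g‖ ^ 2 + ‖classAverage h⁻¹ (v i) g‖ ^ 2) := by
    intro i g
    have h1 : (μ : ℂ) * v i g = 2⁻¹ * (classAverage h (v i) g + classAverage h⁻¹ (v i) g) := by
      rw [← symmAverage_apply, hvw i]
      rfl
    have h2 : μ ^ 2 * ‖v i g‖ ^ 2 = ‖(μ : ℂ) * v i g‖ ^ 2 := by
      rw [norm_mul, mul_pow, Complex.norm_real, Real.norm_eq_abs, sq_abs]
    rw [h2, h1, norm_mul]
    have h3 := norm_add_le (classAverage h (v i) g) (classAverage h⁻¹ (v i) g)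
    have h4 : ‖(2⁻¹ : ℂ)‖ = 2⁻¹ := by simp
    rw [h4]
    nlinarith [norm_nonneg (classAverage h (v i) g + classAverage h⁻¹ (v i) g),
      sq_nonneg (‖classAverage h (v i) g‖ - ‖classAverage h⁻¹ (v i) g‖),
      norm_nonneg (classAverage h (v i) g), norm_nonneg (classAverage h⁻¹ (v i) g)]
  calc μ ^ 2 * Fintype.card I = ∑ i, ∑ g, μ ^ 2 * ‖v i g‖ ^ 2 := by
        have : ∀ i, ∑ g, μ ^ 2 * ‖v i g‖ ^ 2 = μ ^ 2 := by
          intro i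
          rw [← Finset.mul_sum, ← EuclideanSpace.norm_sq_eq, hv.1 i]
          simp
        rw [Finset.sum_congr rfl fun i _ => this i]
        simp [mul_comm]
    _ = ∑ g, ∑ i, μ ^ 2 * ‖v i g‖ ^ 2 := Finset.sum_comm
    _ ≤ ∑ g : Γ, (Fintype.card Γ : ℝ)⁻¹ * Nat.card (Subgroup.centralizer {h}) := by
        refine Finset.sum_le_sum fun g _ => ?_
        refine (Finset.sum_le_sum fun i _ => hpt i g).trans ?_
        rw [← Finset.mul_sum, Finset.sum_add_distrib]
        have h1 := sum_norm_sq_classAverage_le hv h g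
        have h2 := sum_norm_sq_classAverage_le hv h⁻¹ g
        rw [hci] at h2
        linarith
    _ = _ := by
        rw [Finset.sum_const, Finset.card_univ, nsmul_eq_mul]
        field_simp

end ClassAverage

end TransvectionWords

namespace TransvectionWords

open Module

section Weights

open scoped ComplexConjugate

variable {F V : Type*} [Field F] [AddCommGroup V] [Module F V]

theorem transvection_mul_transvection {φ φ' : Dual F V} {u : V} (h : φ u = 0) (h' : φ' u = 0) :
    (LinearEquiv.transvection h * LinearEquiv.transvection h' : V ≃ₗ[F] V) =
      LinearEquiv.transvection (f := φ + φ') (v := u) (by simp [h, h']) := by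
  ext x
  simp only [LinearEquiv.mul_apply, LinearEquiv.transvection.apply, map_add, map_smul, h,
    LinearMap.add_apply, add_smul]
  simp
  abel

theorem transvection_mul_transvection_right {φ : Dual F V} {u u' : V} (h : φ u = 0)
    (h' : φ u' = 0) :
    (LinearEquiv.transvection h * LinearEquiv.transvection h' : V ≃ₗ[F] V) =
      LinearEquiv.transvection (f := φ) (v := u + u') (by simp [h, h']) := by
  ext x
  simp only [LinearEquiv.mul_apply, LinearEquiv.transvection.apply, map_add, map_smul, h',
    smul_add]
  simp
  abel

theorem transvection_commute {φ φ' : Dual F V} {u u' : V} (h : φ u = 0) (h' : φ' u' = 0)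
    (h1 : φ u' = 0) (h2 : φ' u = 0) :
    (LinearEquiv.transvection h * LinearEquiv.transvection h' : V ≃ₗ[F] V) =
      LinearEquiv.transvection h' * LinearEquiv.transvection h := by
  ext x
  simp only [LinearEquiv.mul_apply, LinearEquiv.transvection.apply, map_add, map_smul, h1, h2]
  simp
  abel

theorem transvection_mul_eq_mul_transvection (a : V ≃ₗ[F] V) {φ : Dual F V} {u : V}
    (h : φ (a u) = 0) :
    (LinearEquiv.transvection h * a : V ≃ₗ[F] V) =
      a * LinearEquiv.transvection (f := φ ∘ₗ a.toLinearMap) (v := u) h := by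
  ext x
  simp only [LinearEquiv.mul_apply, LinearEquiv.transvection.apply, map_add, map_smul]
  rfl

variable (ψ : AddChar F ℂ)

/-- Functions on which the transvections along `e i` act through the character attached
to `f i`. -/
def weightSpace {r : ℕ} (e f : Fin r → V) : Submodule ℂ ((V ≃ₗ[F] V) → ℂ) where
  carrier := {w | ∀ (i : Fin r) (φ : Dual F V) (hφ : ∀ l, φ (e l) = 0) (g : V ≃ₗ[F] V),
    w (g * LinearEquiv.transvection (hφ i)) = ψ (φ (f i)) * w g}
  zero_mem' := by simp
  add_mem' {w w'} hw hw' i φ hφ g := by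
    simp only [Pi.add_apply, hw i φ hφ g, hw' i φ hφ g, mul_add]
  smul_mem' c w hw i φ hφ g := by
    simp only [Pi.smul_apply, smul_eq_mul, hw i φ hφ g]
    ring

variable {ψ}

theorem translate_mem_weightSpace {r : ℕ} {e f : Fin r → V} {w : (V ≃ₗ[F] V) → ℂ}
    (hw : w ∈ weightSpace ψ e f) (a : V ≃ₗ[F] V) {e' f' : Fin r → V} (he : ∀ i, a (e i) = e' i)
    (hf : ∀ i, a (f i) = f' i) : (fun g => w (g * a)) ∈ weightSpace ψ e' f' := by
  obtain rfl : (fun i => a (e i)) = e' := funext he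
  obtain rfl : (fun i => a (f i)) = f' := funext hf
  intro i φ hφ g
  have := hw i (φ ∘ₗ a.toLinearMap) hφ (g * a)
  change w (g * LinearEquiv.transvection (hφ i) * a) = _
  rw [mul_assoc, transvection_mul_eq_mul_transvection, ← mul_assoc]
  exact this

variable (ψ) in
/-- Whether the translation invariant space `W` contains a nonzero function with an
`r`-dimensional weight. -/
def HasWeight (W : Submodule ℂ ((V ≃ₗ[F] V) → ℂ)) (r : ℕ) : Prop :=
  ∃ e f : Fin r → V, LinearIndependent F (Sum.elim e f) ∧ ∃ w ∈ W, w ≠ 0 ∧ w ∈ weightSpace ψ e f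

theorem translate_ne_zero {Γ : Type*} [Group Γ] {w : Γ → ℂ} (hw : w ≠ 0) (a : Γ) :
    (fun g => w (g * a)) ≠ 0 := fun h => hw <| funext fun g => by
  simpa using congrFun h (g * a⁻¹)

theorem HasWeight.exists_of_linearIndependent [FiniteDimensional F V]
    {W : Submodule ℂ ((V ≃ₗ[F] V) → ℂ)}
    (hW : ∀ w ∈ W, ∀ a, (fun g => w (g * a)) ∈ W) {r : ℕ} (h : HasWeight ψ W r)
    (hr : 2 * r + 1 ≤ finrank F V) {e f : Fin r → V} (hef : LinearIndependent F (Sum.elim e f)) :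
    ∃ w ∈ W, w ≠ 0 ∧ w ∈ weightSpace ψ e f := by
  obtain ⟨e₀, f₀, hef₀, w, hwW, hw0, hw⟩ := h
  have hbot : ∀ {κ : Fin (r + r) → V}, LinearIndependent F κ →
      LinearIndependent F (fun i => (⊥ : Submodule F V).mkQ (κ i)) := fun hκ =>
    hκ.map' _ (by rw [Submodule.ker_mkQ])
  obtain ⟨p, -, hp⟩ := exists_mem_transvectionGroup_apply_tuple_eq (R := (⊥ : Submodule F V))
    (by rw [finrank_bot]; omega)
    (hbot (hef₀.comp _ finSumFinEquiv.symm.injective))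
    (hbot (hef.comp _ finSumFinEquiv.symm.injective))
  refine ⟨fun g => w (g * p), hW w hwW p, translate_ne_zero hw0 p,
    translate_mem_weightSpace hw p (fun i => ?_) (fun i => ?_)⟩
  · simpa only [Function.comp_apply, Equiv.symm_apply_apply, Sum.elim_inl] using
      hp (finSumFinEquiv (Sum.inl i))
  · simpa only [Function.comp_apply, Equiv.symm_apply_apply, Sum.elim_inr] using
      hp (finSumFinEquiv (Sum.inr i))

theorem exists_dual_char_ne_one (hψ : ψ ≠ 1) {p : Submodule F V} {v : V} (hv : v ∉ p) :
    ∃ φ : Dual F V, ψ (φ v) ≠ 1 ∧ ∀ x ∈ p, φ x = 0 := by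
  obtain ⟨a, ha⟩ := AddChar.ne_one_iff.1 hψ
  obtain ⟨φ, h1, h2⟩ := exists_dual_eq_one hv
  exact ⟨a • φ, by simpa [h1] using ha, fun x hx => by simp [h2 x hx]⟩

variable [Fintype F] [Fintype (V ≃ₗ[F] V)]

theorem sum_conj_mul_eq_zero_of_char {w w' : (V ≃ₗ[F] V) → ℂ} {b : V ≃ₗ[F] V} {x y : F}
    (hw : ∀ g, w (g * b) = ψ x * w g) (hw' : ∀ g, w' (g * b) = ψ y * w' g)
    (hxy : ψ (y - x) ≠ 1) : ∑ g, conj (w g) * w' g = 0 := by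
  have h1 : ∑ g, conj (w g) * w' g = ψ (y - x) * ∑ g, conj (w g) * w' g := by
    conv_lhs => rw [← Equiv.sum_comp (Equiv.mulRight b)]
    rw [Finset.mul_sum]
    refine Finset.sum_congr rfl fun g _ => ?_
    simp only [Equiv.coe_mulRight, hw, hw', map_mul]
    rw [sub_eq_neg_add, AddChar.map_add_eq_mul, ← AddChar.map_neg_eq_conj]
    ring
  have h2 : (1 - ψ (y - x)) * ∑ g, conj (w g) * w' g = 0 := by
    rw [sub_mul, one_mul, ← h1, sub_self]
  exact (mul_eq_zero.1 h2).resolve_left (sub_ne_zero.2 (Ne.symm hxy))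

variable [FiniteDimensional F V]

/-- A large weight forces the eigenspace to be large, hence the eigenvalue to be small. -/
theorem HasWeight.sq_mul_pow_le (hψ : ψ ≠ 1) {W : Submodule ℂ ((V ≃ₗ[F] V) → ℂ)}
    (hW : ∀ w ∈ W, ∀ a, (fun g => w (g * a)) ∈ W) {r : ℕ} (h : HasWeight ψ W r)
    (hr : 2 * r + 1 ≤ finrank F V) {μ : ℝ} {y : V ≃ₗ[F] V}
    (hμ : ∀ w ∈ W, symmAverage y w = (μ : ℂ) • w) :
    μ ^ 2 * (Fintype.card F : ℝ) ^ (r * (finrank F V - 2 * r)) ≤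
      Nat.card (Subgroup.centralizer {y}) := by
  classical
  have : Finite V := Module.finite_of_finite F
  obtain ⟨e, f, hef, -⟩ := id h
  obtain ⟨U, hU⟩ := (Submodule.span F (Set.range (Sum.elim e f))).exists_isCompl
  have hUdim : finrank F U = finrank F V - 2 * r := by
    have h1 := Submodule.finrank_add_eq_of_isCompl hU
    rw [finrank_span_eq_card hef] at h1
    simp at h1
    omega
  have := Fintype.ofFinite (Fin r → U)
  have hind : ∀ c : Fin r → U, LinearIndependent F (Sum.elim e fun i => f i + c i) := by
    intro c
    have hcomp : (Submodule.projection _ _ hU) ∘ (Sum.elim e fun i => f i + (c i : V)) =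
        Sum.elim e f := by
      funext i
      rcases i with i | i
      · exact Submodule.projection_apply_of_mem_left hU (Submodule.subset_span ⟨Sum.inl i, rfl⟩)
      · have h1 : (Submodule.projection _ _ hU) (f i) = f i :=
          Submodule.projection_apply_of_mem_left hU (Submodule.subset_span ⟨Sum.inr i, rfl⟩)
        have h2 : (Submodule.projection _ _ hU) (c i : V) = 0 :=
          Submodule.projection_apply_of_mem_right hU (c i).2
        rw [Function.comp_apply, Sum.elim_inr, Sum.elim_inr, map_add, h1, h2, add_zero]
    exact LinearIndependent.of_comp _ (hcomp ▸ hef)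
  choose w hwW hw0 hw using fun c => h.exists_of_linearIndependent hW hr (hind c)
  have key := sq_mul_card_le_card_centralizer hw0 (fun c c' hcc => ?_) (fun c => hμ _ (hwW c))
  · rw [← Nat.card_eq_fintype_card (α := Fin r → U), Nat.card_fun,
      Module.natCard_eq_pow_finrank (K := F), hUdim] at key
    simpa [← pow_mul, mul_comm] using key
  · obtain ⟨i, hi⟩ := Function.ne_iff.1 hcc
    have hnot : ((c' i : V) - c i) ∉ Submodule.span F (Set.range e) := by
      intro hmem
      apply hi
      have h1 : ((c' i : V) - c i) ∈ (⊥ : Submodule F V) := by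
        rw [← hU.inf_eq_bot]
        refine ⟨Submodule.span_mono ?_ hmem, U.sub_mem (c' i).2 (c i).2⟩
        rintro _ ⟨l, rfl⟩
        exact ⟨Sum.inl l, rfl⟩
      exact Subtype.ext (sub_eq_zero.1 ((Submodule.mem_bot F).1 h1)).symm
    obtain ⟨φ, h1, h2⟩ := exists_dual_char_ne_one hψ hnot
    have hφ : ∀ l, φ (e l) = 0 := fun l => h2 _ (Submodule.subset_span ⟨l, rfl⟩)
    refine sum_conj_mul_eq_zero_of_char (hw c i φ hφ) (hw c' i φ hφ) ?_
    rw [← map_sub]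
    simpa using h1

end Weights

section LowWeight

variable {F V : Type*} [Field F] [AddCommGroup V] [Module F V] {ψ : AddChar F ℂ}

variable (ψ) in
/-- Projection of `w` to the character `φ ↦ ψ (φ f)` of the group of transvections along `u` with
linear form in `A`, up to a scalar. -/
noncomputable def charProj (A : Submodule F (Dual F V)) [Fintype A] {u : V}
    (hA : ∀ φ ∈ A, φ u = 0) (f : V) (w : (V ≃ₗ[F] V) → ℂ) : (V ≃ₗ[F] V) → ℂ :=
  fun g => ∑ φ : A, ψ (-(φ : Dual F V) f) * w (g * LinearEquiv.transvection (hA φ φ.2))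

section

variable {A : Submodule F (Dual F V)} [Fintype A] {u : V} (hA : ∀ φ ∈ A, φ u = 0)

theorem charProj_mem {W : Submodule ℂ ((V ≃ₗ[F] V) → ℂ)} {w : (V ≃ₗ[F] V) → ℂ}
    (hW : ∀ (φ : Dual F V) (hφ : φ ∈ A),
      (fun g => w (g * LinearEquiv.transvection (hA φ hφ))) ∈ W) (f : V) :
    charProj ψ A hA f w ∈ W := by
  have : charProj ψ A hA f w = ∑ φ : A, ψ (-(φ : Dual F V) f) •
      (fun g => w (g * LinearEquiv.transvection (hA φ φ.2))) := by
    ext g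
    simp [charProj]
  rw [this]
  exact Submodule.sum_mem _ fun φ _ => Submodule.smul_mem _ _ (hW φ φ.2)

theorem charProj_mul_of_commute {w : (V ≃ₗ[F] V) → ℂ} {b : V ≃ₗ[F] V} {c : ℂ}
    (hb : ∀ g, w (g * b) = c * w g)
    (hcomm : ∀ (φ : Dual F V) (hφ : φ ∈ A),
      b * LinearEquiv.transvection (hA φ hφ) = LinearEquiv.transvection (hA φ hφ) * b)
    (f : V) (g : V ≃ₗ[F] V) : charProj ψ A hA f w (g * b) = c * charProj ψ A hA f w g := by
  rw [charProj, charProj, Finset.mul_sum]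
  refine Finset.sum_congr rfl fun φ _ => ?_
  rw [mul_assoc, hcomm φ φ.2, ← mul_assoc, hb]
  ring

theorem charProj_mul_transvection (w : (V ≃ₗ[F] V) → ℂ) {φ₀ : Dual F V} (hφ₀ : φ₀ ∈ A)
    (f : V) (g : V ≃ₗ[F] V) :
    charProj ψ A hA f w (g * LinearEquiv.transvection (hA φ₀ hφ₀)) =
      ψ (φ₀ f) * charProj ψ A hA f w g := by
  rw [charProj, charProj, Finset.mul_sum]
  conv_rhs => rw [← Equiv.sum_comp (Equiv.addLeft (⟨φ₀, hφ₀⟩ : A))]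
  refine Finset.sum_congr rfl fun φ _ => ?_
  rw [mul_assoc, transvection_mul_transvection, ← mul_assoc, ← AddChar.map_add_eq_mul]
  simp

theorem sum_charProj [Fintype V] (hψ : ψ ≠ 1) (w : (V ≃ₗ[F] V) → ℂ) :
    ∑ f, charProj ψ A hA f w = (Fintype.card V : ℂ) • w := by
  classical
  ext g
  rw [Finset.sum_apply]
  simp only [charProj]
  rw [Finset.sum_comm]
  have hsum : ∀ φ : A, ∑ f : V, ψ (-(φ : Dual F V) f) =
      if φ = 0 then (Fintype.card V : ℂ) else 0 := by
    intro φ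
    have h1 := AddChar.sum_eq_ite
      (ψ.compAddMonoidHom (-(φ : Dual F V)).toAddMonoidHom : AddChar V ℂ)
    simp only [AddChar.compAddMonoidHom_apply] at h1
    refine Eq.trans h1 ?_
    refine if_congr ⟨fun h0 => ?_, fun h0 => ?_⟩ rfl rfl
    · by_contra hne
      have hφ : (φ : Dual F V) ≠ 0 := fun h => hne (Subtype.ext h)
      obtain ⟨a, ha⟩ := AddChar.ne_one_iff.1 hψ
      obtain ⟨x, hx⟩ := LinearMap.surjective hφ (-a)
      have := DFunLike.congr_fun h0 x
      apply ha
      rw [AddChar.compAddMonoidHom_apply] at this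
      simpa [hx] using this
    · subst h0
      ext x
      simp
  simp only [← Finset.sum_mul, hsum]
  rw [Finset.sum_eq_single 0]
  · have : (LinearEquiv.transvection (hA _ (0 : A).2) : V ≃ₗ[F] V) = 1 := by
      ext x
      simp
    rw [this]
    simp
  · intro φ _ hφ
    simp [hφ]
  · simp

end

variable [Fintype F] [FiniteDimensional F V]

theorem apply_transvection_eq_of_notMem (hψ : ψ ≠ 1) {W : Submodule ℂ ((V ≃ₗ[F] V) → ℂ)}
    (hW : ∀ w ∈ W, ∀ a, (fun g => w (g * a)) ∈ W) {r : ℕ} (hr : ¬ HasWeight ψ W (r + 1))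
    {e f : Fin r → V} (hef : LinearIndependent F (Sum.elim e f)) {w : (V ≃ₗ[F] V) → ℂ}
    (hwW : w ∈ W) (hw : w ∈ weightSpace ψ e f) {u : V}
    (hu : u ∉ Submodule.span F (Set.range (Sum.elim e f))) {φ₀ : Dual F V}
    (hK : ∀ x ∈ Submodule.span F (Set.range (Sum.elim e f)), φ₀ x = 0) (h0 : φ₀ u = 0)
    (g : V ≃ₗ[F] V) : w (g * LinearEquiv.transvection h0) = w g := by
  classical
  set K := Submodule.span F (Set.range (Sum.elim e f)) with hKdef
  have : Finite V := Module.finite_of_finite F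
  have : Finite (Dual F V) := Module.finite_of_finite F
  have := Fintype.ofFinite V
  have := Fintype.ofFinite (Dual F V)
  let A : Submodule F (Dual F V) := (K ⊔ F ∙ u).dualAnnihilator
  let A' : Submodule F (Dual F V) :=
    (Submodule.span F (Set.range e) ⊔ F ∙ u).dualAnnihilator
  have hA : ∀ φ ∈ A, φ u = 0 := fun φ hφ => (Submodule.mem_dualAnnihilator φ).1 hφ u
    (Submodule.mem_sup_right (Submodule.mem_span_singleton_self u))
  have hA' : ∀ φ ∈ A', φ u = 0 := fun φ hφ => (Submodule.mem_dualAnnihilator φ).1 hφ u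
    (Submodule.mem_sup_right (Submodule.mem_span_singleton_self u))
  have hAK : ∀ φ ∈ A, ∀ x ∈ K, φ x = 0 := fun φ hφ x hx =>
    (Submodule.mem_dualAnnihilator φ).1 hφ x (Submodule.mem_sup_left hx)
  have hA'e : ∀ φ ∈ A', ∀ i, φ (e i) = 0 := fun φ hφ i =>
    (Submodule.mem_dualAnnihilator φ).1 hφ _
      (Submodule.mem_sup_left (Submodule.subset_span ⟨i, rfl⟩))
  have mem_ann : ∀ (p : Submodule F V) (φ : Dual F V), (∀ x ∈ p, φ x = 0) → φ u = 0 →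
      φ ∈ (p ⊔ F ∙ u).dualAnnihilator := by
    intro p φ hp hφu
    rw [Submodule.mem_dualAnnihilator]
    intro x hx
    obtain ⟨y, hy, z, hz, rfl⟩ := Submodule.mem_sup.1 hx
    obtain ⟨c, rfl⟩ := Submodule.mem_span_singleton.1 hz
    rw [map_add, hp y hy, map_smul, hφu, smul_zero, add_zero]
  have heK : Submodule.span F (Set.range e) ≤ K := Submodule.span_mono <| by
    rintro _ ⟨i, rfl⟩
    exact ⟨Sum.inl i, rfl⟩
  have hφA : φ₀ ∈ A := mem_ann K φ₀ hK h0
  have hφA' : φ₀ ∈ A' := mem_ann _ φ₀ (fun x hx => hK x (heK hx)) h0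
  by_contra hne
  obtain ⟨f₁, hf₁, hψ₁⟩ : ∃ f₁, charProj ψ A hA f₁ w ≠ 0 ∧ ψ (φ₀ f₁) ≠ 1 := by
    by_contra! H
    apply hne
    have hsum := sum_charProj hA hψ w
    have hcard : (Fintype.card V : ℂ) ≠ 0 := Nat.cast_ne_zero.2 Fintype.card_ne_zero
    have h1 : ∀ x, (∑ f, charProj ψ A hA f w x) = Fintype.card V * w x := fun x => by
      have := congrFun hsum x
      rwa [Finset.sum_apply] at this
    apply mul_left_cancel₀ hcard
    rw [← h1, ← h1]
    refine Finset.sum_congr rfl fun f' _ => ?_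
    rw [charProj_mul_transvection hA w hφA]
    by_cases hz : charProj ψ A hA f' w = 0
    · simp [hz]
    · rw [H f' hz, one_mul]
  set w₁ := charProj ψ A hA f₁ w with hw₁
  have hw₁W : w₁ ∈ W := charProj_mem hA (fun φ hφ => hW w hwW _) f₁
  have hw₁wt : w₁ ∈ weightSpace ψ e f := by
    refine charProj_mem hA (fun φ hφ => translate_mem_weightSpace hw _ (fun i => ?_)
      (fun i => ?_)) f₁
    · rw [LinearEquiv.transvection.apply,
        hAK φ hφ (e i) (Submodule.subset_span ⟨Sum.inl i, rfl⟩), zero_smul, add_zero]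
    · rw [LinearEquiv.transvection.apply,
        hAK φ hφ (f i) (Submodule.subset_span ⟨Sum.inr i, rfl⟩), zero_smul, add_zero]
  obtain ⟨f₂, hf₂⟩ : ∃ f₂, charProj ψ A' hA' f₂ w₁ ≠ 0 := by
    by_contra! H
    have hsum := sum_charProj hA' hψ w₁
    rw [Finset.sum_congr rfl fun f _ => H f, Finset.sum_const_zero] at hsum
    exact hf₁ ((smul_eq_zero.1 hsum.symm).resolve_left
      (Nat.cast_ne_zero.2 Fintype.card_ne_zero))
  have hchar : ψ (φ₀ f₂) ≠ 1 := by
    obtain ⟨x, hx⟩ := Function.ne_iff.1 hf₂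
    have h1 := charProj_mul_transvection (ψ := ψ) hA' w₁ hφA' f₂ x
    have h2 := charProj_mul_of_commute (ψ := ψ) hA' (w := w₁)
      (b := LinearEquiv.transvection (hA φ₀ hφA)) (c := ψ (φ₀ f₁))
      (fun g => charProj_mul_transvection hA w hφA f₁ g)
      (fun φ hφ => transvection_commute _ _ (hA' φ₀ hφA') (hA' φ hφ)) f₂ x
    rw [h1] at h2
    rwa [mul_right_cancel₀ hx h2]
  refine hr ⟨Fin.snoc e u, Fin.snoc f f₂, ?_, charProj ψ A' hA' f₂ w₁,
    charProj_mem hA' (fun φ hφ => hW w₁ hw₁W _) f₂, hf₂, ?_⟩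
  · have hind : LinearIndependent F
        (Fin.snoc (Fin.snoc (Sum.elim e f ∘ finSumFinEquiv.symm) u : Fin (r + r + 1) → V) f₂
          : Fin (r + r + 1 + 1) → V) := by
      have hrange : Set.range (Sum.elim e f ∘ finSumFinEquiv.symm) = Set.range (Sum.elim e f) :=
        finSumFinEquiv.symm.surjective.range_comp _
      rw [linearIndependent_finSnoc, linearIndependent_finSnoc]
      refine ⟨⟨hef.comp _ finSumFinEquiv.symm.injective, ?_⟩, ?_⟩
      · rw [hrange]
        exact hu
      · intro hmem
        apply hchar
        rw [Fin.range_snoc, hrange] at hmem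
        have : φ₀ f₂ = 0 := by
          refine (Submodule.span_le (p := LinearMap.ker φ₀)).2 ?_ hmem
          rintro x (rfl | hx)
          · exact h0
          · exact hK x (Submodule.subset_span hx)
        rw [this, AddChar.map_zero_eq_one]
    let σ : Fin (r + 1) ⊕ Fin (r + 1) → Fin (r + r + 1 + 1) := Sum.elim
      (Fin.snoc (fun i => (finSumFinEquiv (Sum.inl i)).castSucc.castSucc) (Fin.last _).castSucc)
      (Fin.snoc (fun i => (finSumFinEquiv (Sum.inr i)).castSucc.castSucc) (Fin.last _))
    have hσ : Function.Injective σ := by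
      rintro (i | i) (j | j) <;> refine Fin.lastCases ?_ (fun i => ?_) i <;>
        refine Fin.lastCases ?_ (fun j => ?_) j <;> simp [σ, Fin.ext_iff] <;> omega
    have hcomp : Fin.snoc (Fin.snoc (Sum.elim e f ∘ finSumFinEquiv.symm) u :
        Fin (r + r + 1) → V) f₂ ∘ σ = Sum.elim (Fin.snoc e u) (Fin.snoc f f₂) := by
      funext i
      rcases i with i | i <;> refine Fin.lastCases ?_ (fun i => ?_) i <;>
        simp only [σ, Function.comp_apply, Sum.elim_inl, Sum.elim_inr, Fin.snoc_last,
          Fin.snoc_castSucc, Equiv.symm_apply_apply]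
    rw [← hcomp]
    exact hind.comp _ hσ
  · intro i φ hφ g
    have hφA' : φ ∈ A' := by
      refine mem_ann _ φ (fun x hx => ?_) (by simpa using hφ (Fin.last r))
      refine (Submodule.span_le (p := LinearMap.ker φ)).2 ?_ hx
      rintro _ ⟨l, rfl⟩
      simpa using hφ l.castSucc
    refine Fin.lastCases ?_ (fun i => ?_) i
    · simp only [Fin.snoc_last]
      exact charProj_mul_transvection (ψ := ψ) hA' w₁ hφA' f₂ g
    · simp only [Fin.snoc_castSucc]
      exact charProj_mul_of_commute (ψ := ψ) hA' (fun g => hw₁wt i φ (hA'e φ hφA') g)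
        (fun φ' hφ' => transvection_commute _ _ (hA' φ hφA') (hA'e φ' hφ' i)) f₂ g

theorem apply_mul_eq_of_mem_transvectionGroup (hψ : ψ ≠ 1) {W : Submodule ℂ ((V ≃ₗ[F] V) → ℂ)}
    (hW : ∀ w ∈ W, ∀ a, (fun g => w (g * a)) ∈ W) {r : ℕ} (hr : ¬ HasWeight ψ W (r + 1))
    (hdim : 2 * r + 2 ≤ finrank F V)
    {e f : Fin r → V} (hef : LinearIndependent F (Sum.elim e f)) {w : (V ≃ₗ[F] V) → ℂ}
    (hwW : w ∈ W) (hw : w ∈ weightSpace ψ e f) {p : V ≃ₗ[F] V}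
    (hp : p ∈ transvectionGroup (Submodule.span F (Set.range (Sum.elim e f))))
    (g : V ≃ₗ[F] V) : w (g * p) = w g := by
  induction hp using Subgroup.closure_induction generalizing g with
  | mem p hp =>
    obtain ⟨φ, u, hu, hK, rfl⟩ := hp
    by_cases huK : u ∈ Submodule.span F (Set.range (Sum.elim e f))
    · obtain ⟨u', hu'φ, hu'⟩ : ∃ u', φ u' = 0 ∧
          u' ∉ Submodule.span F (Set.range (Sum.elim e f)) := by
        by_contra! H
        have hle : LinearMap.ker φ ≤ Submodule.span F (Set.range (Sum.elim e f)) := H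
        have h1 := Submodule.finrank_mono hle
        rw [finrank_span_eq_card hef] at h1
        have h2 := LinearMap.finrank_range_add_finrank_ker φ
        have h3 := Submodule.finrank_le (LinearMap.range φ)
        rw [Module.finrank_self] at h3
        simp only [Fintype.card_sum, Fintype.card_fin] at h1
        omega
      rw [← apply_transvection_eq_of_notMem hψ hW hr hef hwW hw hu' hK hu'φ, mul_assoc,
        transvection_mul_transvection_right]
      refine apply_transvection_eq_of_notMem hψ hW hr hef hwW hw (fun h => hu' ?_) hK _ g
      simpa using Submodule.sub_mem _ h huK
    · exact apply_transvection_eq_of_notMem hψ hW hr hef hwW hw huK hK hu g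
  | one => rw [mul_one]
  | mul p p' _ _ h h' => rw [← mul_assoc, h', h]
  | inv p _ h => rw [← h (g * p⁻¹), inv_mul_cancel_right]

end LowWeight

end TransvectionWords

namespace TransvectionWords

open Module

section Centralizer

variable {F V : Type*} [Field F] [AddCommGroup V] [Module F V]

/-- The linear map `∑ c i • h ^ i`. -/
def orbitMap {J : ℕ} (h : V ≃ₗ[F] V) (c : Fin J → F) : V →ₗ[F] V :=
  ∑ i, c i • ((h ^ (i : ℕ) : V ≃ₗ[F] V) : V →ₗ[F] V)

theorem orbitMap_apply {J : ℕ} (h : V ≃ₗ[F] V) (c : Fin J → F) (z : V) :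
    orbitMap h c z = ∑ i, c i • (h ^ (i : ℕ)) z := by
  simp [orbitMap, LinearMap.sum_apply]

/-- The vectors `z` for which `z, h z, …, h ^ (J - 1) z` are linearly dependent. -/
def badSet (J : ℕ) (h : V ≃ₗ[F] V) : Set V :=
  {z | ∃ c : Fin J → F, c ≠ 0 ∧ orbitMap h c z = 0}

variable [FiniteDimensional F V]

theorem finrank_comap_le (f : V →ₗ[F] V) (M : Submodule F V) :
    finrank F (M.comap f) ≤ finrank F M + finrank F (LinearMap.ker f) := by
  have h1 := (f.restrict (p := M.comap f) (q := M) (fun x hx => hx)).finrank_range_add_finrank_ker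
  have h2 : finrank F (LinearMap.range (f.restrict (p := M.comap f) (q := M) (fun x hx => hx))) ≤
      finrank F M := Submodule.finrank_le _
  have h3 : finrank F (LinearMap.ker (f.restrict (p := M.comap f) (q := M) (fun x hx => hx))) ≤
      finrank F (LinearMap.ker f) := by
    rw [LinearMap.ker_restrict]
    rw [(Submodule.equivMapOfInjective (M.comap f).subtype (Submodule.injective_subtype _)
      ((LinearMap.ker f).comap (M.comap f).subtype)).finrank_eq]
    apply Submodule.finrank_mono
    rintro _ ⟨x, hx, rfl⟩
    exact hx
  omega

variable [Finite F]

theorem finrank_ker_orbitMap_le {J e : ℕ} {h : V ≃ₗ[F] V}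
    (hbad : Nat.card (badSet J h) ≤ Nat.card F ^ e) {c : Fin J → F} (hc : c ≠ 0) :
    finrank F (LinearMap.ker (orbitMap h c)) ≤ e := by
  have : Finite V := Module.finite_of_finite F
  have h1 : Nat.card (LinearMap.ker (orbitMap h c)) ≤ Nat.card (badSet J h) := by
    refine Nat.card_mono (Set.toFinite _) ?_
    intro z hz
    exact ⟨c, hc, hz⟩
  rw [Module.natCard_eq_pow_finrank (K := F)] at h1
  exact (Nat.pow_le_pow_iff_right Finite.one_lt_card).1 (h1.trans hbad)

theorem exists_orbit_disjoint {J e : ℕ} {h : V ≃ₗ[F] V}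
    (hbad : Nat.card (badSet J h) ≤ Nat.card F ^ e) (M : Submodule F V)
    (hM : finrank F M + e + J ≤ finrank F V) :
    ∃ z, ∀ c : Fin J → F, orbitMap h c z ∈ M → c = 0 := by
  classical
  have : Finite V := Module.finite_of_finite F
  have := Fintype.ofFinite V
  have := Fintype.ofFinite F
  by_contra! H
  choose c hc hc0 using H
  have hcover : (Finset.univ : Finset V) ⊆
      ((Finset.univ : Finset (Fin J → F)).erase 0).biUnion
        fun c => Finset.univ.filter fun z => orbitMap h c z ∈ M := by
    intro z _
    simp only [Finset.mem_biUnion, Finset.mem_erase, Finset.mem_univ, and_true, Finset.mem_filter,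
      true_and]
    exact ⟨c z, hc0 z, hc z⟩
  have h1 := (Finset.card_le_card hcover).trans (Finset.card_biUnion_le_card_mul _ _
    (Nat.card F ^ (finrank F M + e)) ?_)
  · rw [Finset.card_univ, ← Nat.card_eq_fintype_card, Module.natCard_eq_pow_finrank (K := F),
      Finset.card_erase_of_mem (Finset.mem_univ _), Finset.card_univ, Fintype.card_fun,
      Fintype.card_fin, ← Nat.card_eq_fintype_card] at h1
    have hq : 0 < Nat.card F := Nat.card_pos
    have h2 : Nat.card F ^ (finrank F M + e) * Nat.card F ^ J ≤ Nat.card F ^ finrank F V := by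
      rw [← pow_add]
      exact Nat.pow_le_pow_right hq hM
    have h3 : (Nat.card F ^ J - 1) * Nat.card F ^ (finrank F M + e) <
        Nat.card F ^ J * Nat.card F ^ (finrank F M + e) :=
      Nat.mul_lt_mul_of_pos_right (Nat.sub_lt (by positivity) one_pos) (by positivity)
    rw [mul_comm] at h2
    omega
  · intro c hc
    have hc0 : c ≠ 0 := (Finset.mem_erase.1 hc).1
    have hker := finrank_ker_orbitMap_le hbad hc0
    have hcm := finrank_comap_le (orbitMap h c) M
    have hcard : (Finset.univ.filter fun z => orbitMap h c z ∈ M).card =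
        Nat.card (M.comap (orbitMap h c)) := by
      rw [Nat.card_eq_fintype_card, Fintype.card_subtype]
      rfl
    rw [hcard, Module.natCard_eq_pow_finrank (K := F)]
    exact Nat.pow_le_pow_right Nat.card_pos (by omega)

theorem exists_generating_finset {J e : ℕ} {h : V ≃ₗ[F] V}
    (hbad : Nat.card (badSet J h) ≤ Nat.card F ^ e) (j : ℕ) (hj : j * J + e ≤ finrank F V) :
    ∃ (M : Submodule F V) (T : Finset V), finrank F M = j * J ∧ T.card ≤ j ∧
      ∀ X Y : V ≃ₗ[F] V, Commute X h → Commute Y h → (∀ t ∈ T, X t = Y t) →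
        ∀ x ∈ M, X x = Y x := by
  classical
  induction j with
  | zero =>
    exact ⟨⊥, ∅, by simp, by simp, fun X Y _ _ _ x hx => by simp [(Submodule.mem_bot F).1 hx]⟩
  | succ j ih =>
    rw [Nat.succ_mul] at hj
    obtain ⟨M, T, hM, hT, hgen⟩ := ih (by omega)
    obtain ⟨z, hz⟩ := exists_orbit_disjoint hbad M (by omega)
    let ev : (Fin J → F) →ₗ[F] V :=
      { toFun := fun c => orbitMap h c z
        map_add' := fun c d => by simp [orbitMap_apply, add_smul, Finset.sum_add_distrib]
        map_smul' := fun a c => by simp [orbitMap_apply, mul_smul, Finset.smul_sum] }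
    have hinj : Function.Injective ev := by
      rw [← LinearMap.ker_eq_bot, LinearMap.ker_eq_bot']
      intro c hc
      refine hz c ?_
      change ev c ∈ M
      rw [hc]
      exact M.zero_mem
    have hdisj : M ⊓ LinearMap.range ev = ⊥ := by
      rw [eq_bot_iff]
      rintro _ ⟨hxM, c, rfl⟩
      rw [hz c hxM]
      simp
    refine ⟨M ⊔ LinearMap.range ev, insert z T, ?_, ?_, ?_⟩
    · have h1 := Submodule.finrank_sup_add_finrank_inf_eq M (LinearMap.range ev)
      rw [hdisj, finrank_bot, LinearMap.finrank_range_of_inj hinj, hM] at h1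
      rw [Nat.succ_mul]
      simpa using h1
    · exact (Finset.card_insert_le _ _).trans (by omega)
    · intro X Y hX hY hXY x hx
      obtain ⟨m, hm, _, ⟨c, rfl⟩, rfl⟩ := Submodule.mem_sup.1 hx
      have hpow : ∀ (Z : V ≃ₗ[F] V), Commute Z h → ∀ i : ℕ, Z ((h ^ i) z) = (h ^ i) (Z z) := by
        intro Z hZ i
        exact LinearEquiv.congr_fun (hZ.pow_right i).eq z
      rw [map_add, map_add, hgen X Y hX hY (fun t ht => hXY t (Finset.mem_insert_of_mem ht)) m hm]
      congr 1
      change X (orbitMap h c z) = Y (orbitMap h c z)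
      rw [orbitMap_apply, map_sum, map_sum]
      refine Finset.sum_congr rfl fun i _ => ?_
      rw [map_smul, map_smul, hpow X hX, hpow Y hY, hXY z (Finset.mem_insert_self _ _)]

/-- If few vectors have short `h`-orbits then the centralizer of `h` is small. -/
theorem card_centralizer_le {J e : ℕ} (hJ : 0 < J) {h : V ≃ₗ[F] V}
    (hbad : Nat.card (badSet J h) ≤ Nat.card F ^ e) (he : e ≤ finrank F V) :
    Nat.card (Subgroup.centralizer {h} : Subgroup (V ≃ₗ[F] V)) ≤
      Nat.card F ^ (finrank F V * (finrank F V / J + e + J)) := by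
  classical
  have : Finite V := Module.finite_of_finite F
  set n := finrank F V with hn
  set j := (n - e) / J with hj
  have hjJ : j * J ≤ n - e := Nat.div_mul_le_self _ _
  have hjJ' : n - e < j * J + J := Nat.lt_div_mul_add hJ
  obtain ⟨M, T, hM, hT, hgen⟩ := exists_generating_finset hbad j (by omega)
  obtain ⟨M', hM'⟩ := M.exists_isCompl
  have hdim := Submodule.finrank_add_eq_of_isCompl hM'
  let b := Module.finBasis F M'
  let Φ : (Subgroup.centralizer {h} : Subgroup (V ≃ₗ[F] V)) →
      (T → V) × (Fin (finrank F M') → V) :=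
    fun X => (fun t => X.1 t, fun i => X.1 (b i))
  have hΦ : Function.Injective Φ := by
    intro X Y hXY
    have hX : Commute X.1 h := Subgroup.mem_centralizer_singleton_iff.1 X.2
    have hY : Commute Y.1 h := Subgroup.mem_centralizer_singleton_iff.1 Y.2
    have h1 := congrArg Prod.fst hXY
    have h2 := congrArg Prod.snd hXY
    have hMeq := hgen X.1 Y.1 hX hY (fun t ht => congrFun h1 ⟨t, ht⟩)
    have hM'eq : ∀ x ∈ M', X.1 x = Y.1 x := by
      have : (X.1 : V →ₗ[F] V) ∘ₗ M'.subtype = (Y.1 : V →ₗ[F] V) ∘ₗ M'.subtype :=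
        b.ext fun i => congrFun h2 i
      intro x hx
      exact LinearMap.congr_fun this ⟨x, hx⟩
    refine Subtype.ext (LinearEquiv.ext fun x => ?_)
    obtain ⟨m, hm, m', hm', rfl⟩ := Submodule.mem_sup.1
      (hM'.sup_eq_top ▸ Submodule.mem_top : x ∈ M ⊔ M')
    rw [map_add, map_add, hMeq m hm, hM'eq m' hm']
  refine (Nat.card_le_card_of_injective Φ hΦ).trans ?_
  rw [Nat.card_prod, Nat.card_fun, Nat.card_fun, Module.natCard_eq_pow_finrank (K := F) (V := V),
    ← pow_mul, ← pow_mul, ← pow_add, ← mul_add]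
  refine Nat.pow_le_pow_right Nat.card_pos (Nat.mul_le_mul_left _ ?_)
  have h1 : j ≤ n / J := Nat.div_le_div_right (by omega)
  simp only [Nat.card_eq_fintype_card, Fintype.card_coe, Fintype.card_fin]
  omega

end Centralizer

end TransvectionWords

namespace TransvectionWords

open Module

section Counting

variable {α V : Type*} [Fintype α]

theorem card_fiber_mul_le [DecidableEq V] (f : α → V) (v : V) (S : Finset V)
    (hS : ∀ v' ∈ S, ∃ σ : α → α, Function.Injective σ ∧ ∀ a, f a = v → f (σ a) = v') :
    (Finset.univ.filter fun a => f a = v).card * S.card ≤ Fintype.card α := by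
  classical
  have h1 : ∀ v' ∈ S, (Finset.univ.filter fun a => f a = v).card ≤
      (Finset.univ.filter fun a => f a = v').card := by
    intro v' hv'
    obtain ⟨σ, hσ, h⟩ := hS v' hv'
    refine Finset.card_le_card_of_injOn σ (fun a ha => ?_) hσ.injOn
    simpa using h a (by simpa using ha)
  calc _ = ∑ _v' ∈ S, (Finset.univ.filter fun a => f a = v).card := by
        rw [Finset.sum_const, smul_eq_mul, mul_comm]
    _ ≤ ∑ v' ∈ S, (Finset.univ.filter fun a => f a = v').card := Finset.sum_le_sum h1
    _ = (Finset.univ.filter fun a => f a ∈ S).card := by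
        rw [Finset.card_eq_sum_card_fiberwise (s := Finset.univ.filter fun a => f a ∈ S) (t := S)
          (f := f) (fun a ha => by simpa using ha)]
        refine Finset.sum_congr rfl fun v' hv' => ?_
        congr 1
        ext a
        simp only [Finset.mem_filter, Finset.mem_univ, true_and]
        exact ⟨fun h => ⟨h ▸ hv', h⟩, fun h => h.2⟩
    _ ≤ Fintype.card α := Finset.card_le_univ _

end Counting

section SupNorm

variable {F V : Type*} [Field F] [AddCommGroup V] [Module F V]

/-- The union of the eigenspaces of `h`. -/
def eigenSet (h : V ≃ₗ[F] V) : Set V := {z | ∃ a : F, h z = a • z}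

theorem eigenSet_inv (h : V ≃ₗ[F] V) : eigenSet h⁻¹ = eigenSet h := by
  have key : ∀ h : V ≃ₗ[F] V, eigenSet h ⊆ eigenSet h⁻¹ := by
    rintro h z ⟨a, ha⟩
    by_cases h0 : a = 0
    · subst h0
      have : z = 0 := by simpa using ha
      exact ⟨0, by simp [this]⟩
    · refine ⟨a⁻¹, ?_⟩
      change h.symm z = _
      rw [LinearEquiv.symm_apply_eq, map_smul, ha, smul_smul, inv_mul_cancel₀ h0, one_smul]
  exact (by simpa using key h⁻¹ : eigenSet h⁻¹ ⊆ eigenSet h).antisymm (key h)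

theorem eigenSet_subset_badSet {J : ℕ} (hJ : 2 ≤ J) (h : V ≃ₗ[F] V) :
    eigenSet h ⊆ badSet J h := by
  rintro z ⟨a, ha⟩
  refine ⟨Pi.single ⟨1, hJ⟩ 1 - Pi.single ⟨0, by omega⟩ a, ?_, ?_⟩
  · intro h0
    have := congrFun h0 ⟨1, hJ⟩
    simp at this
  · have h1 : ∀ (i : Fin J) (b : F), orbitMap h (Pi.single i b) z = b • (h ^ (i : ℕ)) z := by
      intro i b
      classical
      rw [orbitMap_apply, Finset.sum_eq_single i]
      · simp
      · intro j _ hj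
        simp [hj]
      · simp
    have h2 : orbitMap h (Pi.single ⟨1, hJ⟩ 1 - Pi.single ⟨0, by omega⟩ a : Fin J → F) z =
        orbitMap h (Pi.single ⟨1, hJ⟩ 1 : Fin J → F) z -
          orbitMap h (Pi.single ⟨0, by omega⟩ a : Fin J → F) z := by
      simp only [orbitMap_apply, Pi.sub_apply, sub_smul, Finset.sum_sub_distrib]
    rw [h2, h1, h1]
    simp [ha]

theorem exists_apply_eq_of_not_linearIndependent {b : ℕ} {κ : Fin b → V}
    (hκ : LinearIndependent F κ) {Y : V ≃ₗ[F] V}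
    (hY : ¬ LinearIndependent F
      (fun i => (Submodule.span F (Set.range κ)).mkQ (Y (κ i)))) :
    ∃ v v' : Submodule.span F (Set.range κ), (v : V) ≠ 0 ∧ (v' : V) ≠ 0 ∧ Y v' = v := by
  rw [Fintype.not_linearIndependent_iff] at hY
  obtain ⟨c, hc, i, hi⟩ := hY
  set v' : V := ∑ i, c i • κ i with hv'
  have hmem' : v' ∈ Submodule.span F (Set.range κ) :=
    Submodule.sum_mem _ fun i _ => Submodule.smul_mem _ _ (Submodule.subset_span ⟨i, rfl⟩)
  have hmem : Y v' ∈ Submodule.span F (Set.range κ) := by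
    rw [← Submodule.ker_mkQ (Submodule.span F (Set.range κ)), LinearMap.mem_ker, hv']
    simpa using hc
  have hne : v' ≠ 0 := fun h0 => hi (Fintype.linearIndependent_iff.1 hκ c h0 i)
  exact ⟨⟨Y v', hmem⟩, ⟨v', hmem'⟩, by simpa using hne, hne, rfl⟩

variable [Fintype F] [FiniteDimensional F V]

theorem card_compl_span_singleton [Fintype V] [DecidableEq V] (v : V) (S : Finset V)
    (hS : ∀ x, x ∈ S ↔ x ∉ F ∙ v) :
    Fintype.card F ^ finrank F V - Fintype.card F ≤ S.card := by
  classical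
  have h1 : Sᶜ.card ≤ Fintype.card F := by
    have : Sᶜ ⊆ Finset.univ.image fun a : F => a • v := by
      intro x hx
      rw [Finset.mem_compl, hS, not_not] at hx
      obtain ⟨a, rfl⟩ := Submodule.mem_span_singleton.1 hx
      exact Finset.mem_image_of_mem _ (Finset.mem_univ a)
    exact (Finset.card_le_card this).trans Finset.card_image_le
  rw [Finset.card_compl, Module.card_eq_pow_finrank (K := F)] at h1
  omega

variable [Fintype (V ≃ₗ[F] V)]

theorem exists_det_eq_one_apply_eq (hn : 2 ≤ finrank F V) {v v' : V} (hv : v ≠ 0) (hv' : v' ≠ 0) :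
    ∃ p : V ≃ₗ[F] V, LinearEquiv.det p = 1 ∧ p v = v' := by
  obtain ⟨p, hp, h⟩ := exists_mem_transvectionGroup_apply_eq (R := (⊥ : Submodule F V))
    (by rw [finrank_bot]; omega) (z := v) (z' := v') (by simpa using hv) (by simpa using hv')
  exact ⟨p, det_of_mem_transvectionGroup hp, h⟩

open Classical in
theorem card_det_eq_one_apply_eq_mul_le (hn : 2 ≤ finrank F V) {v : V} (hv : v ≠ 0) (x : V) :
    (Finset.univ.filter fun s : (LinearEquiv.det (R := F) (M := V)).ker =>
      (s : V ≃ₗ[F] V) x = v).card * (Fintype.card F ^ finrank F V - Fintype.card F) ≤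
      Fintype.card (LinearEquiv.det (R := F) (M := V)).ker := by
  have : Finite V := Module.finite_of_finite F
  have := Fintype.ofFinite V
  refine (Nat.mul_le_mul_left _ (card_compl_span_singleton v
    (Finset.univ.filter fun y => y ∉ F ∙ v) (by simp))).trans
    (card_fiber_mul_le (fun s : (LinearEquiv.det (R := F) (M := V)).ker => (s : V ≃ₗ[F] V) x)
      v _ fun v' hv' => ?_)
  obtain ⟨p, hp, h⟩ := exists_det_eq_one_apply_eq hn hv (v' := v') (by
    rintro rfl
    simp at hv')
  refine ⟨fun s => ⟨p, hp⟩ * s, mul_right_injective _, fun s hs => ?_⟩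
  simpa [hs] using h

open Classical in
theorem card_apply_eq_mul_le (hn : 2 ≤ finrank F V) {v : V} (hv : v ≠ 0) (x : V) :
    (Finset.univ.filter fun y : V ≃ₗ[F] V => y x = v).card *
      (Fintype.card F ^ finrank F V - Fintype.card F) ≤ Fintype.card (V ≃ₗ[F] V) := by
  have : Finite V := Module.finite_of_finite F
  have := Fintype.ofFinite V
  refine (Nat.mul_le_mul_left _ (card_compl_span_singleton v
    (Finset.univ.filter fun y => y ∉ F ∙ v) (by simp))).trans
    (card_fiber_mul_le (fun s : V ≃ₗ[F] V => s x) v _ fun v' hv' => ?_)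
  obtain ⟨p, hp, h⟩ := exists_det_eq_one_apply_eq hn hv (v' := v') (by
    rintro rfl
    simp at hv')
  refine ⟨fun s => p * s, mul_right_injective _, fun s hs => ?_⟩
  simpa [hs] using h

open Classical in
theorem card_conj_apply_eq_mul_le (hn : 3 ≤ finrank F V) (h : V ≃ₗ[F] V) {v v' : V} (hv : v ≠ 0)
    (hv' : v' ≠ 0) :
    (Finset.univ.filter fun y : V ≃ₗ[F] V => (y⁻¹ * h * y) v' = v).card *
      (Fintype.card F ^ finrank F V - Fintype.card F) ≤
      Nat.card (eigenSet h) * Fintype.card (V ≃ₗ[F] V) := by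
  have : Finite V := Module.finite_of_finite F
  have := Fintype.ofFinite V
  by_cases hvv : v ∈ F ∙ v'
  · obtain ⟨a, rfl⟩ := Submodule.mem_span_singleton.1 hvv
    have hsub : (Finset.univ.filter fun y : V ≃ₗ[F] V => (y⁻¹ * h * y) v' = a • v') ⊆
        (Finset.univ.filter fun z => z ∈ eigenSet h ∧ z ≠ 0).biUnion
          fun z => Finset.univ.filter fun y : V ≃ₗ[F] V => y v' = z := by
      intro y hy
      simp only [Finset.mem_filter, Finset.mem_univ, true_and, Finset.mem_biUnion] at hy ⊢
      refine ⟨y v', ⟨⟨a, ?_⟩, by simpa using hv'⟩, rfl⟩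
      have := congrArg y hy
      simpa using this
    refine (Nat.mul_le_mul_right _ ((Finset.card_le_card hsub).trans
      Finset.card_biUnion_le)).trans ?_
    rw [Finset.sum_mul]
    refine (Finset.sum_le_sum fun z hz => card_apply_eq_mul_le (by omega) (v := z)
      (by simpa using (Finset.mem_filter.1 hz).2.2) v').trans ?_
    rw [Finset.sum_const, smul_eq_mul]
    refine Nat.mul_le_mul_right _ ?_
    rw [Nat.card_eq_fintype_card, ← Set.toFinset_card]
    refine Finset.card_le_card fun z hz => ?_
    simpa using (Finset.mem_filter.1 hz).2.1
  · have h1 : 1 ≤ Nat.card (eigenSet h) := by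
      have : Nonempty (eigenSet h) := ⟨0, 0, by simp⟩
      exact Nat.card_pos
    refine le_trans ?_ (Nat.le_mul_of_pos_left _ h1)
    refine (Nat.mul_le_mul_left _ (card_compl_span_singleton v'
      (Finset.univ.filter fun y => y ∉ F ∙ v') (by simp))).trans
      (card_fiber_mul_le (fun y : V ≃ₗ[F] V => (y⁻¹ * h * y) v') v _ fun v'' hv'' => ?_)
    have hdim : finrank F (F ∙ v') + 2 ≤ finrank F V := by
      rw [finrank_span_singleton hv']
      omega
    obtain ⟨p, hp, hpv⟩ := exists_mem_transvectionGroup_apply_eq hdim hvv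
      (by simpa using hv'' : v'' ∉ F ∙ v')
    refine ⟨fun y => y * p⁻¹, mul_left_injective _, fun y hy => ?_⟩
    have hfix : p⁻¹ v' = v' :=
      apply_of_mem_transvectionGroup (inv_mem hp) (Submodule.mem_span_singleton_self v')
    rw [← hpv, ← hy]
    simp [hfix]

end SupNorm

end TransvectionWords

namespace TransvectionWords

open Module

section SupNorm

variable {F V : Type*} [Field F] [AddCommGroup V] [Module F V] [Fintype F] [FiniteDimensional F V]
  [Fintype (V ≃ₗ[F] V)]

/-- `Y` moves `span κ` to a subspace independent from it. -/
def MovesAway {b : ℕ} (κ : Fin b → V) (Y : V ≃ₗ[F] V) : Prop :=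
  LinearIndependent F (fun i => (Submodule.span F (Set.range κ)).mkQ (Y (κ i)))

open Classical in
theorem card_not_movesAway_le {α : Type*} [Fintype α] {b : ℕ} {κ : Fin b → V}
    (hκ : LinearIndependent F κ) (Y : α → V ≃ₗ[F] V) {M N : ℕ}
    (hY : ∀ v v' : V, v ≠ 0 → v' ≠ 0 →
      (Finset.univ.filter fun a => Y a v' = v).card * M ≤ N) :
    (Finset.univ.filter fun a => ¬ MovesAway κ (Y a)).card * M ≤
      Fintype.card F ^ (2 * b) * N := by
  have : Finite V := Module.finite_of_finite F
  set K := Submodule.span F (Set.range κ) with hK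
  have := Fintype.ofFinite K
  have hsub : (Finset.univ.filter fun a => ¬ MovesAway κ (Y a)) ⊆
      (Finset.univ.filter fun vv : K × K => (vv.1 : V) ≠ 0 ∧ (vv.2 : V) ≠ 0).biUnion
        fun vv => Finset.univ.filter fun a => Y a vv.2 = vv.1 := by
    intro a ha
    obtain ⟨v, v', hv, hv', h⟩ :=
      exists_apply_eq_of_not_linearIndependent hκ (Finset.mem_filter.1 ha).2
    simp only [Finset.mem_filter, Finset.mem_univ, true_and, Finset.mem_biUnion]
    exact ⟨(v, v'), ⟨hv, hv'⟩, h⟩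
  refine (Nat.mul_le_mul_right _ ((Finset.card_le_card hsub).trans
    Finset.card_biUnion_le)).trans ?_
  rw [Finset.sum_mul]
  refine (Finset.sum_le_sum fun vv hvv => hY _ _ (Finset.mem_filter.1 hvv).2.1
    (Finset.mem_filter.1 hvv).2.2).trans ?_
  rw [Finset.sum_const, smul_eq_mul]
  refine Nat.mul_le_mul_right _ ((Finset.card_le_univ _).trans ?_)
  rw [Fintype.card_prod, Module.card_eq_pow_finrank (K := F), hK, finrank_span_eq_card hκ,
    Fintype.card_fin, ← pow_add, two_mul]

open Classical in
theorem norm_sum_conj_le {b : ℕ} (hb : 2 * b + 1 ≤ finrank F V) {κ : Fin b → V}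
    (hκ : LinearIndependent F κ) {w : (V ≃ₗ[F] V) → ℂ}
    (hw0 : w ∈ zeroMean (LinearEquiv.det (R := F) (M := V)).ker)
    (hinv : ∀ p ∈ transvectionGroup (Submodule.span F (Set.range κ)), ∀ g, w (g * p) = w g)
    {M : ℝ} (hM : ∀ g, ‖w g‖ ≤ M) (h g : V ≃ₗ[F] V) :
    ‖∑ y, w (g * (y * h * y⁻¹))‖ ≤
      ((Finset.univ.filter fun y : V ≃ₗ[F] V => ¬ MovesAway κ (y * h * y⁻¹)).card +
        2 * Fintype.card (V ≃ₗ[F] V) * ((Finset.univ.filter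
          fun s : (LinearEquiv.det (R := F) (M := V)).ker =>
            ¬ MovesAway κ ((s : V ≃ₗ[F] V) * h)).card /
          Fintype.card (LinearEquiv.det (R := F) (M := V)).ker)) * M := by
  set K := Submodule.span F (Set.range κ) with hK
  set S := (LinearEquiv.det (R := F) (M := V)).ker with hS
  set P := transvectionGroup K with hP
  have hKdim : finrank F K = b := by rw [hK, finrank_span_eq_card hκ, Fintype.card_fin]
  have hM0 : 0 ≤ M := (norm_nonneg _).trans (hM 1)
  let A : (V ≃ₗ[F] V) → ℂ := fun Y => (Fintype.card P : ℂ)⁻¹ * ∑ z : P, w (g * (z * Y))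
  have hP0 : (Fintype.card P : ℂ) ≠ 0 := Nat.cast_ne_zero.2 Fintype.card_ne_zero
  have hP0' : (0 : ℝ) < Fintype.card P := Nat.cast_pos.2 Fintype.card_pos
  have hS0' : (0 : ℝ) < Fintype.card S := Nat.cast_pos.2 Fintype.card_pos
  have hAM : ∀ Y, ‖A Y‖ ≤ M := by
    intro Y
    simp only [A, norm_mul, norm_inv, Complex.norm_natCast]
    rw [inv_mul_le_iff₀ hP0']
    refine (norm_sum_le _ _).trans ((Finset.sum_le_sum fun z _ => hM _).trans ?_)
    simp
  have hsumA : ∑ y, w (g * (y * h * y⁻¹)) = ∑ y, A (y * h * y⁻¹) := by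
    simp only [A]
    rw [← Finset.mul_sum, Finset.sum_comm]
    have : ∀ z : P, ∑ y, w (g * (z * (y * h * y⁻¹))) = ∑ y, w (g * (y * h * y⁻¹)) := by
      intro z
      conv_rhs => rw [← Equiv.sum_comp (Equiv.mulLeft (z : V ≃ₗ[F] V))]
      refine Finset.sum_congr rfl fun y _ => ?_
      rw [← hinv (z⁻¹ : P) (z⁻¹ : P).2 (g * (z * (y * h * y⁻¹)))]
      simp only [Equiv.coe_mulLeft, mul_inv_rev, Subgroup.coe_inv, mul_assoc]
    rw [Finset.sum_congr rfl fun z _ => this z, Finset.sum_const, nsmul_eq_mul,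
      Finset.card_univ, inv_mul_cancel_left₀ hP0]
  have hconst : ∀ Y Y' : V ≃ₗ[F] V, MovesAway κ Y → MovesAway κ Y' →
      LinearEquiv.det Y = LinearEquiv.det Y' → A Y = A Y' := by
    intro Y Y' hY hY' hdet
    obtain ⟨z₀, hz₀, hz⟩ := exists_mem_transvectionGroup_apply_tuple_eq (R := K)
      (κ := fun i => Y (κ i)) (κ' := fun i => Y' (κ i)) (by omega) hY hY'
    have hp : (z₀ * Y)⁻¹ * Y' ∈ P := by
      refine mem_transvectionGroup_of_fix (by omega) (fun x hx => ?_) ?_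
      · have : K ≤ LinearMap.eqLocus ((z₀ * Y)⁻¹ * Y' : V ≃ₗ[F] V).toLinearMap
            LinearMap.id := by
          rw [hK, Submodule.span_le]
          rintro _ ⟨i, rfl⟩
          change ((z₀ * Y)⁻¹ * Y') (κ i) = κ i
          rw [LinearEquiv.mul_apply, ← hz i]
          exact (z₀ * Y).symm_apply_apply (κ i)
        exact this hx
      · rw [map_mul, map_inv, map_mul, det_of_mem_transvectionGroup hz₀, hdet]
        simp
    have hY'eq : Y' = z₀ * Y * ((z₀ * Y)⁻¹ * Y') := by rw [mul_inv_cancel_left]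
    simp only [A]
    congr 1
    conv_lhs => rw [← Equiv.sum_comp (Equiv.mulRight (⟨z₀, hz₀⟩ : P))]
    refine Finset.sum_congr rfl fun z _ => ?_
    conv_rhs => rw [hY'eq, ← mul_assoc, ← mul_assoc, hinv _ hp]
    simp [mul_assoc]
  have hzero : ∑ s : S, A (s * h) = 0 := by
    simp only [A]
    rw [← Finset.mul_sum, Finset.sum_comm, Finset.sum_eq_zero, mul_zero]
    intro z _
    have := translate_mem_zeroMean hw0 h (g * z)
    simpa only [mul_assoc] using this
  obtain ⟨c, hc, hc0⟩ : ∃ c, (∀ Y, MovesAway κ Y → LinearEquiv.det Y = LinearEquiv.det h →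
      A Y = c) ∧ ((¬ ∃ Y, MovesAway κ Y ∧ LinearEquiv.det Y = LinearEquiv.det h) → c = 0) := by
    by_cases H : ∃ Y, MovesAway κ Y ∧ LinearEquiv.det Y = LinearEquiv.det h
    · obtain ⟨Y, hY, hdet⟩ := H
      exact ⟨A Y, fun Y' hY' hdet' => hconst _ _ hY' hY (hdet'.trans hdet.symm),
        fun H => (H ⟨Y, hY, hdet⟩).elim⟩
    · exact ⟨0, fun Y hY hdet => (H ⟨Y, hY, hdet⟩).elim, fun _ => rfl⟩
  have hcS : ‖c‖ ≤ 2 * ((Finset.univ.filter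
      fun s : S => ¬ MovesAway κ ((s : V ≃ₗ[F] V) * h)).card / Fintype.card S) * M := by
    have h1 : (Fintype.card S : ℂ) * c = ∑ s : S, (c - A (s * h)) := by
      rw [Finset.sum_sub_distrib, hzero, sub_zero, Finset.sum_const, nsmul_eq_mul,
        Finset.card_univ]
    have h2 : ‖(Fintype.card S : ℂ) * c‖ ≤
        ∑ s : S, if ¬ MovesAway κ ((s : V ≃ₗ[F] V) * h) then 2 * M else 0 := by
      rw [h1]
      refine (norm_sum_le _ _).trans (Finset.sum_le_sum fun s _ => ?_)
      have hdet : LinearEquiv.det ((s : V ≃ₗ[F] V) * h) = LinearEquiv.det h := by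
        rw [map_mul, MonoidHom.mem_ker.1 s.2, one_mul]
      split_ifs with hs
      · rw [hc _ hs hdet, sub_self, norm_zero]
      · have hcM : ‖c‖ ≤ M := by
          by_cases H : ∃ Y, MovesAway κ Y ∧ LinearEquiv.det Y = LinearEquiv.det h
          · obtain ⟨Y, hY, hdet⟩ := H
            exact hc Y hY hdet ▸ hAM Y
          · exact (hc0 H).symm ▸ by simpa using hM0
        exact (norm_sub_le _ _).trans (by linarith [hAM ((s : V ≃ₗ[F] V) * h)])
    rw [← Finset.sum_filter, Finset.sum_const, nsmul_eq_mul, norm_mul,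
      Complex.norm_natCast] at h2
    rw [mul_div_assoc', div_mul_eq_mul_div, le_div_iff₀ hS0']
    linarith
  have hsum : ‖∑ y, A (y * h * y⁻¹)‖ ≤ ∑ y : V ≃ₗ[F] V,
      (‖c‖ + if ¬ MovesAway κ (y * h * y⁻¹) then M else 0) := by
    refine (norm_sum_le _ _).trans (Finset.sum_le_sum fun y _ => ?_)
    split_ifs with hy
    · rw [hc _ hy (by simp), add_zero]
    · linarith [hAM (y * h * y⁻¹), norm_nonneg c]
  rw [Finset.sum_add_distrib, ← Finset.sum_filter, Finset.sum_const, Finset.sum_const,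
    nsmul_eq_mul, nsmul_eq_mul, Finset.card_univ] at hsum
  rw [hsumA]
  have := mul_le_mul_of_nonneg_left hcS (Nat.cast_nonneg (α := ℝ) (Fintype.card (V ≃ₗ[F] V)))
  linarith

end SupNorm

end TransvectionWords

namespace TransvectionWords

open Module

theorem classAverage_translate {Γ : Type*} [Group Γ] [Fintype Γ] (h a : Γ) (w : Γ → ℂ) :
    classAverage h (fun g => w (g * a)) = fun g => classAverage h w (g * a) := by
  ext g
  rw [classAverage_apply, classAverage_apply, ← Equiv.sum_comp (Equiv.mulLeft a)]
  congr 1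
  refine Finset.sum_congr rfl fun y _ => ?_
  simp [mul_assoc]

theorem symmAverage_translate {Γ : Type*} [Group Γ] [Fintype Γ] (h a : Γ) (w : Γ → ℂ) :
    symmAverage h (fun g => w (g * a)) = fun g => symmAverage h w (g * a) := by
  ext g
  rw [symmAverage_apply, symmAverage_apply, classAverage_translate, classAverage_translate]

section Spectral

variable {F V : Type*} [Field F] [AddCommGroup V] [Module F V] [Fintype F] [FiniteDimensional F V]
  [Fintype (V ≃ₗ[F] V)]

open Classical in
theorem norm_classAverage_mul_le {b e : ℕ} (hb : 2 * b + 1 ≤ finrank F V) (hn : 3 ≤ finrank F V)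
    {κ : Fin b → V} (hκ : LinearIndependent F κ) {w : (V ≃ₗ[F] V) → ℂ}
    (hw0 : w ∈ zeroMean (LinearEquiv.det (R := F) (M := V)).ker)
    (hinv : ∀ p ∈ transvectionGroup (Submodule.span F (Set.range κ)), ∀ g, w (g * p) = w g)
    {M : ℝ} (hM : ∀ g, ‖w g‖ ≤ M) {h : V ≃ₗ[F] V}
    (hE : Nat.card (eigenSet h) ≤ Fintype.card F ^ e) (g : V ≃ₗ[F] V) :
    ‖classAverage h w g‖ * ((Fintype.card F : ℝ) ^ finrank F V - Fintype.card F) ≤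
      3 * (Fintype.card F : ℝ) ^ (2 * b + e) * M := by
  set q := Fintype.card F with hq
  set n := finrank F V with hndef
  have hq2 : 2 ≤ q := Fintype.one_lt_card
  have hqn : q < q ^ n := by
    calc q = q ^ 1 := (pow_one q).symm
      _ < q ^ n := Nat.pow_lt_pow_right hq2 (by omega)
  have hcast : ((q ^ n - q : ℕ) : ℝ) = (q : ℝ) ^ n - q := by
    rw [Nat.cast_sub hqn.le, Nat.cast_pow]
  have hD : (0 : ℝ) < (q : ℝ) ^ n - q := by
    rw [← hcast]
    exact Nat.cast_pos.2 (by omega)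
  have hM0 : 0 ≤ M := (norm_nonneg _).trans (hM 1)
  have hΓ : (0 : ℝ) < Fintype.card (V ≃ₗ[F] V) := Nat.cast_pos.2 Fintype.card_pos
  have hS : (0 : ℝ) < Fintype.card (LinearEquiv.det (R := F) (M := V)).ker :=
    Nat.cast_pos.2 Fintype.card_pos
  have h1 := card_not_movesAway_le hκ (fun y : V ≃ₗ[F] V => y * h * y⁻¹)
    (M := q ^ n - q) (N := q ^ e * Fintype.card (V ≃ₗ[F] V)) (by
      intro v v' hv hv'
      refine le_trans (Nat.mul_le_mul_right _ (le_of_eq ?_))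
        ((card_conj_apply_eq_mul_le hn h hv hv').trans (Nat.mul_le_mul_right _ hE))
      refine Finset.card_bij' (fun y _ => y⁻¹) (fun y _ => y⁻¹) (fun y hy => ?_)
        (fun y hy => ?_) (fun y _ => inv_inv y) (fun y _ => inv_inv y)
      · simpa only [Finset.mem_filter, Finset.mem_univ, true_and, inv_inv] using hy
      · simpa only [Finset.mem_filter, Finset.mem_univ, true_and, inv_inv] using hy)
  have h2 := card_not_movesAway_le hκ
    (fun s : (LinearEquiv.det (R := F) (M := V)).ker => (s : V ≃ₗ[F] V) * h)
    (M := q ^ n - q) (N := Fintype.card (LinearEquiv.det (R := F) (M := V)).ker) (by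
      intro v v' hv hv'
      exact card_det_eq_one_apply_eq_mul_le (by omega) hv (h v'))
  have h3 := norm_sum_conj_le hb hκ hw0 hinv hM h g
  set B₁ := (Finset.univ.filter fun y : V ≃ₗ[F] V => ¬ MovesAway κ (y * h * y⁻¹)).card
  set B₂ := (Finset.univ.filter fun s : (LinearEquiv.det (R := F) (M := V)).ker =>
    ¬ MovesAway κ ((s : V ≃ₗ[F] V) * h)).card
  rw [classAverage_apply, norm_mul, norm_inv, Complex.norm_natCast]
  have h1' : (B₁ : ℝ) * ((q : ℝ) ^ n - q) ≤
      (q : ℝ) ^ (2 * b + e) * Fintype.card (V ≃ₗ[F] V) := by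
    rw [← hcast, pow_add, mul_assoc]
    exact_mod_cast h1
  have h2' : (B₂ : ℝ) / Fintype.card (LinearEquiv.det (R := F) (M := V)).ker *
      ((q : ℝ) ^ n - q) ≤ (q : ℝ) ^ (2 * b + e) := by
    rw [div_mul_eq_mul_div, div_le_iff₀ hS, ← hcast]
    calc _ ≤ (q : ℝ) ^ (2 * b) * Fintype.card (LinearEquiv.det (R := F) (M := V)).ker := by
          exact_mod_cast h2
      _ ≤ _ := by
          gcongr
          · exact_mod_cast (by omega : 1 ≤ q)
          · omega
  rw [mul_assoc, inv_mul_le_iff₀ hΓ]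
  calc _ ≤ _ := mul_le_mul_of_nonneg_right h3 hD.le
    _ = (B₁ * ((q : ℝ) ^ n - q) + 2 * Fintype.card (V ≃ₗ[F] V) *
        (B₂ / Fintype.card (LinearEquiv.det (R := F) (M := V)).ker * ((q : ℝ) ^ n - q))) * M := by
        ring
    _ ≤ ((q : ℝ) ^ (2 * b + e) * Fintype.card (V ≃ₗ[F] V) +
        2 * Fintype.card (V ≃ₗ[F] V) * (q : ℝ) ^ (2 * b + e)) * M := by gcongr
    _ = _ := by ring

open Classical in
/-- The symmetrised class average of an element with few cyclic dependencies has small eigenvalues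
on functions of mean zero. -/
theorem abs_eigenvalue_le (hn : 4096 ≤ finrank F V) {h : V ≃ₗ[F] V}
    (hbad : Nat.card (badSet 64 h) ≤ Fintype.card F ^ (finrank F V / 64)) {μ : ℝ}
    {w : (V ≃ₗ[F] V) → ℂ} (hw0 : w ∈ zeroMean (LinearEquiv.det (R := F) (M := V)).ker)
    (hw : w ≠ 0) (hμ : symmAverage h w = (μ : ℂ) • w) :
    |μ| ≤ ((Fintype.card F : ℝ) ^ (finrank F V / 4))⁻¹ := by
  have : Finite V := Module.finite_of_finite F
  set q := Fintype.card F with hq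
  set n := finrank F V with hndef
  have hq2 : 2 ≤ q := Fintype.one_lt_card
  have hq1 : (1 : ℝ) ≤ q := by exact_mod_cast (by omega : 1 ≤ q)
  have hq0 : (0 : ℝ) < q := by linarith
  obtain ⟨ψ, hψ⟩ : ∃ ψ : AddChar F ℂ, ψ ≠ 1 := by
    obtain ⟨ψ, hψ⟩ := (AddChar.exists_apply_ne_zero (α := F) (a := 1)).2 one_ne_zero
    exact ⟨ψ, AddChar.ne_one_iff.2 ⟨1, hψ⟩⟩
  let W : Submodule ℂ ((V ≃ₗ[F] V) → ℂ) :=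
    zeroMean (LinearEquiv.det (R := F) (M := V)).ker ⊓
      LinearMap.ker (symmAverage h - (μ : ℂ) • LinearMap.id)
  have hWμ : ∀ w ∈ W, symmAverage h w = (μ : ℂ) • w := fun w hw => by
    simpa [sub_eq_zero] using LinearMap.mem_ker.1 hw.2
  have hWt : ∀ w ∈ W, ∀ a, (fun g => w (g * a)) ∈ W := by
    intro w hw a
    refine ⟨translate_mem_zeroMean hw.1 a, ?_⟩
    have := hWμ w hw
    refine LinearMap.mem_ker.2 (funext fun g => ?_)
    simp [symmAverage_translate, this]
  have hwW : w ∈ W := ⟨hw0, by simp [LinearMap.mem_ker, hμ]⟩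
  have hE : Nat.card (eigenSet h) ≤ q ^ (n / 64) :=
    (Nat.card_mono (Set.toFinite _) (eigenSet_subset_badSet (by norm_num) h)).trans hbad
  by_cases hhigh : HasWeight ψ W (n / 16)
  · have h1 := hhigh.sq_mul_pow_le hψ hWt (by omega) hWμ
    have h2 := card_centralizer_le (J := 64) (h := h) (e := n / 64) (by norm_num)
      (by rwa [Nat.card_eq_fintype_card (α := F)]) (by omega)
    rw [Nat.card_eq_fintype_card (α := F)] at h2
    have h3 : μ ^ 2 * (q : ℝ) ^ (n / 16 * (n - 2 * (n / 16))) ≤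
        (q : ℝ) ^ (n * (n / 64 + n / 64 + 64)) := h1.trans (by exact_mod_cast h2)
    have hexp : n * (n / 64 + n / 64 + 64) + 2 * (n / 4) ≤ n / 16 * (n - 2 * (n / 16)) := by
      have ha : n ≤ 16 * (n / 16) + 15 := by omega
      have hc : 7 * n ≤ 8 * (n - 2 * (n / 16)) := by omega
      have hd : 32 * (n / 64 + n / 64) ≤ n := by omega
      have he : 2 * (n / 4) ≤ n := by omega
      have hf : 2 * (n / 64 + n / 64 + 64 + 1) * 8 ≤ 2 * 7 * (n / 16) := by omega
      nlinarith
    have h4 : (|μ| * (q : ℝ) ^ (n / 4)) ^ 2 ≤ 1 := by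
      rw [mul_pow, sq_abs, ← pow_mul]
      have hp : (0 : ℝ) < (q : ℝ) ^ (n * (n / 64 + n / 64 + 64)) := by positivity
      refine le_of_mul_le_mul_right ?_ hp
      rw [one_mul, mul_assoc, ← pow_add]
      refine le_trans ?_ h3
      gcongr
      omega
    rw [← one_div, le_div_iff₀ (by positivity)]
    exact (sq_le_one_iff₀ (by positivity)).1 h4
  · obtain ⟨r, hr, hr1, hr2⟩ : ∃ r, r < n / 16 ∧ HasWeight ψ W r ∧ ¬ HasWeight ψ W (r + 1) := by
      by_contra! H
      apply hhigh
      have : ∀ r ≤ n / 16, HasWeight ψ W r := by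
        intro r
        induction r with
        | zero =>
          intro _
          exact ⟨Fin.elim0, Fin.elim0, linearIndependent_empty_type, w, hwW, hw,
            fun i => i.elim0⟩
        | succ r ih => exact fun hr => H r (by omega) (ih (by omega))
      exact this _ le_rfl
    obtain ⟨e, f, hef, w', hw'W, hw'0, hw'⟩ := hr1
    have hinv := fun p hp => apply_mul_eq_of_mem_transvectionGroup hψ hWt hr2 (by omega) hef hw'W
      hw' (p := p) hp
    have hκ : LinearIndependent F (Sum.elim e f ∘ finSumFinEquiv.symm) :=
      hef.comp _ finSumFinEquiv.symm.injective
    rw [← finSumFinEquiv.symm.surjective.range_comp] at hinv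
    obtain ⟨g, hg⟩ := Finite.exists_max fun g => ‖w' g‖
    have hgpos : 0 < ‖w' g‖ := by
      obtain ⟨x, hx⟩ := Function.ne_iff.1 hw'0
      exact (norm_pos_iff.2 hx).trans_le (hg x)
    have h1 := norm_classAverage_mul_le (e := n / 64) (by omega) (by omega) hκ hw'W.1 hinv hg
      (h := h) hE g
    have h2 := norm_classAverage_mul_le (e := n / 64) (by omega) (by omega) hκ hw'W.1 hinv hg
      (h := h⁻¹) (by rwa [eigenSet_inv]) g
    have h3 : |μ| * ‖w' g‖ ≤ 2⁻¹ * (‖classAverage h w' g‖ + ‖classAverage h⁻¹ w' g‖) := by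
      have := congrFun (hWμ w' hw'W) g
      rw [symmAverage_apply, Pi.smul_apply, smul_eq_mul] at this
      have h4 : |μ| * ‖w' g‖ = ‖(μ : ℂ) * w' g‖ := by
        rw [norm_mul, Complex.norm_real, Real.norm_eq_abs]
      rw [h4, ← this, norm_mul]
      refine mul_le_mul ?_ (norm_add_le _ _) (norm_nonneg _) (by norm_num)
      simp
    rw [← hq, ← hndef] at h1 h2
    have hqn : 3 * (q : ℝ) ^ (2 * (r + r) + n / 64) * (q : ℝ) ^ (n / 4) ≤ (q : ℝ) ^ n - q := by
      rw [mul_assoc, ← pow_add]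
      generalize hxdef : 2 * (r + r) + n / 64 + n / 4 = x
      have hx : (q : ℝ) ≤ (q : ℝ) ^ x := le_self_pow₀ hq1 (by omega)
      have hx2 : (q : ℝ) ^ (x + 2) ≤ (q : ℝ) ^ n := pow_le_pow_right₀ hq1 (by omega)
      have hx3 : 4 * (q : ℝ) ^ x ≤ (q : ℝ) ^ (x + 2) := by
        rw [pow_add _ x 2, mul_comm]
        have : (4 : ℝ) ≤ (q : ℝ) ^ 2 := by
          have : (2 : ℝ) ≤ q := by exact_mod_cast hq2
          nlinarith
        exact mul_le_mul_of_nonneg_left this (by positivity)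
      linarith
    have hD : (0 : ℝ) < (q : ℝ) ^ n - q := lt_of_lt_of_le (by positivity) hqn
    have h4 : |μ| * ‖w' g‖ * ((q : ℝ) ^ n - q) ≤
        3 * (q : ℝ) ^ (2 * (r + r) + n / 64) * ‖w' g‖ := by
      refine (mul_le_mul_of_nonneg_right h3 hD.le).trans ?_
      linarith
    have h5 : |μ| * ((q : ℝ) ^ n - q) ≤ 3 * (q : ℝ) ^ (2 * (r + r) + n / 64) := by
      refine le_of_mul_le_mul_right ?_ hgpos
      linarith
    rw [← one_div, le_div_iff₀ (by positivity)]
    have h6 : |μ| * (3 * (q : ℝ) ^ (2 * (r + r) + n / 64) * (q : ℝ) ^ (n / 4)) ≤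
        3 * (q : ℝ) ^ (2 * (r + r) + n / 64) :=
      (mul_le_mul_of_nonneg_left hqn (abs_nonneg μ)).trans h5
    refine le_of_mul_le_mul_right ?_
      (by positivity : (0 : ℝ) < 3 * (q : ℝ) ^ (2 * (r + r) + n / 64))
    linarith

end Spectral

end TransvectionWords

namespace TransvectionWords

open Module

section Walk

variable {F V : Type*} [Field F] [AddCommGroup V] [Module F V] {ι : Type*}
  {G : Subgroup (V ≃ₗ[F] V)}

/-- The group element attached to a letter `ξ` or `ξ⁻¹`. -/
def letter {Γ : Type*} [Group Γ] (x : ι → Γ) (a : ι × Bool) : Γ :=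
  if a.2 then x a.1 else (x a.1)⁻¹

/-- The trajectory of `z` under the letters `s 0, s 1, …`. -/
def walk (x : ι → G) (s : ℕ → ι × Bool) (z : V) : ℕ → V
  | 0 => z
  | i + 1 => (letter x (s i) : G).1 (walk x s z i)

/-- The span of the vectors whose image under the letter `a` or its inverse is known after
`i` steps of the trajectory `P`, taken on the side of the image of `a`. -/
def knownImage (s : ℕ → ι × Bool) (P : ℕ → V) (i : ℕ) (a : ι × Bool) : Submodule F V :=
  Submodule.span F ({v | ∃ j < i, s j = a ∧ v = P (j + 1)} ∪
    {v | ∃ j < i, s j = (a.1, !a.2) ∧ v = P j})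

theorem walk_succ_notMem_knownImage {x : ι → G} {s : ℕ → ι × Bool} {z : V} {i : ℕ}
    (hs : ∀ j < i, s j ≠ ((s (j + 1)).1, !(s (j + 1)).2))
    (hli : LinearIndependent F fun j : Fin (i + 1) => walk x s z j) :
    walk x s z (i + 1) ∉ knownImage (F := F) s (walk x s z) i (s i) := by
  intro hmem
  have hli' := hli
  rw [linearIndependent_finSucc'] at hli'
  apply hli'.2
  set X : V ≃ₗ[F] V := (letter x (s i) : G).1 with hX
  set T : Submodule F V := Submodule.span F (Set.range
    (Fin.init fun j : Fin (i + 1) => walk x s z j)) with hT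
  have hle : knownImage s (walk x s z) i (s i) ≤ T.comap X.symm.toLinearMap := by
    refine Submodule.span_le.2 ?_
    have hin : ∀ j < i, walk x s z j ∈ T := fun j hj =>
      Submodule.subset_span ⟨⟨j, hj⟩, rfl⟩
    rintro v (⟨j, hj, hsj, rfl⟩ | ⟨j, hj, hsj, rfl⟩)
    · change X.symm (walk x s z (j + 1)) ∈ T
      rw [walk, hsj, ← hX, X.symm_apply_apply]
      exact hin j hj
    · change X.symm (walk x s z j) ∈ T
      have hj1 : j + 1 < i := by
        rcases Nat.lt_or_ge (j + 1) i with h | h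
        · exact h
        · obtain rfl : j + 1 = i := by omega
          exact (hs j hj hsj).elim
      have : X.symm (walk x s z j) = walk x s z (j + 1) := by
        rw [walk, hsj, hX]
        have hinv : letter x ((s i).1, !(s i).2) = (letter x (s i))⁻¹ := by
          rcases s i with ⟨t, _ | _⟩ <;> simp [letter]
        rw [hinv]
        rfl
      rw [this]
      exact hin _ hj1
  have := hle hmem
  change X.symm (walk x s z (i + 1)) ∈ T at this
  rw [walk, ← hX, X.symm_apply_apply] at this
  exact this

theorem finrank_knownImage_le [FiniteDimensional F V] (s : ℕ → ι × Bool) (P : ℕ → V) (i : ℕ)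
    (a : ι × Bool) : finrank F (knownImage (F := F) s P i a) ≤ i := by
  classical
  have hle : knownImage (F := F) s P i a ≤ Submodule.span F
      (((Finset.range i).image fun j => if s j = a then P (j + 1) else P j : Finset V) : Set V) := by
    refine Submodule.span_mono ?_
    rintro v (⟨j, hj, hsj, rfl⟩ | ⟨j, hj, hsj, rfl⟩)
    · simp only [Finset.coe_image, Set.mem_image, Finset.coe_range, Set.mem_Iio]
      exact ⟨j, hj, if_pos hsj⟩
    · simp only [Finset.coe_image, Set.mem_image, Finset.coe_range, Set.mem_Iio]
      refine ⟨j, hj, if_neg ?_⟩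
      rw [hsj]
      rcases a with ⟨t, _ | _⟩ <;> simp
  exact (Submodule.finrank_mono hle).trans ((finrank_span_finset_le_card _).trans
    (Finset.card_image_le.trans (by simp)))

theorem knownImage_congr (s : ℕ → ι × Bool) {P P' : ℕ → V} {i : ℕ} (h : ∀ j ≤ i, P j = P' j)
    (a : ι × Bool) : knownImage (F := F) s P i a = knownImage s P' i a := by
  rw [knownImage, knownImage]
  congr 2
  · ext v
    exact exists_congr fun j => and_congr_right fun hj => by rw [h (j + 1) hj]
  · ext v
    exact exists_congr fun j => and_congr_right fun hj => by rw [h j hj.le]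

variable [DecidableEq ι]

/-- Replace the value of the generator under the letter `a` so that `letter a` gets multiplied by
`p` on the left. -/
def twist (a : ι × Bool) (p : G) (x : ι → G) : ι → G :=
  Function.update x a.1 (if a.2 then p * x a.1 else x a.1 * p⁻¹)

theorem letter_twist (a : ι × Bool) (p : G) (x : ι → G) :
    letter (twist a p x) a = p * letter x a := by
  rcases a with ⟨t, _ | _⟩ <;> simp [letter, twist]

theorem letter_twist_flip (a : ι × Bool) (p : G) (x : ι → G) :
    letter (twist a p x) (a.1, !a.2) = letter x (a.1, !a.2) * p⁻¹ := by
  rcases a with ⟨t, _ | _⟩ <;> simp [letter, twist]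

theorem letter_twist_of_ne {a b : ι × Bool} (h : b.1 ≠ a.1) (p : G) (x : ι → G) :
    letter (twist a p x) b = letter x b := by
  simp [letter, twist, Function.update_of_ne h]

theorem twist_injective (a : ι × Bool) (p : G) : Function.Injective (twist (ι := ι) a p) := by
  intro x y h
  funext t
  by_cases ht : t = a.1
  · subst ht
    have := congrFun h a.1
    rcases a with ⟨t, _ | _⟩ <;> simpa [twist] using this
  · have := congrFun h t
    simpa [twist, Function.update_of_ne ht] using this

theorem walk_twist {x : ι → G} {s : ℕ → ι × Bool} {z : V} {i : ℕ} {a : ι × Bool} {p : G}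
    (hp : (p : V ≃ₗ[F] V) ∈ transvectionGroup (knownImage s (walk x s z) i a)) {j : ℕ}
    (hj : j ≤ i) : walk (twist a p x) s z j = walk x s z j := by
  induction j with
  | zero => rfl
  | succ j ih =>
    rw [walk, walk, ih (by omega)]
    by_cases h1 : s j = a
    · rw [h1, letter_twist]
      have : walk x s z (j + 1) ∈ knownImage (F := F) s (walk x s z) i a :=
        Submodule.subset_span (Or.inl ⟨j, hj, h1, rfl⟩)
      rw [walk, h1] at this
      exact apply_of_mem_transvectionGroup hp this
    · by_cases h2 : s j = (a.1, !a.2)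
      · rw [h2, letter_twist_flip]
        have : walk x s z j ∈ knownImage (F := F) s (walk x s z) i a :=
          Submodule.subset_span (Or.inr ⟨j, hj, h2, rfl⟩)
        exact congrArg _ (apply_of_mem_transvectionGroup (inv_mem hp) this)
      · rw [letter_twist_of_ne]
        intro h
        rcases hb : s j with ⟨t, ε⟩
        rw [hb] at h h1 h2
        obtain ⟨t', ε'⟩ := a
        obtain rfl : t = t' := h
        cases ε <;> cases ε' <;> simp_all

theorem walk_succ_twist {x : ι → G} {s : ℕ → ι × Bool} {z : V} {i : ℕ} {p : G}
    (hp : (p : V ≃ₗ[F] V) ∈ transvectionGroup (knownImage s (walk x s z) i (s i))) :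
    walk (twist (s i) p x) s z (i + 1) = (p : V ≃ₗ[F] V) (walk x s z (i + 1)) := by
  rw [walk, walk_twist hp le_rfl, letter_twist, walk]
  rfl

variable [Fintype F] [FiniteDimensional F V] [Fintype (V ≃ₗ[F] V)] [Fintype ι]

open Classical in
theorem card_first_dependence_mul_le
    (hG : ∀ g : V ≃ₗ[F] V, LinearEquiv.det g = 1 → g ∈ G)
    (s : ℕ → ι × Bool) (z : V) {i : ℕ} (hi : i + 2 ≤ finrank F V)
    (hs : ∀ j < i, s j ≠ ((s (j + 1)).1, !(s (j + 1)).2)) :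
    (Finset.univ.filter fun x : ι → G =>
      LinearIndependent F (fun j : Fin (i + 1) => walk x s z j) ∧
      ¬ LinearIndependent F (fun j : Fin (i + 2) => walk x s z j)).card *
      (Fintype.card F ^ finrank F V - Fintype.card F ^ (i + 1)) ≤
    Fintype.card F ^ (i + 1) * Fintype.card (ι → G) := by
  have : Finite V := Module.finite_of_finite F
  have := Fintype.ofFinite V
  set B := (Finset.univ.filter fun x : ι → G =>
      LinearIndependent F (fun j : Fin (i + 1) => walk x s z j) ∧
      ¬ LinearIndependent F (fun j : Fin (i + 2) => walk x s z j)) with hB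
  let π : (ι → G) → (Fin (i + 1) → V) := fun x j => walk x s z j
  have hfib : ∀ P : Fin (i + 1) → V, (B.filter fun x => π x = P).card *
      (Fintype.card F ^ finrank F V - Fintype.card F ^ (i + 1)) ≤
      Fintype.card F ^ (i + 1) * (Finset.univ.filter fun x => π x = P).card := by
    intro P
    by_cases hP : (B.filter fun x => π x = P).Nonempty
    swap
    · rw [Finset.not_nonempty_iff_eq_empty] at hP
      simp [hP]
    obtain ⟨x₀, hx₀⟩ := hP
    simp only [hB, Finset.mem_filter, Finset.mem_univ, true_and] at hx₀
    obtain ⟨⟨hli, -⟩, hπ⟩ := hx₀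
    have hliP : LinearIndependent F P := hπ ▸ hli
    set R : Submodule F V := knownImage s (walk x₀ s z) i (s i) with hR
    have hRx : ∀ x, π x = P → knownImage s (walk x s z) i (s i) = R := by
      intro x hx
      refine knownImage_congr s (fun j hj => ?_) _
      exact congrFun (hx.trans hπ.symm) ⟨j, by omega⟩
    have hRdim : finrank F R ≤ i := finrank_knownImage_le _ _ _ _
    let Sp : Submodule F V := Submodule.span F (Set.range P)
    have hSp : finrank F Sp = i + 1 := by
      rw [finrank_span_eq_card hliP, Fintype.card_fin]
    have hsub : (B.filter fun x => π x = P) ⊆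
        (Finset.univ.filter fun v : V => v ∈ Sp).biUnion fun v =>
          Finset.univ.filter fun x => π x = P ∧ walk x s z (i + 1) = v := by
      intro x hx
      simp only [hB, Finset.mem_filter, Finset.mem_univ, true_and] at hx
      obtain ⟨⟨hx1, hx2⟩, hx3⟩ := hx
      simp only [Finset.mem_filter, Finset.mem_univ, true_and, Finset.mem_biUnion]
      refine ⟨_, ?_, hx3, rfl⟩
      by_contra hnot
      apply hx2
      rw [linearIndependent_finSucc']
      refine ⟨hx1, fun h => hnot ?_⟩
      change walk x s z (i + 1) ∈ Submodule.span F (Set.range (π x)) at h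
      rwa [hx3] at h
    have hcount : ∀ v : V, (Finset.univ.filter fun x => π x = P ∧ walk x s z (i + 1) = v).card *
        (Fintype.card F ^ finrank F V - Fintype.card F ^ (i + 1)) ≤
        (Finset.univ.filter fun x => π x = P).card := by
      intro v
      by_cases hv : v ∈ R
      · rw [Finset.filter_eq_empty_iff.2, Finset.card_empty, zero_mul]
        · exact Nat.zero_le _
        · rintro x - ⟨hx1, rfl⟩
          rw [← hRx x hx1] at hv
          refine walk_succ_notMem_knownImage hs ?_ hv
          change LinearIndependent F (π x)
          rwa [hx1]
      · have hS : Fintype.card F ^ finrank F V - Fintype.card F ^ (i + 1) ≤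
            (Finset.univ.filter fun v' : V => v' ∉ R).card := by
          have h1 : (Finset.univ.filter fun v' : V => v' ∈ R).card ≤ Fintype.card F ^ (i + 1) := by
            rw [← Fintype.card_subtype]
            rw [Module.card_eq_pow_finrank (K := F)]
            exact Nat.pow_le_pow_right Fintype.card_pos (by omega)
          have h2 := Finset.card_filter_add_card_filter_not (s := (Finset.univ : Finset V))
            (fun v' : V => v' ∈ R)
          rw [Finset.card_univ, Module.card_eq_pow_finrank (K := F)] at h2
          omega
        have key := card_fiber_mul_le (α := {x // π x = P}) (fun x => walk x.1 s z (i + 1)) v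
          (Finset.univ.filter fun v' : V => v' ∉ R) (by
            intro v' hv'
            obtain ⟨p, hp, hpv⟩ := exists_mem_transvectionGroup_apply_eq (R := R) (by omega) hv
              (by simpa using hv' : v' ∉ R)
            have hpG := hG p (det_of_mem_transvectionGroup hp)
            refine ⟨fun x => ⟨twist (s i) ⟨p, hpG⟩ x.1, ?_⟩, ?_, ?_⟩
            · funext j
              have := walk_twist (x := x.1) (s := s) (z := z) (i := i) (a := s i) (p := ⟨p, hpG⟩)
                (by rw [hRx x.1 x.2]; exact hp) (j := j) (by omega)
              exact this.trans (congrFun x.2 j)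
            · intro x y hxy
              exact Subtype.ext (twist_injective _ _ (congrArg Subtype.val hxy))
            · intro x hx
              have := walk_succ_twist (x := x.1) (s := s) (z := z) (i := i) (p := ⟨p, hpG⟩)
                (by rw [hRx x.1 x.2]; exact hp)
              rw [this, hx]
              exact hpv)
        rw [Fintype.card_subtype] at key
        refine le_trans (Nat.mul_le_mul (le_of_eq ?_) hS) key
        rw [← Finset.card_map (Function.Embedding.subtype _)]
        congr 1
        ext x
        simp [and_comm]
    refine (Nat.mul_le_mul_right _ ((Finset.card_le_card hsub).trans
      Finset.card_biUnion_le)).trans ?_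
    rw [Finset.sum_mul]
    refine (Finset.sum_le_sum fun v _ => hcount v).trans ?_
    rw [Finset.sum_const, smul_eq_mul]
    refine Nat.mul_le_mul_right _ (le_of_eq ?_)
    rw [← Fintype.card_subtype]
    rw [Module.card_eq_pow_finrank (K := F), hSp]
  rw [Finset.card_eq_sum_card_fiberwise (f := π) (s := B) (t := Finset.univ) (by simp),
    Finset.sum_mul, ← Finset.card_univ (α := ι → G),
    Finset.card_eq_sum_card_fiberwise (f := π) (s := Finset.univ) (t := Finset.univ) (by simp),
    Finset.mul_sum]
  exact Finset.sum_le_sum fun P _ => hfib P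

end Walk

end TransvectionWords

namespace TransvectionWords

open Module

section WalkCounting

variable {F V : Type*} [Field F] [AddCommGroup V] [Module F V] {ι : Type*}
  {G : Subgroup (V ≃ₗ[F] V)}

theorem mem_badSet_not_linearIndependent {x : ι → G} {s : ℕ → ι × Bool} {z : V} {N : ℕ}
    (hN : 0 < N) {J : ℕ} {h : V ≃ₗ[F] V} (hwalk : ∀ j, walk x s z (N * j) = (h ^ j) z)
    (hz : z ∈ badSet (F := F) (J + 1) h) :
    ¬ LinearIndependent F fun j : Fin (N * J + 1) => walk x s z j := by
  intro hli
  obtain ⟨c, hc, hcz⟩ := hz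
  apply hc
  let e : Fin (J + 1) → Fin (N * J + 1) := fun j =>
    ⟨N * j, Nat.lt_succ_of_le (Nat.mul_le_mul_left _ (Nat.le_of_lt_succ j.2))⟩
  have he : Function.Injective e := by
    intro a b hab
    have := congrArg Fin.val hab
    exact Fin.ext (Nat.eq_of_mul_eq_mul_left hN this)
  have := hli.comp e he
  rw [Fintype.linearIndependent_iff] at this
  funext i
  refine this c ?_ i
  rw [orbitMap_apply] at hcz
  rw [← hcz]
  refine Finset.sum_congr rfl fun i _ => ?_
  simp only [Function.comp_apply, e, hwalk]

variable [Fintype F] [FiniteDimensional F V] [Fintype (V ≃ₗ[F] V)] [Fintype ι]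

open Classical in
theorem card_dependent_mul_le
    (hG : ∀ g : V ≃ₗ[F] V, LinearEquiv.det g = 1 → g ∈ G)
    {s : ℕ → ι × Bool} {z : V} (hz : z ≠ 0) {L : ℕ} (hL : L + 1 ≤ finrank F V)
    (hs : ∀ j, s j ≠ ((s (j + 1)).1, !(s (j + 1)).2)) :
    (Finset.univ.filter fun x : ι → G =>
      ¬ LinearIndependent F (fun j : Fin (L + 1) => walk x s z j)).card *
      Fintype.card F ^ finrank F V ≤
    2 * L * Fintype.card F ^ L * Fintype.card (ι → G) := by
  induction L with
  | zero =>
    rw [Finset.filter_eq_empty_iff.2]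
    · simp
    · intro x _ h
      apply h
      exact (linearIndependent_unique_iff (ι := Fin 1) (v := fun j => walk x s z j)).2 hz
  | succ L ih =>
    have hq : 2 ≤ Fintype.card F := Fintype.one_lt_card
    have h1 := ih (by omega)
    have h2 := card_first_dependence_mul_le hG s z (i := L) (by omega) (fun j _ => hs j)
    have hsub : (Finset.univ.filter fun x : ι → G =>
        ¬ LinearIndependent F (fun j : Fin (L + 1 + 1) => walk x s z j)) ⊆
        (Finset.univ.filter fun x : ι → G =>
          ¬ LinearIndependent F (fun j : Fin (L + 1) => walk x s z j)) ∪
        (Finset.univ.filter fun x : ι → G =>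
          LinearIndependent F (fun j : Fin (L + 1) => walk x s z j) ∧
          ¬ LinearIndependent F (fun j : Fin (L + 2) => walk x s z j)) := by
      intro x hx
      simp only [Finset.mem_union, Finset.mem_filter, Finset.mem_univ, true_and] at hx ⊢
      by_cases h : LinearIndependent F (fun j : Fin (L + 1) => walk x s z j)
      · exact Or.inr ⟨h, hx⟩
      · exact Or.inl h
    have hcard := (Finset.card_le_card hsub).trans (Finset.card_union_le _ _)
    set a := (Finset.univ.filter fun x : ι → G =>
          ¬ LinearIndependent F (fun j : Fin (L + 1) => walk x s z j)).card
    set b := (Finset.univ.filter fun x : ι → G =>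
          LinearIndependent F (fun j : Fin (L + 1) => walk x s z j) ∧
          ¬ LinearIndependent F (fun j : Fin (L + 2) => walk x s z j)).card
    set g := Fintype.card (ι → G)
    set q := Fintype.card F
    have hpow : q ^ (L + 1) * 2 ≤ q ^ finrank F V :=
      calc q ^ (L + 1) * 2 ≤ q ^ (L + 1) * q := Nat.mul_le_mul_left _ hq
        _ = q ^ (L + 2) := (pow_succ _ _).symm
        _ ≤ _ := Nat.pow_le_pow_right (by omega) hL
    have hhalf : q ^ finrank F V ≤ 2 * (q ^ finrank F V - q ^ (L + 1)) := by omega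
    have hb : b * q ^ finrank F V ≤ 2 * (q ^ (L + 1) * g) :=
      calc b * q ^ finrank F V ≤ b * (2 * (q ^ finrank F V - q ^ (L + 1))) :=
            Nat.mul_le_mul_left _ hhalf
        _ = 2 * (b * (q ^ finrank F V - q ^ (L + 1))) := by ring
        _ ≤ _ := Nat.mul_le_mul_left _ h2
    calc _ ≤ (a + b) * q ^ finrank F V := Nat.mul_le_mul_right _ hcard
      _ = a * q ^ finrank F V + b * q ^ finrank F V := add_mul _ _ _
      _ ≤ 2 * L * q ^ L * g + 2 * (q ^ (L + 1) * g) := Nat.add_le_add h1 hb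
      _ ≤ 2 * L * q ^ (L + 1) * g + 2 * (q ^ (L + 1) * g) := by
          gcongr <;> omega
      _ = _ := by ring

open Classical in
theorem card_large_badSet_mul_le
    (hG : ∀ g : V ≃ₗ[F] V, LinearEquiv.det g = 1 → g ∈ G)
    {s : ℕ → ι × Bool} {N J : ℕ} (hN : 0 < N) (hL : N * J + 1 ≤ finrank F V)
    (hs : ∀ j, s j ≠ ((s (j + 1)).1, !(s (j + 1)).2)) (H : (ι → G) → V ≃ₗ[F] V)
    (hwalk : ∀ x z j, walk x s z (N * j) = (H x ^ j) z) (B : ℕ) :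
    (Finset.univ.filter fun x : ι → G => B < Nat.card (badSet (F := F) (J + 1) (H x))).card * B ≤
    (1 + 2 * (N * J) * Fintype.card F ^ (N * J)) * Fintype.card (ι → G) := by
  have : Finite V := Module.finite_of_finite F
  have := Fintype.ofFinite V
  set g := Fintype.card (ι → G) with hg
  set q := Fintype.card F
  have hVq : Fintype.card V = q ^ finrank F V := Module.card_eq_pow_finrank (K := F)
  have hsum : ∑ x : ι → G, Nat.card (badSet (F := F) (J + 1) (H x)) ≤
      (1 + 2 * (N * J) * q ^ (N * J)) * g := by
    have hcard : ∀ x : ι → G, Nat.card (badSet (F := F) (J + 1) (H x)) =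
        ∑ z : V, if z ∈ badSet (F := F) (J + 1) (H x) then 1 else 0 := by
      intro x
      rw [Finset.sum_boole, Nat.card_eq_fintype_card, Fintype.card_subtype]
      rfl
    simp_rw [hcard]
    rw [Finset.sum_comm]
    have hz : ∀ z : V, (∑ x : ι → G, if z ∈ badSet (F := F) (J + 1) (H x) then 1 else 0) *
        q ^ finrank F V ≤
        (if z = 0 then q ^ finrank F V * g else 0) + 2 * (N * J) * q ^ (N * J) * g := by
      intro z
      rw [Finset.sum_boole]
      split_ifs with h0
      · refine le_trans ?_ (Nat.le_add_right _ _)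
        rw [mul_comm]
        exact Nat.mul_le_mul_left _ (Finset.card_le_univ _)
      · rw [zero_add]
        refine le_trans (Nat.mul_le_mul_right _ (Finset.card_le_card ?_))
          (card_dependent_mul_le hG h0 hL hs)
        intro x hx
        simp only [Finset.mem_filter, Finset.mem_univ, true_and] at hx ⊢
        exact mem_badSet_not_linearIndependent hN (hwalk x z) hx
    have hq : 0 < q ^ finrank F V := pow_pos Fintype.card_pos _
    refine Nat.le_of_mul_le_mul_right ?_ hq
    rw [Finset.sum_mul]
    refine (Finset.sum_le_sum fun z _ => hz z).trans (le_of_eq ?_)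
    rw [Finset.sum_add_distrib, Finset.sum_ite_eq' Finset.univ (0 : V), if_pos (Finset.mem_univ _),
      Finset.sum_const, Finset.card_univ, hVq, smul_eq_mul]
    ring
  refine le_trans ?_ hsum
  rw [← smul_eq_mul, ← Finset.sum_const]
  refine (Finset.sum_le_sum fun x hx => ?_).trans
    (Finset.sum_le_sum_of_subset (Finset.filter_subset _ _))
  exact (Finset.mem_filter.1 hx).2.le

end WalkCounting

end TransvectionWords

namespace TransvectionWords

open Module

section ListWords

variable {F V : Type*} [Field F] [AddCommGroup V] [Module F V] {ι : Type*}
  {G : Subgroup (V ≃ₗ[F] V)}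

theorem walk_add_length (x : ι → G) (s : ℕ → ι × Bool) (z : V) (W : List (ι × Bool)) (m : ℕ)
    (hW : ∀ i (hi : i < W.length), s (m + i) = W[i]) :
    walk x s z (m + W.length) =
      ((W.map (letter x)).reverse.prod : G).1 (walk x s z m) := by
  induction W generalizing m with
  | nil => simp
  | cons a W ih =>
    have h0 : s m = a := hW 0 (by simp)
    have := ih (m + 1) (fun i hi => by
      have := hW (i + 1) (by simpa using hi)
      rw [add_assoc, add_comm 1 i]
      simpa using this)
    rw [List.length_cons, add_comm W.length 1, ← add_assoc, this, walk, h0]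
    simp

theorem walk_periodic (x : ι → G) (z : V) (W : List (ι × Bool)) (s : ℕ → ι × Bool)
    (hs : ∀ j i (hi : i < W.length), s (W.length * j + i) = W[i]) (j : ℕ) :
    walk x s z (W.length * j) = (((W.map (letter x)).reverse.prod : G).1 ^ j) z := by
  induction j with
  | zero => simp [walk]
  | succ j ih =>
    rw [Nat.mul_succ, walk_add_length x s z W _ (hs j), ih, pow_succ']
    rfl

theorem badSet_conj (J : ℕ) (h p : V ≃ₗ[F] V) :
    Nat.card (badSet (F := F) J (p⁻¹ * h * p)) = Nat.card (badSet (F := F) J h) := by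
  have hconj : ∀ (h p : V ≃ₗ[F] V) (z : V), z ∈ badSet (F := F) J (p⁻¹ * h * p) ↔
      p z ∈ badSet (F := F) J h := by
    intro h p z
    refine exists_congr fun c => and_congr_right fun _ => ?_
    rw [orbitMap_apply, orbitMap_apply]
    have : ∀ i : ℕ, ((p⁻¹ * h * p) ^ i) z = p.symm ((h ^ i) (p z)) := by
      intro i
      have : (p⁻¹ * h * p) ^ i = p⁻¹ * h ^ i * p := by
        simpa using conj_pow (a := p⁻¹) (b := h) (i := i)
      rw [this]
      rfl
    simp_rw [this, ← map_smul, ← map_sum]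
    exact p.symm.map_eq_zero_iff
  refine Nat.card_congr (p.toEquiv.subtypeEquiv fun z => ?_)
  exact hconj h p z

variable [Fintype F] [FiniteDimensional F V] [Fintype (V ≃ₗ[F] V)] [Fintype ι]

/-- The quotient of the values of two positive words. -/
def wordQuotient {Γ : Type*} [Group Γ] (u v : List ι) (x : ι → Γ) : Γ :=
  (u.map x).prod⁻¹ * (v.map x).prod

open Classical in
theorem card_wordQuotient_reduced
    (hG : ∀ g : V ≃ₗ[F] V, LinearEquiv.det g = 1 → g ∈ G) {J : ℕ} (B : ℕ) {u v : List ι}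
    (hu : u ≠ []) (hlen : u.length = v.length)
    (hL : 2 * u.length * J + 1 ≤ finrank F V)
    (hhead : ∀ (h1 : 0 < u.length) (h2 : 0 < v.length), u[0] ≠ v[0])
    (hlast : ∀ (h1 : u.length - 1 < u.length) (h2 : u.length - 1 < v.length),
      u[u.length - 1] ≠ v[u.length - 1]) :
    (Finset.univ.filter fun x : ι → G =>
      B < Nat.card (badSet (F := F) (J + 1) (wordQuotient u v x : G).1)).card * B ≤
    (1 + 2 * (2 * u.length * J) * Fintype.card F ^ (2 * u.length * J)) *
      Fintype.card (ι → G) := by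
  have hr : 0 < u.length := List.length_pos_iff.2 hu
  set r := u.length with hrdef
  let W : List (ι × Bool) := v.reverse.map (fun t => (t, true)) ++ u.map (fun t => (t, false))
  have hWlen : W.length = 2 * r := by simp [W, ← hlen]; omega
  have hWl : ∀ i (hi : i < r) (hi' : i < W.length),
      W[i] = (v[r - 1 - i]'(by omega), true) := by
    intro i hi hi'
    simp only [W]
    rw [List.getElem_append_left (by simpa using (by omega : i < v.length))]
    simp [← hlen]
  have hWr : ∀ i (hi : r ≤ i) (hi' : i < W.length),
      W[i] = (u[i - r]'(by omega), false) := by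
    intro i hi hi'
    simp only [W]
    rw [List.getElem_append_right (by simpa using (by omega : v.length ≤ i))]
    simp [← hlen]
  let s : ℕ → ι × Bool := fun i => W[i % W.length]'(Nat.mod_lt _ (by omega))
  have hsW : ∀ j i (hi : i < W.length), s (W.length * j + i) = W[i] := by
    intro j i hi
    simp only [s]
    congr 1
    rw [Nat.mul_add_mod, Nat.mod_eq_of_lt hi]
  have hback : ∀ j, s j ≠ ((s (j + 1)).1, !(s (j + 1)).2) := by
    intro j
    obtain ⟨a, i, hi, rfl⟩ : ∃ a i, i < W.length ∧ j = W.length * a + i :=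
      ⟨j / W.length, j % W.length, Nat.mod_lt _ (by omega), (Nat.div_add_mod _ _).symm⟩
    rw [hsW a i hi]
    by_cases hlast' : i + 1 < W.length
    · rw [add_assoc, hsW a (i + 1) hlast']
      rcases Nat.lt_or_ge (i + 1) r with h1 | h1
      · rw [hWl i (by omega) hi, hWl (i + 1) h1 hlast']
        simp
      · rcases Nat.lt_or_ge i r with h2 | h2
        · rw [hWl i h2 hi, hWr (i + 1) h1 hlast']
          intro h
          have h' := congrArg Prod.fst h
          simp only at h'
          refine hhead hr (by omega) ?_
          have e1 : r - 1 - i = 0 := by omega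
          have e2 : i + 1 - r = 0 := by omega
          simp only [e1, e2] at h'
          exact h'.symm
        · rw [hWr i h2 hi, hWr (i + 1) h1 hlast']
          simp
    · have hi1 : i + 1 = W.length := by omega
      have : W.length * a + i + 1 = W.length * (a + 1) + 0 := by
        rw [add_assoc, hi1]; ring
      rw [this, hsW (a + 1) 0 (by omega), hWr i (by omega) hi, hWl 0 hr (by omega)]
      intro h
      have h' := congrArg Prod.fst h
      simp only at h'
      refine hlast (by omega) (by omega) ?_
      have e1 : i - r = r - 1 := by omega
      simp only [e1] at h'
      exact h'
  have hprod : ∀ x : ι → G, ((W.map (letter x)).reverse.prod : G) = wordQuotient u v x := by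
    intro x
    simp only [W, wordQuotient, List.map_append, List.map_map, List.reverse_append,
      List.prod_append, List.map_reverse, List.reverse_reverse, List.prod_inv_reverse]
    congr 1
  have := card_large_badSet_mul_le hG (s := s) (N := 2 * r) (J := J) (by omega) hL hback
    (fun x => (wordQuotient u v x : G).1) (by
      intro x z j
      rw [← hWlen, walk_periodic x z W s hsW, hprod]) B
  exact this

open Classical in
theorem card_wordQuotient_mul_le
    (hG : ∀ g : V ≃ₗ[F] V, LinearEquiv.det g = 1 → g ∈ G) {J : ℕ} (B : ℕ) (r : ℕ)
    {u v : List ι} (hu : u.length = r) (hv : v.length = r) (huv : u ≠ v)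
    (hL : 2 * r * J + 1 ≤ finrank F V) :
    (Finset.univ.filter fun x : ι → G =>
      B < Nat.card (badSet (F := F) (J + 1) (wordQuotient u v x : G).1)).card * B ≤
    (1 + 2 * (2 * r * J) * Fintype.card F ^ (2 * r * J)) * Fintype.card (ι → G) := by
  induction r generalizing u v with
  | zero =>
    rw [List.length_eq_zero_iff] at hu hv
    exact (huv (hu.trans hv.symm)).elim
  | succ r ih =>
    have hmono : (1 + 2 * (2 * r * J) * Fintype.card F ^ (2 * r * J)) * Fintype.card (ι → G) ≤
        (1 + 2 * (2 * (r + 1) * J) * Fintype.card F ^ (2 * (r + 1) * J)) *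
          Fintype.card (ι → G) := by
      gcongr
      · omega
      · exact Fintype.card_pos
      · omega
    have hL' : 2 * r * J + 1 ≤ finrank F V := by
      have : 2 * r * J ≤ 2 * (r + 1) * J := by gcongr; omega
      omega
    by_cases hhead : u[0] = v[0]
    · obtain ⟨a, u, rfl⟩ := List.exists_cons_of_length_pos (by omega : 0 < u.length)
      obtain ⟨b, v, rfl⟩ := List.exists_cons_of_length_pos (by omega : 0 < v.length)
      obtain rfl : a = b := by simpa using hhead
      have hw : ∀ x : ι → G, wordQuotient (a :: u) (a :: v) x = wordQuotient u v x := by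
        intro x
        simp [wordQuotient, mul_assoc]
      simp_rw [hw]
      exact (ih (by simpa using hu) (by simpa using hv) (by simpa using huv) hL').trans hmono
    · by_cases hlast : u[u.length - 1] = v[u.length - 1]
      · have hu0 : u ≠ [] := by rintro rfl; simp at hu
        have hv0 : v ≠ [] := by rintro rfl; simp at hv
        rcases List.eq_nil_or_concat u with h | ⟨u, a, rfl⟩
        · exact (hu0 h).elim
        rcases List.eq_nil_or_concat v with h | ⟨v, b, rfl⟩
        · exact (hv0 h).elim
        have hul : u.length = r := by simpa using hu
        have hvl : v.length = r := by simpa using hv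
        obtain rfl : a = b := by
          have e : u.length = v.length := hul.trans hvl.symm
          simpa [e] using hlast
        have hw : ∀ x : ι → G, ((wordQuotient (u ++ [a]) (v ++ [a]) x : G) : V ≃ₗ[F] V) =
            (x a : V ≃ₗ[F] V)⁻¹ * (wordQuotient u v x : G).1 * (x a : V ≃ₗ[F] V) := by
          intro x
          rw [← Subgroup.coe_inv, ← Subgroup.coe_mul, ← Subgroup.coe_mul]
          congr 1
          simp [wordQuotient, mul_assoc]
        simp_rw [List.concat_eq_append, hw, badSet_conj]
        exact (ih hul hvl (by rintro rfl; exact huv rfl) hL').trans hmono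
      · have := card_wordQuotient_reduced hG (J := J) B (u := u) (v := v)
          (by rintro rfl; simp at hu) (by omega) (by rw [hu]; exact hL)
          (fun _ _ => hhead) (fun _ _ => hlast)
        rwa [hu] at this

end ListWords

end TransvectionWords

namespace TransvectionWords

open Module Polynomial

section Model

variable {F : Type*} [Field F]

/-- The space carrying the part of the model element which is not semisimple and without
eigenvalues. -/
abbrev Tail (F : Type*) (r : ℕ) : Type _ := (F × F) × F × (Fin r → F)

theorem snd_one_zero : LinearMap.snd F F F ((1 : F), (0 : F)) = 0 := by
  simp

/-- The automorphism `((a, b), c, u) ↦ ((a + b, b), α c, u)`. -/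
noncomputable def tailMap (r : ℕ) (α : F) : Tail F r →ₗ[F] Tail F r :=
  LinearMap.prodMap
    (LinearEquiv.transvection (snd_one_zero (F := F))).toLinearMap
    (LinearMap.prodMap (α • LinearMap.id) LinearMap.id)

theorem tailMap_apply (r : ℕ) (α a b c : F) (u : Fin r → F) :
    tailMap r α ((a, b), c, u) = ((a + b, b), α * c, u) := by
  have h : LinearEquiv.transvection (snd_one_zero (F := F)) (a, b) = (a + b, b) := by
    rw [LinearEquiv.transvection.apply]
    simp
  exact Prod.ext h rfl

theorem det_tailMap (r : ℕ) (α : F) : LinearMap.det (tailMap r α) = α := by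
  rw [tailMap, LinearMap.det_prodMap, LinearMap.det_prodMap, LinearMap.det_id,
    ← LinearEquiv.coe_det, LinearEquiv.transvection.det_eq_one, LinearMap.det_smul]
  simp

theorem tailMap_pow_apply (r : ℕ) (α a b c : F) (u : Fin r → F) (i : ℕ) :
    (tailMap r α ^ i) ((a, b), c, u) = ((a + i * b, b), α ^ i * c, u) := by
  induction i with
  | zero => simp
  | succ i ih =>
    rw [pow_succ', Module.End.mul_apply, ih, tailMap_apply]
    simp only [Prod.mk.injEq, and_true, Nat.cast_add, Nat.cast_one]
    constructor <;> ring

/-- A polynomial annihilating `tailMap`. -/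
noncomputable def tailPoly (α : F) : F[X] := (X - C 1) ^ 2 * (X - C α)

theorem aeval_tailPoly (r : ℕ) (α : F) : aeval (tailMap r α) (tailPoly α) = 0 := by
  refine LinearMap.ext fun w => ?_
  obtain ⟨⟨a, b⟩, c, u⟩ := w
  simp only [tailPoly, map_mul, map_sub, aeval_X, aeval_C, pow_two, Module.End.mul_apply,
    LinearMap.sub_apply, tailMap_apply, Module.algebraMap_end_apply]
  ext <;> simp [tailMap_apply]

theorem isCoprime_tailPoly {h : F[X]} (hh : ∀ a, ¬ h.IsRoot a) (α : F) :
    IsCoprime h (tailPoly α) := by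
  have key : ∀ a, IsCoprime h (X - C a) := fun a =>
    ((irreducible_X_sub_C a).coprime_iff_not_dvd.2 fun hd => hh a (dvd_iff_isRoot.1 hd)).symm
  exact (key 1).pow_right.mul_right (key α)

variable {V : Type*} [AddCommGroup V] [Module F V] {f : F[X]} {r : ℕ} {α : F}
  {e : V ≃ₗ[F] AdjoinRoot f × Tail F r} {g : V ≃ₗ[F] V}

theorem model_aeval_apply
    (hg : ∀ v, e (g v) = (AdjoinRoot.root f * (e v).1, tailMap r α (e v).2)) (p : F[X]) (v : V) :
    e (aeval (g : V →ₗ[F] V) p v) =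
      (AdjoinRoot.mk f p * (e v).1, aeval (tailMap r α) p (e v).2) := by
  induction p using Polynomial.induction_on' with
  | add p q hp hq =>
    simp only [map_add, LinearMap.add_apply, hp, hq, add_mul, Prod.mk_add_mk]
  | monomial i a =>
    have hpow : ∀ i : ℕ, e (((g : V →ₗ[F] V) ^ i) v) =
        (AdjoinRoot.root f ^ i * (e v).1, (tailMap r α ^ i) (e v).2) := by
      intro i
      induction i with
      | zero => simp
      | succ i ih =>
        rw [pow_succ', Module.End.mul_apply, LinearEquiv.coe_coe, hg, ih, pow_succ' (tailMap r α),
          Module.End.mul_apply]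
        simp only [pow_succ', mul_assoc]
    rw [← C_mul_X_pow_eq_monomial]
    simp only [map_mul, aeval_C, map_pow, aeval_X, Module.End.mul_apply,
      Module.algebraMap_end_apply, map_smul, hpow, AdjoinRoot.mk_X, AdjoinRoot.mk_C,
      Prod.smul_mk, mul_assoc]
    rw [Algebra.smul_def, AdjoinRoot.algebraMap_eq]

theorem model_dvd_of_aeval_eq_zero
    (hg : ∀ v, e (g v) = (AdjoinRoot.root f * (e v).1, tailMap r α (e v).2)) {p : F[X]}
    (hp : aeval (g : V →ₗ[F] V) p = 0) : f ∣ p := by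
  have := model_aeval_apply hg p (e.symm (1, 0))
  rw [hp] at this
  have h1 := congrArg Prod.fst this
  simp only [LinearMap.zero_apply, map_zero, e.apply_symm_apply, Prod.fst_zero, mul_one] at h1
  exact AdjoinRoot.mk_eq_zero.1 h1.symm

theorem model_aeval_mul_tailPoly
    (hg : ∀ v, e (g v) = (AdjoinRoot.root f * (e v).1, tailMap r α (e v).2)) :
    aeval (g : V →ₗ[F] V) (f * tailPoly α) = 0 := by
  refine LinearMap.ext fun v => e.injective ?_
  rw [model_aeval_apply hg, map_mul, map_mul, aeval_tailPoly]
  simp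

theorem model_finrank_range
    (hg : ∀ v, e (g v) = (AdjoinRoot.root f * (e v).1, tailMap r α (e v).2)) {m : ℕ}
    (hf : f ∣ X ^ m - 1) (hα : α ^ m = 1) (hm : (m : F) ≠ 0) :
    finrank F (LinearMap.range ((g ^ m : V ≃ₗ[F] V) - 1 : V →ₗ[F] V)) = 1 := by
  have hpow : ∀ v, e ((g ^ m : V ≃ₗ[F] V) v) = ((e v).1, (tailMap r α ^ m) (e v).2) := by
    intro v
    have := model_aeval_apply hg (X ^ m) v
    have hroot : AdjoinRoot.mk f (X ^ m) = 1 := by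
      rw [← sub_eq_zero, ← map_one (AdjoinRoot.mk f), ← map_sub, AdjoinRoot.mk_eq_zero]
      exact hf
    rw [hroot, one_mul, map_pow, aeval_X, map_pow, aeval_X] at this
    rw [← this]
    congr 1
    exact LinearMap.congr_fun
      (map_pow (LinearEquiv.automorphismGroup.toLinearMapMonoidHom (R := F) (M := V)) g m) v
  have hdiff : ∀ v, ((g ^ m : V ≃ₗ[F] V) - 1 : V →ₗ[F] V) v =
      (m * (e v).2.1.2) • e.symm (0, ((1, 0), 0, 0)) := by
    intro v
    apply e.injective
    rw [LinearMap.sub_apply, LinearEquiv.coe_coe, Module.End.one_apply, map_sub, hpow, map_smul,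
      e.apply_symm_apply]
    rcases e v with ⟨k, ⟨a, b⟩, c, u⟩
    rw [tailMap_pow_apply, hα]
    ext <;> simp
  have hrange : LinearMap.range ((g ^ m : V ≃ₗ[F] V) - 1 : V →ₗ[F] V) =
      F ∙ e.symm (0, ((1, 0), 0, 0)) := by
    apply le_antisymm
    · rintro _ ⟨v, rfl⟩
      rw [hdiff]
      exact Submodule.smul_mem _ _ (Submodule.mem_span_singleton_self _)
    · rw [Submodule.span_singleton_le_iff_mem]
      refine ⟨e.symm (0, ((0, (m : F)⁻¹), 0, 0)), ?_⟩
      rw [hdiff]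
      simp [hm]
  rw [hrange, finrank_span_singleton]
  intro h
  have := (e.symm.map_eq_zero_iff).1 h
  simp at this

theorem model_card_centralizer_le [Fintype F] [FiniteDimensional F V]
    (hg : ∀ v, e (g v) = (AdjoinRoot.root f * (e v).1, tailMap r α (e v).2))
    (hroot : ∀ a, ¬ f.IsRoot a) :
    Nat.card (Subgroup.centralizer {g}) ≤ Fintype.card F ^ (finrank F V + (r + 3) ^ 2) := by
  have : Finite V := Module.finite_of_finite F
  have hcomm : ∀ p : Subgroup.centralizer {g}, ∀ (P : F[X]) (v : V),
      (p : V ≃ₗ[F] V) (aeval (g : V →ₗ[F] V) P v) =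
        aeval (g : V →ₗ[F] V) P ((p : V ≃ₗ[F] V) v) := by
    intro p P v
    have hp : ((p : V ≃ₗ[F] V) : V →ₗ[F] V) ∘ₗ (g : V →ₗ[F] V) =
        (g : V →ₗ[F] V) ∘ₗ ((p : V ≃ₗ[F] V) : V →ₗ[F] V) := by
      have := Subgroup.mem_centralizer_singleton_iff.1 p.2
      refine LinearMap.ext fun v => ?_
      exact (LinearEquiv.congr_fun this v)
    have : Commute (((p : V ≃ₗ[F] V) : V →ₗ[F] V) : Module.End F V)
        (aeval (g : V →ₗ[F] V) P) := by
      induction P using Polynomial.induction_on' with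
      | add P Q hP hQ => rw [map_add]; exact hP.add_right hQ
      | monomial i a =>
        rw [aeval_monomial]
        exact (Algebra.commute_algebraMap_right a _).mul_right (Commute.pow_right hp i)
    exact LinearMap.congr_fun this v
  have hzero : ∀ p : Subgroup.centralizer {g}, ∀ w : Tail F r,
      (e ((p : V ≃ₗ[F] V) (e.symm (0, w)))).1 = 0 := by
    intro p w
    have h1 : aeval (g : V →ₗ[F] V) (tailPoly α) (e.symm (0, w)) = 0 := by
      apply e.injective
      rw [model_aeval_apply hg, aeval_tailPoly]
      simp
    have h2 := hcomm p (tailPoly α) (e.symm (0, w))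
    rw [h1, map_zero] at h2
    have h3 := model_aeval_apply hg (tailPoly α) ((p : V ≃ₗ[F] V) (e.symm (0, w)))
    rw [← h2, map_zero] at h3
    have h4 := (congrArg Prod.fst h3).symm
    obtain ⟨a, b, hab⟩ := isCoprime_tailPoly hroot α
    have h5 := congrArg (AdjoinRoot.mk f) hab
    rw [map_add, map_mul, map_mul, AdjoinRoot.mk_self, mul_zero, zero_add, map_one] at h5
    calc _ = AdjoinRoot.mk f b * (AdjoinRoot.mk f (tailPoly α) * _) := by
          rw [← mul_assoc, h5, one_mul]
      _ = 0 := by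
          have : AdjoinRoot.mk f (tailPoly α) * (e ((p : V ≃ₗ[F] V) (e.symm (0, w)))).1 = 0 := h4
          rw [this, mul_zero]
  let Φ : Subgroup.centralizer {g} → V × (Tail F r →ₗ[F] Tail F r) := fun p =>
    ((p : V ≃ₗ[F] V) (e.symm (1, 0)),
      LinearMap.snd F _ _ ∘ₗ e.toLinearMap ∘ₗ ((p : V ≃ₗ[F] V) : V →ₗ[F] V) ∘ₗ
        e.symm.toLinearMap ∘ₗ LinearMap.inr F _ _)
  have hΦ : Function.Injective Φ := by
    intro p p' h
    have h1 : (p : V ≃ₗ[F] V) (e.symm (1, 0)) = (p' : V ≃ₗ[F] V) (e.symm (1, 0)) :=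
      congrArg Prod.fst h
    have h2 : ∀ w : Tail F r, (e ((p : V ≃ₗ[F] V) (e.symm (0, w)))).2 =
        (e ((p' : V ≃ₗ[F] V) (e.symm (0, w)))).2 := fun w =>
      LinearMap.congr_fun (congrArg Prod.snd h) w
    apply Subtype.ext
    refine LinearEquiv.ext fun v => ?_
    obtain ⟨⟨k, w⟩, rfl⟩ := e.symm.surjective v
    have hsplit : e.symm (k, w) = e.symm (k, 0) + e.symm (0, w) := by
      rw [← map_add]; simp
    rw [hsplit, map_add, map_add]
    congr 1
    · obtain ⟨P, rfl⟩ := AdjoinRoot.mk_surjective k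
      have : e.symm (AdjoinRoot.mk f P, 0) = aeval (g : V →ₗ[F] V) P (e.symm (1, 0)) := by
        rw [e.symm_apply_eq, model_aeval_apply hg]
        simp
      rw [this, hcomm, hcomm, h1]
    · exact e.injective (Prod.ext ((hzero p w).trans (hzero p' w).symm) (h2 w))
  have : Finite (Tail F r →ₗ[F] Tail F r) := Module.finite_of_finite F
  refine (Nat.card_le_card_of_injective Φ hΦ).trans (le_of_eq ?_)
  rw [Nat.card_prod, Module.natCard_eq_pow_finrank (K := F) (V := V),
    Module.natCard_eq_pow_finrank (K := F) (V := Tail F r →ₗ[F] Tail F r), ← pow_add,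
    Nat.card_eq_fintype_card]
  congr 2
  rw [Module.finrank_linearMap]
  simp
  ring

theorem exists_model [FiniteDimensional F V] {f : F[X]} (hf : f.Monic) {r m : ℕ}
    (hdim : f.natDegree + (r + 3) = finrank F V) (hfm : f ∣ X ^ m - 1) (hm : m ≠ 0) (δ : Fˣ) :
    ∃ (α : F) (e : V ≃ₗ[F] AdjoinRoot f × Tail F r) (g : V ≃ₗ[F] V), α ≠ 0 ∧
      LinearEquiv.det g = δ ∧
      ∀ v, e (g v) = (AdjoinRoot.root f * (e v).1, tailMap r α (e v).2) := by
  have : Module.Finite F (AdjoinRoot f) := hf.finite_adjoinRoot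
  have hKdim : finrank F (AdjoinRoot f) = f.natDegree := finrank_quotient_span_eq_natDegree' hf
  have hVdim : finrank F V = finrank F (AdjoinRoot f × Tail F r) := by
    rw [← hdim, Module.finrank_prod, hKdim]
    simp
    ring
  let e := LinearEquiv.ofFinrankEq V (AdjoinRoot f × Tail F r) hVdim
  let μ : AdjoinRoot f →ₗ[F] AdjoinRoot f := LinearMap.mulLeft F (AdjoinRoot.root f)
  have hμ : LinearMap.det μ ≠ 0 := by
    intro h0
    have hroot : AdjoinRoot.root f ^ m = 1 := by
      rw [← sub_eq_zero, ← AdjoinRoot.mk_X, ← map_one (AdjoinRoot.mk f), ← map_pow, ← map_sub,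
        AdjoinRoot.mk_eq_zero]
      exact hfm
    have : μ ^ m = 1 := by
      rw [LinearMap.pow_mulLeft, hroot, LinearMap.mulLeft_one]
      rfl
    have h1 := congrArg LinearMap.det this
    rw [map_pow, h0, map_one, zero_pow hm] at h1
    exact zero_ne_one h1
  let α : F := (LinearMap.det μ)⁻¹ * δ
  let g₀ : V →ₗ[F] V := e.symm.toLinearMap ∘ₗ LinearMap.prodMap μ (tailMap r α) ∘ₗ e.toLinearMap
  have hdet : LinearMap.det g₀ = δ := by
    have : g₀ = e.symm.toLinearMap ∘ₗ LinearMap.prodMap μ (tailMap r α) ∘ₗ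
        e.symm.symm.toLinearMap := rfl
    rw [this, LinearMap.det_conj, LinearMap.det_prodMap, det_tailMap]
    simp only [α]
    rw [← mul_assoc, mul_inv_cancel₀ hμ, one_mul]
  have hunit : IsUnit (LinearMap.det g₀) := by rw [hdet]; exact δ.isUnit
  refine ⟨α, e, LinearMap.equivOfDetNeZero g₀ hunit.ne_zero,
    mul_ne_zero (inv_ne_zero hμ) δ.ne_zero, ?_, ?_⟩
  · ext
    rw [LinearEquiv.coe_det]
    exact hdet
  · intro v
    change e (g₀ v) = _
    simp only [g₀, LinearMap.comp_apply, LinearEquiv.coe_coe, e.apply_symm_apply]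
    rfl

end Model

end TransvectionWords

namespace TransvectionWords

open Module Polynomial

section Density

theorem aeval_conj_eq_zero {F V : Type*} [Field F] [AddCommGroup V] [Module F V]
    {g y : V ≃ₗ[F] V} {P : F[X]}
    (h : aeval (g : V →ₗ[F] V) P = 0) :
    aeval ((y * g * y⁻¹ : V ≃ₗ[F] V) : V →ₗ[F] V) P = 0 := by
  have : ((y * g * y⁻¹ : V ≃ₗ[F] V) : V →ₗ[F] V) = y.conjAlgEquiv F (g : V →ₗ[F] V) := rfl
  rw [this, aeval_algEquiv, AlgHom.comp_apply, h, map_zero]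

variable {F : Type*} [Field F] [Fintype F]

theorem exists_finset_irreducible {d : ℕ} (hd : d.Prime) :
    ∃ I : Finset F[X], (∀ a ∈ I, a.Monic ∧ Irreducible a ∧ a.natDegree = d ∧
      a ∣ X ^ (Fintype.card F ^ d - 1) - 1) ∧
      Fintype.card F ^ d ≤ Fintype.card F + d * I.card := by
  classical
  obtain ⟨p, hp⟩ := CharP.exists F
  have hpp : Fact p.Prime := ⟨CharP.char_is_prime F p⟩
  have : NeZero d := ⟨hd.ne_zero⟩
  let K := FiniteField.Extension F p d
  have : Finite K := Module.finite_of_finite F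
  have := Fintype.ofFinite K
  have hK : Fintype.card K = Fintype.card F ^ d := by
    rw [← Nat.card_eq_fintype_card, FiniteField.natCard_extension, Nat.card_eq_fintype_card]
  let U : Finset K := Finset.univ.filter fun x => x ∉ Set.range (algebraMap F K)
  have hU : Fintype.card F ^ d ≤ Fintype.card F + U.card := by
    have h := Finset.card_filter_add_card_filter_not (s := (Finset.univ : Finset K))
      (fun x => x ∈ Set.range (algebraMap F K))
    rw [Finset.card_univ, hK] at h
    have h1 : (Finset.univ.filter fun x => x ∈ Set.range (algebraMap F K)).card ≤
        Fintype.card F := by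
      have : (Finset.univ.filter fun x => x ∈ Set.range (algebraMap F K)) ⊆
          Finset.univ.image (algebraMap F K) := by
        intro x hx
        simpa using hx
      exact (Finset.card_le_card this).trans Finset.card_image_le
    change _ + U.card = _ at h
    omega
  have hintegral : ∀ x : K, IsIntegral F x := fun x => Algebra.IsIntegral.isIntegral x
  have hdeg : ∀ x ∈ U, (minpoly F x).natDegree = d := by
    intro x hx
    have hdvd : (minpoly F x).natDegree ∣ d := by
      have := minpoly.degree_dvd (hintegral x)
      rwa [FiniteField.finrank_extension] at this
    rcases (Nat.dvd_prime hd).1 hdvd with h | h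
    · exact ((Finset.mem_filter.1 hx).2 (minpoly.natDegree_eq_one_iff.1 h)).elim
    · exact h
  refine ⟨U.image (minpoly F), ?_, ?_⟩
  · intro a ha
    obtain ⟨x, hx, rfl⟩ := Finset.mem_image.1 ha
    refine ⟨minpoly.monic (hintegral x), minpoly.irreducible (hintegral x), hdeg x hx,
      minpoly.dvd F x ?_⟩
    have hx0 : x ≠ 0 := by
      rintro rfl
      exact (Finset.mem_filter.1 hx).2 ⟨0, map_zero _⟩
    rw [map_sub, map_pow, aeval_X, map_one, ← hK, FiniteField.pow_card_sub_one_eq_one x hx0,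
      sub_self]
  · refine hU.trans (Nat.add_le_add_left ?_ _)
    refine Finset.card_le_mul_card_image U d fun a ha => ?_
    obtain ⟨x, hx, rfl⟩ := Finset.mem_image.1 ha
    have hsub : (U.filter fun y => minpoly F y = minpoly F x) ⊆
        ((minpoly F x).aroots K).toFinset := by
      intro y hy
      rw [Multiset.mem_toFinset, mem_aroots]
      refine ⟨minpoly.ne_zero (hintegral x), ?_⟩
      rw [← (Finset.mem_filter.1 hy).2]
      exact minpoly.aeval F y
    refine (Finset.card_le_card hsub).trans ((Multiset.toFinset_card_le _).trans ?_)
    refine (card_roots' _).trans ?_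
    rw [natDegree_map, hdeg x hx]

variable {V : Type*} [AddCommGroup V] [Module F V] [FiniteDimensional F V]
  [Fintype (V ≃ₗ[F] V)]

open Classical in
theorem choose_mul_card_le {d t r : ℕ} (hd : d.Prime) (hdim : t * d + (r + 3) = finrank F V)
    (δ : Fˣ) {I : Finset F[X]} (hI : ∀ a ∈ I, a.Monic ∧ Irreducible a ∧ a.natDegree = d ∧
      a ∣ X ^ (Fintype.card F ^ d - 1) - 1) :
    I.card.choose t * Fintype.card (V ≃ₗ[F] V) ≤
      Fintype.card F ^ (finrank F V + (r + 3) ^ 2) *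
      (Finset.univ.filter fun g : V ≃ₗ[F] V => LinearEquiv.det g = δ ∧
        finrank F (LinearMap.range ((g ^ (Fintype.card F ^ d - 1) : V ≃ₗ[F] V) - 1 :
          V →ₗ[F] V)) = 1).card := by
  set q := Fintype.card F with hq
  set m := q ^ d - 1 with hm
  have hq2 : 2 ≤ q := Fintype.one_lt_card
  have hqd : q ≤ q ^ d := Nat.le_self_pow hd.ne_zero q
  have hm0 : m ≠ 0 := by omega
  have hmF : (m : F) ≠ 0 := by
    rw [hm, Nat.cast_sub (by omega), Nat.cast_pow, hq, FiniteField.cast_card_eq_zero,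
      zero_pow hd.ne_zero]
    simp
  have hpowm : ∀ α : F, α ≠ 0 → α ^ m = 1 := by
    intro α hα
    have h1 := FiniteField.pow_card_pow d α
    have h2 : α ^ m * α = 1 * α := by
      rw [← pow_succ, one_mul, hm, Nat.sub_add_cancel (by omega)]
      exact h1
    exact mul_right_cancel₀ hα h2
  let 𝒜 := {A : Finset F[X] // A ∈ I.powersetCard t}
  have hprop : ∀ A : 𝒜, (∏ a ∈ A.1, a).Monic ∧ (∏ a ∈ A.1, a).natDegree = t * d ∧
      (∏ a ∈ A.1, a) ∣ X ^ m - 1 ∧ ∀ b, ¬ (∏ a ∈ A.1, a).IsRoot b := by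
    intro A
    obtain ⟨hAI, hAt⟩ := Finset.mem_powersetCard.1 A.2
    refine ⟨monic_prod_of_monic _ _ fun a ha => (hI a (hAI ha)).1, ?_, ?_, ?_⟩
    · rw [natDegree_prod_of_monic _ _ fun a ha => (hI a (hAI ha)).1,
        Finset.sum_congr rfl fun a ha => (hI a (hAI ha)).2.2.1, Finset.sum_const, hAt, smul_eq_mul]
    · refine Finset.prod_dvd_of_coprime ?_ fun a ha => (hI a (hAI ha)).2.2.2
      intro a ha b hb hab
      refine ((hI a (hAI ha)).2.1.coprime_iff_not_dvd).2 fun hdvd => hab ?_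
      exact eq_of_monic_of_associated (hI a (hAI ha)).1 (hI b (hAI hb)).1
        ((hI a (hAI ha)).2.1.associated_of_dvd (hI b (hAI hb)).2.1 hdvd)
    · intro b hb
      rw [IsRoot, eval_prod, Finset.prod_eq_zero_iff] at hb
      obtain ⟨a, ha, hab⟩ := hb
      have h1 := degree_eq_one_of_irreducible_of_root (hI a (hAI ha)).2.1 hab
      have h2 := (hI a (hAI ha)).2.2.1
      rw [natDegree_eq_of_degree_eq_some h1] at h2
      exact hd.ne_one h2.symm
  choose α e g hα hdet hg using fun A : 𝒜 => exists_model (V := V) (hprop A).1 (r := r)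
    (by rw [(hprop A).2.1, hdim]) (hprop A).2.2.1 hm0 δ
  let Ψ : 𝒜 × (V ≃ₗ[F] V) → (V ≃ₗ[F] V) := fun x => x.2 * g x.1 * x.2⁻¹
  have hsep : ∀ (A B : 𝒜) (y z : V ≃ₗ[F] V), y * g A * y⁻¹ = z * g B * z⁻¹ → A = B := by
    intro A B y z h
    have h1 : aeval (g B : V →ₗ[F] V) ((∏ a ∈ A.1, a) * tailPoly (α A)) = 0 := by
      have h2 := aeval_conj_eq_zero (y := z⁻¹ * y) (model_aeval_mul_tailPoly (hg A))
      have h3 : z⁻¹ * y * g A * (z⁻¹ * y)⁻¹ = g B := by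
        calc z⁻¹ * y * g A * (z⁻¹ * y)⁻¹ = z⁻¹ * (y * g A * y⁻¹) * z := by group
          _ = g B := by rw [h]; group
      rwa [h3] at h2
    have h4 : (∏ a ∈ B.1, a) ∣ ∏ a ∈ A.1, a :=
      (isCoprime_tailPoly (hprop B).2.2.2 (α A)).dvd_of_dvd_mul_right
        (model_dvd_of_aeval_eq_zero (hg B) h1)
    obtain ⟨hAI, hAt⟩ := Finset.mem_powersetCard.1 A.2
    obtain ⟨hBI, hBt⟩ := Finset.mem_powersetCard.1 B.2
    have hBA : B.1 ⊆ A.1 := by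
      intro b hb
      obtain ⟨a, ha, hba⟩ := ((hI b (hBI hb)).2.1.prime.dvd_finsetProd_iff _).1
        ((Finset.dvd_prod_of_mem _ hb).trans h4)
      have : b = a := eq_of_monic_of_associated (hI b (hBI hb)).1 (hI a (hAI ha)).1
        ((hI b (hBI hb)).2.1.associated_of_dvd (hI a (hAI ha)).2.1 hba)
      rwa [this]
    exact Subtype.ext (Finset.eq_of_subset_of_card_le hBA (by omega)).symm
  have hcard : Fintype.card (𝒜 × (V ≃ₗ[F] V)) = I.card.choose t * Fintype.card (V ≃ₗ[F] V) := by
    rw [Fintype.card_prod, Fintype.card_coe, Finset.card_powersetCard]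
  rw [← hcard, ← Finset.card_univ]
  refine (Finset.card_le_mul_card_image (f := Ψ) Finset.univ
    (q ^ (finrank F V + (r + 3) ^ 2)) ?_).trans (Nat.mul_le_mul_left _ (Finset.card_le_card ?_))
  · intro h hh
    obtain ⟨⟨A, y⟩, -, rfl⟩ := Finset.mem_image.1 hh
    refine le_trans ?_ (model_card_centralizer_le (hg A) (hprop A).2.2.2)
    rw [← Fintype.card_subtype, ← Nat.card_eq_fintype_card]
    have hfst : ∀ x : {x : 𝒜 × (V ≃ₗ[F] V) // Ψ x = Ψ (A, y)}, x.1.1 = A := fun x =>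
      hsep _ _ _ _ x.2
    refine Nat.card_le_card_of_injective
      (fun x : {x : 𝒜 × (V ≃ₗ[F] V) // Ψ x = Ψ (A, y)} =>
        (⟨y⁻¹ * x.1.2, ?_⟩ : Subgroup.centralizer {g A})) ?_
    · rw [Subgroup.mem_centralizer_singleton_iff]
      have h1 : x.1.2 * g x.1.1 * x.1.2⁻¹ = y * g A * y⁻¹ := x.2
      rw [hfst x] at h1
      rw [mul_inv_eq_iff_eq_mul] at h1
      rw [mul_assoc, h1]
      group
    · intro x x' hxx
      have h1 := congrArg Subtype.val hxx
      exact Subtype.ext (Prod.ext ((hfst x).trans (hfst x').symm) (mul_left_cancel h1))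
  · intro h hh
    obtain ⟨⟨A, y⟩, -, rfl⟩ := Finset.mem_image.1 hh
    simp only [Finset.mem_filter, Finset.mem_univ, true_and, Ψ]
    refine ⟨by rw [map_mul, map_mul, map_inv, hdet, mul_inv_cancel_comm], ?_⟩
    have := model_finrank_range (hg A) (m := m) (hprop A).2.2.1 (hpowm _ (hα A)) hmF
    rw [← this]
    have hconj : (((y * g A * y⁻¹) ^ m : V ≃ₗ[F] V) - 1 : V →ₗ[F] V) =
        (y : V →ₗ[F] V) ∘ₗ ((g A ^ m : V ≃ₗ[F] V) - 1 : V →ₗ[F] V) ∘ₗ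
          (y.symm : V →ₗ[F] V) := by
      rw [conj_pow]
      refine LinearMap.ext fun v => ?_
      simp
    rw [hconj, LinearMap.range_comp, LinearMap.range_comp, LinearEquiv.range, Submodule.map_top]
    exact LinearEquiv.finrank_map_eq y _

end Density

end TransvectionWords

namespace TransvectionWords

open Module Polynomial

section Parameters

theorem pow_le_mul_choose {q d n t I : ℕ} (hq : 2 ≤ q) (hd : 2 ≤ d) (ht : t * d ≤ n)
    (hI : q ^ d ≤ q + d * I) (hn : 4 * n ≤ q ^ d) : q ^ (d * t) ≤ (4 * n) ^ t * I.choose t := by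
  have h2q : 2 * q ≤ q ^ d :=
    calc 2 * q ≤ q * q := Nat.mul_le_mul_right _ hq
      _ = q ^ 2 := (sq q).symm
      _ ≤ q ^ d := Nat.pow_le_pow_right (by omega) hd
  have hdI : q ^ d ≤ 2 * (d * I) := by omega
  have h2t : 2 * t ≤ I := by
    have : d * (2 * t) ≤ d * I := by nlinarith
    exact Nat.le_of_mul_le_mul_left this (by omega)
  have hstep : q ^ d ≤ 4 * d * (I + 1 - t) := by
    have : I ≤ 2 * (I + 1 - t) := by omega
    nlinarith
  calc q ^ (d * t) = (q ^ d) ^ t := pow_mul _ _ _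
    _ ≤ (4 * d * (I + 1 - t)) ^ t := Nat.pow_le_pow_left hstep _
    _ = (4 * d) ^ t * (I + 1 - t) ^ t := mul_pow _ _ _
    _ ≤ (4 * d) ^ t * (t.factorial * I.choose t) := by
        rw [← Nat.descFactorial_eq_factorial_mul_choose]
        exact Nat.mul_le_mul_left _ (Nat.pow_sub_le_descFactorial _ _)
    _ ≤ (4 * d) ^ t * (t ^ t * I.choose t) :=
        Nat.mul_le_mul_left _ (Nat.mul_le_mul_right _ (Nat.factorial_le_pow t))
    _ = (4 * (t * d)) ^ t * I.choose t := by
        rw [← mul_assoc, ← mul_pow]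
        ring_nf
    _ ≤ _ := Nat.mul_le_mul_right _ (Nat.pow_le_pow_left (by omega) _)

theorem pow_le_choose_mul_pow {q d n t r I : ℕ} (hq : 2 ≤ q) (hd : 2 ≤ d)
    (hdim : t * d + (r + 3) = n) (hr : r < d) (hI : q ^ d ≤ q + d * I)
    (hn : (4 * n) ^ 2000 ≤ q ^ d) (hdn : 2000 * (d + 5) ^ 2 ≤ n) :
    q ^ (n + (r + 3) ^ 2) ≤ I.choose t * q ^ (n / 1000) := by
  have h1 := pow_le_mul_choose (t := t) (n := n) hq hd (by omega) hI
    ((Nat.le_self_pow (by norm_num) _).trans hn)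
  have h2 : q ^ (d * t) * q ^ (d * t * 1999) ≤ q ^ (d * t) * I.choose t ^ 2000 :=
    calc q ^ (d * t) * q ^ (d * t * 1999) = (q ^ (d * t)) ^ 2000 := by
          rw [← pow_add, ← pow_mul]; congr 1; ring
      _ ≤ ((4 * n) ^ t * I.choose t) ^ 2000 := Nat.pow_le_pow_left h1 _
      _ = ((4 * n) ^ 2000) ^ t * I.choose t ^ 2000 := by
          rw [mul_pow, ← pow_mul, ← pow_mul, mul_comm t]
      _ ≤ (q ^ d) ^ t * I.choose t ^ 2000 :=
          Nat.mul_le_mul_right _ (Nat.pow_le_pow_left hn _)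
      _ = _ := by rw [← pow_mul]
  have h3 : q ^ (d * t * 1999) ≤ I.choose t ^ 2000 :=
    Nat.le_of_mul_le_mul_left h2 (pow_pos (by omega) _)
  refine (Nat.pow_le_pow_iff_left (n := 2000) (by norm_num)).1 ?_
  calc (q ^ (n + (r + 3) ^ 2)) ^ 2000 = q ^ ((n + (r + 3) ^ 2) * 2000) := (pow_mul _ _ _).symm
    _ ≤ q ^ (d * t * 1999 + n / 1000 * 2000) := by
        refine Nat.pow_le_pow_right (by omega) ?_
        have hdt : d * t = n - (r + 3) := by rw [mul_comm]; omega
        have h5 : (r + 3) ^ 2 ≤ (d + 2) ^ 2 := Nat.pow_le_pow_left (by omega) _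
        have h6 : (d + 5) ^ 2 = (d + 2) ^ 2 + 6 * d + 21 := by ring
        rw [hdt]
        generalize (r + 3) ^ 2 = R at *
        omega
    _ = q ^ (d * t * 1999) * (q ^ (n / 1000)) ^ 2000 := by rw [pow_add, ← pow_mul]
    _ ≤ I.choose t ^ 2000 * (q ^ (n / 1000)) ^ 2000 := Nat.mul_le_mul_right _ h3
    _ = _ := (mul_pow _ _ _).symm

open Classical in
theorem card_le_mul_card_pow_transvection {F V : Type*} [Field F] [Fintype F] [AddCommGroup V]
    [Module F V] [FiniteDimensional F V] [Fintype (V ≃ₗ[F] V)] {d : ℕ} (hd : d.Prime)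
    (hn : (4 * finrank F V) ^ 2000 ≤ Fintype.card F ^ d) (hdn : 2000 * (d + 5) ^ 2 ≤ finrank F V)
    (δ : Fˣ) :
    Fintype.card (V ≃ₗ[F] V) ≤ Fintype.card F ^ (finrank F V / 1000) *
      (Finset.univ.filter fun g : V ≃ₗ[F] V => LinearEquiv.det g = δ ∧
        finrank F (LinearMap.range ((g ^ (Fintype.card F ^ d - 1) : V ≃ₗ[F] V) - 1 :
          V →ₗ[F] V)) = 1).card := by
  obtain ⟨I, hI, hIcard⟩ := exists_finset_irreducible (F := F) hd
  set n := finrank F V with hndef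
  have h3 : 3 ≤ n := by nlinarith
  have hdim : (n - 3) / d * d + ((n - 3) % d + 3) = n := by
    have := Nat.div_add_mod' (n - 3) d
    omega
  have h1 := choose_mul_card_le (V := V) hd hdim δ hI
  have h2 := pow_le_choose_mul_pow Fintype.one_lt_card hd.two_le hdim
    (Nat.mod_lt _ hd.pos) hIcard hn hdn
  set q := Fintype.card F
  have hpos : 0 < q ^ (n + ((n - 3) % d + 3) ^ 2) := pow_pos Fintype.card_pos _
  refine Nat.le_of_mul_le_mul_left ?_ hpos
  rw [← hndef] at h1
  calc _ ≤ I.card.choose ((n - 3) / d) * q ^ (n / 1000) * Fintype.card (V ≃ₗ[F] V) :=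
        Nat.mul_le_mul_right _ h2
    _ = q ^ (n / 1000) * (I.card.choose ((n - 3) / d) * Fintype.card (V ≃ₗ[F] V)) := by ring
    _ ≤ q ^ (n / 1000) * _ := Nat.mul_le_mul_left _ h1
    _ = _ := by ring

theorem eventually_log_sq_le :
    ∀ᶠ n : ℕ in Filter.atTop, 2000 * (10000 * Real.log (4 * n)) ^ 2 ≤ n ∧
      1 ≤ Real.log (4 * n) := by
  have h1 : Filter.Tendsto (fun n : ℕ => 4 * (n : ℝ)) Filter.atTop Filter.atTop :=
    tendsto_natCast_atTop_atTop.const_mul_atTop (by norm_num)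
  have h2 := (Real.isLittleO_pow_log_id_atTop (n := 2)).bound
    (c := 1 / (2000 * 10000 ^ 2 * 4)) (by norm_num)
  have h3 := h1.eventually h2
  have h4 := (Real.tendsto_log_atTop.comp h1).eventually_ge_atTop 1
  filter_upwards [h3, h4] with n hn hn'
  refine ⟨?_, hn'⟩
  simp only [id, Real.norm_eq_abs, abs_pow, sq_abs] at hn
  rw [abs_of_nonneg (by positivity : (0 : ℝ) ≤ 4 * n)] at hn
  nlinarith

theorem eventually_exists_prime :
    ∀ᶠ n : ℕ in Filter.atTop, ∀ q : ℕ, 2 ≤ q → ∃ d : ℕ, d.Prime ∧ (4 * n) ^ 2000 ≤ q ^ d ∧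
      2000 * (d + 5) ^ 2 ≤ n ∧ q ^ d ≤ q ^ 2 * (4 * n) ^ 8000 := by
  filter_upwards [eventually_log_sq_le, Filter.eventually_ge_atTop 1] with n hn hn1 q hq
  obtain ⟨hn, hlog⟩ := hn
  set M := (4 * n) ^ 2000 with hM
  have hM1 : 1 < M := Nat.one_lt_pow (by norm_num) (by omega)
  set d₀ := Nat.clog q M with hd₀
  have hd₀pos : 0 < d₀ := Nat.clog_pos hq hM1
  have hMle : M ≤ q ^ d₀ := Nat.le_pow_clog hq M
  have hlt : q ^ (d₀ - 1) < M := Nat.pow_pred_clog_lt_self hq hM1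
  have hd₀log : ((d₀ : ℝ) - 1) ≤ 4000 * Real.log (4 * n) := by
    have h1 : (2 : ℝ) ^ (d₀ - 1) ≤ (4 * n) ^ 2000 := by
      have : 2 ^ (d₀ - 1) ≤ (4 * n) ^ 2000 := (Nat.pow_le_pow_left hq _).trans hlt.le
      exact_mod_cast this
    have h2 := Real.log_le_log (by positivity) h1
    rw [Real.log_pow, Real.log_pow, Nat.cast_sub hd₀pos] at h2
    have h3 : (1 : ℝ) / 2 ≤ Real.log 2 := by
      have := Real.log_two_gt_d9
      linarith
    have h4 : (1 : ℝ) ≤ d₀ := by exact_mod_cast hd₀pos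
    push_cast at h2
    nlinarith
  have hfin : ∀ d : ℕ, d ≤ 2 * d₀ → 2000 * (d + 5) ^ 2 ≤ n := by
    intro d hd
    have h1 : (d : ℝ) ≤ 2 * d₀ := by exact_mod_cast hd
    have h2 : (d : ℝ) + 5 ≤ 10000 * Real.log (4 * n) := by linarith
    have h3 : (2000 : ℝ) * ((d : ℝ) + 5) ^ 2 ≤ n := by
      refine le_trans ?_ hn
      gcongr
    exact_mod_cast h3
  rcases Nat.lt_or_ge 1 d₀ with h | h
  · obtain ⟨d, hdp, hd1, hd2⟩ := Nat.exists_prime_lt_and_le_two_mul d₀ (by omega)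
    refine ⟨d, hdp, hMle.trans (Nat.pow_le_pow_right (by omega) hd1.le), hfin d hd2, ?_⟩
    calc q ^ d ≤ q ^ ((d₀ - 1) * 4) := Nat.pow_le_pow_right (by omega) (by omega)
      _ = (q ^ (d₀ - 1)) ^ 4 := pow_mul _ _ _
      _ ≤ M ^ 4 := Nat.pow_le_pow_left hlt.le _
      _ = 1 * (4 * n) ^ 8000 := by rw [hM, ← pow_mul, one_mul]
      _ ≤ _ := Nat.mul_le_mul_right _ (Nat.one_le_pow _ _ (by omega))
  · have h1 : d₀ = 1 := by omega
    refine ⟨2, Nat.prime_two, hMle.trans (Nat.pow_le_pow_right (by omega) (by omega)),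
      hfin 2 (by omega), Nat.le_mul_of_pos_right _ (pow_pos (by omega) _)⟩

end Parameters

end TransvectionWords

namespace TransvectionWords

section SecondMoment

open scoped Classical

variable {Γ : Type*} [Group Γ] [Fintype Γ]

/-- The proportion of the coset `g N` lying in `S`. -/
noncomputable def cosetDensity (N : Subgroup Γ) (S : Set Γ) (g : Γ) : ℝ :=
  (∑ s : N, if g * s ∈ S then (1 : ℝ) else 0) / Fintype.card N

/-- The indicator of `S`, centred on every coset of `N` and restricted to `G`. -/
noncomputable def centredIndicator (N G : Subgroup Γ) (S : Set Γ) (g : Γ) : ℝ :=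
  if g ∈ G then (if g ∈ S then 1 else 0) - cosetDensity N S g else 0

theorem cosetDensity_mul (N : Subgroup Γ) (S : Set Γ) (g : Γ) (s : N) :
    cosetDensity N S (g * s) = cosetDensity N S g := by
  rw [cosetDensity, cosetDensity]
  congr 1
  refine Fintype.sum_equiv (Equiv.mulLeft s) _ _ fun t => ?_
  simp only [Equiv.coe_mulLeft, Subgroup.coe_mul, mul_assoc]
  congr

theorem cosetDensity_conj {N : Subgroup Γ} [N.Normal] {S : Set Γ}
    (hS : ∀ y g, y * g * y⁻¹ ∈ S ↔ g ∈ S) (y g : Γ) :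
    cosetDensity N S (y * g * y⁻¹) = cosetDensity N S g := by
  rw [cosetDensity, cosetDensity]
  congr 1
  refine Fintype.sum_equiv (MulAut.conjNormal (H := N) y⁻¹).toEquiv _ _ fun t => ?_
  have : y * g * y⁻¹ * t = y * (g * (y⁻¹ * t * y)) * y⁻¹ := by group
  rw [this, hS]
  simp

theorem cosetDensity_nonneg (N : Subgroup Γ) (S : Set Γ) (g : Γ) : 0 ≤ cosetDensity N S g := by
  exact div_nonneg (Finset.sum_nonneg fun _ _ => by split_ifs <;> norm_num) (Nat.cast_nonneg _)

theorem cosetDensity_le_one (N : Subgroup Γ) (S : Set Γ) (g : Γ) : cosetDensity N S g ≤ 1 := by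
  rw [cosetDensity, div_le_one (by exact_mod_cast Fintype.card_pos)]
  calc _ ≤ ∑ s : N, (1 : ℝ) := Finset.sum_le_sum fun _ _ => by split_ifs <;> norm_num
    _ = _ := by simp

theorem abs_centredIndicator_le (N G : Subgroup Γ) (S : Set Γ) (g : Γ) :
    |centredIndicator N G S g| ≤ 1 := by
  have h0 := cosetDensity_nonneg N S g
  have h1 := cosetDensity_le_one N S g
  rw [centredIndicator]
  split_ifs <;> rw [abs_le] <;> constructor <;> linarith

theorem centredIndicator_conj {N G : Subgroup Γ} [N.Normal] [hG : G.Normal] {S : Set Γ}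
    (hS : ∀ y g, y * g * y⁻¹ ∈ S ↔ g ∈ S) (y g : Γ) :
    centredIndicator N G S (y * g * y⁻¹) = centredIndicator N G S g := by
  have hmem : y * g * y⁻¹ ∈ G ↔ g ∈ G :=
    ⟨fun h => by simpa [mul_assoc] using hG.conj_mem _ h y⁻¹, fun h => hG.conj_mem _ h y⟩
  simp only [centredIndicator, hmem, hS, cosetDensity_conj hS]

theorem sum_centredIndicator {N G : Subgroup Γ} (hNG : N ≤ G) (S : Set Γ) (g : Γ) :
    ∑ s : N, centredIndicator N G S (g * s) = 0 := by
  have hmem : ∀ s : N, g * s ∈ G ↔ g ∈ G := fun s =>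
    ⟨fun h => by simpa using G.mul_mem h (G.inv_mem (hNG s.2)), fun h => G.mul_mem h (hNG s.2)⟩
  simp only [centredIndicator, hmem, cosetDensity_mul]
  split_ifs
  · have hN : (Fintype.card N : ℝ) ≠ 0 := by exact_mod_cast Fintype.card_ne_zero
    rw [Finset.sum_sub_distrib, Finset.sum_const, Finset.card_univ, nsmul_eq_mul, cosetDensity,
      mul_div_cancel₀ _ hN, sub_self]
  · simp

theorem sum_sq_centredIndicator_le (N G : Subgroup Γ) (S : Set Γ) :
    ∑ g, centredIndicator N G S g ^ 2 ≤ Nat.card G := by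
  have : (Nat.card G : ℝ) = ∑ g : Γ, if g ∈ G then (1 : ℝ) else 0 := by
    rw [Finset.sum_boole, Nat.card_eq_fintype_card, Fintype.card_subtype]
  rw [this]
  refine Finset.sum_le_sum fun g _ => ?_
  have h1 := abs_centredIndicator_le N G S g
  split_ifs with h
  · rw [← sq_abs]
    exact pow_le_one₀ (abs_nonneg _) h1
  · simp [centredIndicator, h]

theorem sum_centredIndicator_translate (N G : Subgroup Γ) (S : Set Γ) (a b : G) :
    ∑ x : G, centredIndicator N G S (x * a) * centredIndicator N G S (x * b) =
      ∑ g : Γ, centredIndicator N G S g * centredIndicator N G S (g * (a⁻¹ * b : G)) := by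
  set f := centredIndicator N G S with hf
  have h1 : ∑ g : Γ, f g * f (g * (a⁻¹ * b : G)) = ∑ x : G, f x * f (x * (a⁻¹ * b : G)) := by
    rw [← Finset.sum_subtype (Finset.univ.filter fun g => g ∈ G) (by simp)
      (fun g => f g * f (g * (a⁻¹ * b : G))), Finset.sum_filter_of_ne]
    intro g _ hne
    by_contra h
    exact hne (by simp [hf, centredIndicator, h])
  rw [h1]
  refine Fintype.sum_equiv (Equiv.mulRight a) _ _ fun x => ?_
  simp [mul_assoc]

theorem card_avoid_mul_le {N G : Subgroup Γ} [N.Normal] [G.Normal] (hNG : N ≤ G) {S : Set Γ}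
    (hS : ∀ y g, y * g * y⁻¹ ∈ S ↔ g ∈ S) {p Λ β : ℝ} (hp0 : 0 ≤ p) (hΛ : 0 ≤ Λ) (hβ : 0 ≤ β)
    (hp : ∀ g, p ≤ cosetDensity N S g) {good : Γ → Prop}
    (hgood : ∀ h, good h → ∀ f : Γ → ℝ, (∀ y g, f (y * g * y⁻¹) = f g) →
      (∀ g, ∑ s : N, f (g * s) = 0) → |∑ g, f g * f (g * h)| ≤ Λ * ∑ g, f g ^ 2)
    {U X : Type*} [Fintype U] [Fintype X] (W : U → X → G)
    (hbad : ∀ u v, u ≠ v → ((Finset.univ.filter fun x =>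
      ¬ good ((W u x)⁻¹ * W v x : G)).card : ℝ) ≤ β * Fintype.card X) :
    ((Finset.univ.filter fun z : G × X => ∀ u, ((z.1 * W u z.2 : G) : Γ) ∉ S).card : ℝ) *
      (Fintype.card U * p) ^ 2 ≤
      Nat.card G * Fintype.card X * (Fintype.card U + Fintype.card U ^ 2 * (Λ + β)) := by
  set f := centredIndicator N G S with hf
  set gG : ℝ := (Nat.card G : ℝ) with hgG
  set cX : ℝ := (Fintype.card X : ℝ) with hcX
  have hgG0 : 0 ≤ gG := Nat.cast_nonneg _
  have hcX0 : 0 ≤ cX := Nat.cast_nonneg _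
  have hsq := sum_sq_centredIndicator_le N G S
  have hone : ∀ a b : G, ∑ x : G, f (x * a) * f (x * b) ≤ gG := by
    intro a b
    calc _ ≤ ∑ x : G, (1 : ℝ) := Finset.sum_le_sum fun x _ => by
          have h1 := abs_centredIndicator_le N G S (x * a)
          have h2 := abs_centredIndicator_le N G S (x * b)
          refine (le_abs_self _).trans ?_
          rw [abs_mul]
          exact mul_le_one₀ h1 (abs_nonneg _) h2
      _ = gG := by simp [hgG]
  have hgoodsum : ∀ a b : G, good ((a⁻¹ * b : G) : Γ) →
      ∑ x : G, f (x * a) * f (x * b) ≤ Λ * gG := by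
    intro a b hab
    rw [sum_centredIndicator_translate]
    exact (le_abs_self _).trans ((hgood _ hab _ (centredIndicator_conj hS)
      (sum_centredIndicator hNG S)).trans (mul_le_mul_of_nonneg_left hsq hΛ))
  have hpair : ∀ u v : U, ∑ y : X, ∑ x : G, f (x * W u y) * f (x * W v y) ≤
      gG * cX * ((if u = v then 1 else 0) + (Λ + β)) := by
    intro u v
    split_ifs with huv
    · calc _ ≤ ∑ y : X, gG := Finset.sum_le_sum fun y _ => hone _ _
        _ = gG * cX * 1 := by simp [hcX]; ring
        _ ≤ _ := mul_le_mul_of_nonneg_left (by linarith) (mul_nonneg hgG0 hcX0)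
    · calc _ ≤ ∑ y : X, (Λ * gG + if ¬ good ((W u y)⁻¹ * W v y : G) then gG else 0) := by
            refine Finset.sum_le_sum fun y _ => ?_
            by_cases h : good ((W u y)⁻¹ * W v y : G)
            · rw [if_neg (not_not.2 h), add_zero]
              exact hgoodsum _ _ h
            · rw [if_pos h]
              have := hone (W u y) (W v y)
              have := mul_nonneg hΛ hgG0
              linarith
        _ = cX * (Λ * gG) + ((Finset.univ.filter fun x =>
              ¬ good ((W u x)⁻¹ * W v x : G)).card : ℝ) * gG := by
            rw [Finset.sum_add_distrib, Finset.sum_const, ← Finset.sum_filter, Finset.sum_const,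
              nsmul_eq_mul, nsmul_eq_mul, Finset.card_univ]
        _ ≤ cX * (Λ * gG) + β * cX * gG := by
            gcongr
            exact hbad u v huv
        _ = _ := by ring
  have htotal : ∑ z : G × X, (∑ u, f (z.1 * W u z.2)) ^ 2 ≤
      gG * cX * (Fintype.card U + Fintype.card U ^ 2 * (Λ + β)) := by
    calc _ = ∑ u : U, ∑ v : U, ∑ y : X, ∑ x : G, f (x * W u y) * f (x * W v y) := by
          simp_rw [sq, Finset.sum_mul_sum]
          rw [Finset.sum_comm]
          refine Finset.sum_congr rfl fun u _ => ?_
          rw [Finset.sum_comm]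
          refine Finset.sum_congr rfl fun v _ => ?_
          rw [Fintype.sum_prod_type_right]
      _ ≤ ∑ u : U, ∑ v : U, gG * cX * ((if u = v then 1 else 0) + (Λ + β)) :=
          Finset.sum_le_sum fun u _ => Finset.sum_le_sum fun v _ => hpair u v
      _ = _ := by
          simp_rw [← Finset.mul_sum, Finset.sum_add_distrib]
          simp only [Finset.sum_ite_eq, Finset.mem_univ, if_true, Finset.sum_const,
            Finset.card_univ, nsmul_eq_mul]
          ring
  refine le_trans ?_ htotal
  rw [← nsmul_eq_mul, ← Finset.sum_const]
  refine (Finset.sum_le_sum fun z hz => ?_).trans (Finset.sum_le_sum_of_subset_of_nonneg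
    (Finset.filter_subset _ _) fun _ _ _ => sq_nonneg _)
  have hz' := (Finset.mem_filter.1 hz).2
  have hle : ∑ u, f (z.1 * W u z.2) ≤ -(Fintype.card U * p) := by
    calc _ ≤ ∑ _u : U, -p := Finset.sum_le_sum fun u _ => by
          have hm : (z.1 * W u z.2 : Γ) ∈ G := (z.1 * W u z.2 : G).2
          have hn : (z.1 * W u z.2 : Γ) ∉ S := hz' u
          rw [hf, centredIndicator, if_pos hm, if_neg hn, zero_sub]
          exact neg_le_neg (hp _)
      _ = _ := by simp
  have h0 : 0 ≤ Fintype.card U * p := mul_nonneg (Nat.cast_nonneg _) hp0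
  nlinarith

end SecondMoment

end TransvectionWords

namespace TransvectionWords

open Module

section Assembly

open scoped Classical

variable {F V : Type*} [Field F] [AddCommGroup V] [Module F V]

/-- The automorphisms whose `m`-th power differs from the identity by a map of rank one. -/
def rankOnePower (F V : Type*) [Field F] [AddCommGroup V] [Module F V] (m : ℕ) :
    Set (V ≃ₗ[F] V) :=
  {g | finrank F (LinearMap.range ((g ^ m : V ≃ₗ[F] V) - 1 : V →ₗ[F] V)) = 1}

theorem conj_mem_rankOnePower (m : ℕ) (y g : V ≃ₗ[F] V) :
    y * g * y⁻¹ ∈ rankOnePower F V m ↔ g ∈ rankOnePower F V m := by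
  have hconj : (((y * g * y⁻¹) ^ m : V ≃ₗ[F] V) - 1 : V →ₗ[F] V) =
      (y : V →ₗ[F] V) ∘ₗ ((g ^ m : V ≃ₗ[F] V) - 1 : V →ₗ[F] V) ∘ₗ (y.symm : V →ₗ[F] V) := by
    rw [conj_pow]
    refine LinearMap.ext fun v => ?_
    simp
  rw [rankOnePower, Set.mem_ofPred_eq, Set.mem_ofPred_eq, hconj, LinearMap.range_comp,
    LinearMap.range_comp, LinearEquiv.range, Submodule.map_top, LinearEquiv.finrank_map_eq y]

theorem normal_of_ker_det_le {G : Subgroup (V ≃ₗ[F] V)}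
    (hG : (LinearEquiv.det (R := F) (M := V)).ker ≤ G) : G.Normal := by
  refine ⟨fun g hg y => ?_⟩
  have h : y * g * y⁻¹ * g⁻¹ ∈ G := hG (by
    rw [MonoidHom.mem_ker]
    rw [map_mul, map_mul, map_mul, map_inv, map_inv, mul_inv_cancel_comm, mul_inv_cancel])
  simpa using G.mul_mem h hg

variable [Fintype F] [FiniteDimensional F V] [Fintype (V ≃ₗ[F] V)]

theorem inv_le_cosetDensity {d : ℕ} (hd : d.Prime)
    (hn : (4 * finrank F V) ^ 2000 ≤ Fintype.card F ^ d)
    (hdn : 2000 * (d + 5) ^ 2 ≤ finrank F V) (g : V ≃ₗ[F] V) :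
    ((Fintype.card F : ℝ) ^ (finrank F V / 1000))⁻¹ ≤
      cosetDensity (LinearEquiv.det (R := F) (M := V)).ker
        (rankOnePower F V (Fintype.card F ^ d - 1)) g := by
  obtain ⟨N, hN⟩ : ∃ N, N = (LinearEquiv.det (R := F) (M := V)).ker := ⟨_, rfl⟩
  rw [← hN]
  set S := rankOnePower F V (Fintype.card F ^ d - 1) with hS
  have h := card_le_mul_card_pow_transvection (V := V) hd hn hdn (LinearEquiv.det g)
  have hq : (0 : ℝ) < (Fintype.card F : ℝ) ^ (finrank F V / 1000) := by
    have : 0 < Fintype.card F := Fintype.card_pos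
    positivity
  have hNpos : (0 : ℝ) < Fintype.card N := by exact_mod_cast Fintype.card_pos
  have hcount : (Finset.univ.filter fun s : N => g * s ∈ S).card =
      (Finset.univ.filter fun y : V ≃ₗ[F] V =>
        LinearEquiv.det y = LinearEquiv.det g ∧ y ∈ S).card := by
    refine Finset.card_bij (fun s _ => g * s) ?_ ?_ ?_
    · intro s hs
      have h1 : LinearEquiv.det (s : V ≃ₗ[F] V) = 1 := MonoidHom.mem_ker.1 (hN ▸ s.2)
      simp only [Finset.mem_filter, Finset.mem_univ, true_and] at hs ⊢
      exact ⟨by rw [map_mul, h1, mul_one], hs⟩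
    · intro s _ t _ hst
      exact Subtype.ext (mul_left_cancel hst)
    · intro y hy
      simp only [Finset.mem_filter, Finset.mem_univ, true_and] at hy
      refine ⟨⟨g⁻¹ * y, ?_⟩, ?_, ?_⟩
      · rw [hN, MonoidHom.mem_ker, map_mul, map_inv, hy.1, inv_mul_cancel]
      · simpa using hy.2
      · simp
  rw [cosetDensity, Finset.sum_boole, hcount, le_div_iff₀ hNpos, inv_mul_le_iff₀ hq]
  have hle : Fintype.card N ≤ Fintype.card (V ≃ₗ[F] V) := Fintype.card_subtype_le _
  have h' : Fintype.card N ≤ Fintype.card F ^ (finrank F V / 1000) *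
      (Finset.univ.filter fun y : V ≃ₗ[F] V =>
        LinearEquiv.det y = LinearEquiv.det g ∧ y ∈ S).card := by
    refine (hle.trans h).trans (Nat.mul_le_mul_left _ (Finset.card_le_card fun y hy => ?_))
    simpa [hS, rankOnePower] using hy
  exact_mod_cast h'

theorem failure_exponent_le {q n ℓ : ℕ} (hq : 2 ≤ q) (hn : 2 ^ 17 ≤ n) (hℓ : ℓ = n / 2 ^ 16)
    {K : ℝ} (hK : (q : ℝ) ^ n ≤ K) :
    (K + K ^ 2 * (((q : ℝ) ^ (n / 4))⁻¹ +
      (1 + 2 * (2 * ℓ * 63) * (q : ℝ) ^ (2 * ℓ * 63)) / (q : ℝ) ^ (n / 64))) * (q : ℝ) ^ (n / 500) ≤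
      (K * ((q : ℝ) ^ (n / 1000))⁻¹) ^ 2 := by
  have hq1 : (1 : ℝ) ≤ q := by exact_mod_cast (by omega : 1 ≤ q)
  have hq2 : (2 : ℝ) ≤ q := by exact_mod_cast hq
  have hq0 : (0 : ℝ) < q := by linarith
  have hKpos : 0 < K := lt_of_lt_of_le (by positivity) hK
  set a := n / 500 + 2 * (n / 1000) with ha
  have h1 : K * (q : ℝ) ^ (a + 2) ≤ K ^ 2 := by
    rw [sq]
    exact mul_le_mul_of_nonneg_left
      ((pow_le_pow_right₀ hq1 (by omega)).trans hK) hKpos.le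
  have h2 : ((q : ℝ) ^ (n / 4))⁻¹ * (q : ℝ) ^ (a + 2) ≤ 1 := by
    rw [inv_mul_le_iff₀ (by positivity), mul_one]
    exact pow_le_pow_right₀ hq1 (by omega)
  have hnum : (1 + 2 * (2 * ℓ * 63) * (q : ℝ) ^ (2 * ℓ * 63)) ≤
      (q : ℝ) ^ (2 * ℓ * 63 + 1 + 2 * ℓ * 63) := by
    generalize hL : 2 * ℓ * 63 = L
    have hLr : (2 : ℝ) * ℓ * 63 = L := by rw [← hL]; push_cast; ring
    rw [hLr]
    have h3 : ((L + 1 : ℕ) : ℝ) ≤ (2 : ℝ) ^ L := by exact_mod_cast Nat.lt_two_pow_self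
    push_cast at h3
    have h4 : (2 : ℝ) ^ (L + 1) ≤ (q : ℝ) ^ (L + 1) := pow_le_pow_left₀ (by norm_num) hq2 _
    have h5 : (1 : ℝ) ≤ (q : ℝ) ^ L := one_le_pow₀ hq1
    rw [pow_succ] at h4
    rw [pow_add]
    calc (1 + 2 * (L : ℝ) * (q : ℝ) ^ L) ≤ (2 * L + 1) * (q : ℝ) ^ L := by linarith
      _ ≤ _ := mul_le_mul_of_nonneg_right (by linarith) (by positivity)
  have h3 : (1 + 2 * (2 * ℓ * 63) * (q : ℝ) ^ (2 * ℓ * 63)) / (q : ℝ) ^ (n / 64) *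
      (q : ℝ) ^ (a + 2) ≤ 1 := by
    rw [div_mul_eq_mul_div, div_le_one (by positivity)]
    refine (mul_le_mul_of_nonneg_right hnum (by positivity)).trans ?_
    rw [← pow_add]
    exact pow_le_pow_right₀ hq1 (by omega)
  set β := (1 + 2 * (2 * ℓ * 63) * (q : ℝ) ^ (2 * ℓ * 63)) / (q : ℝ) ^ (n / 64)
  set Λ := ((q : ℝ) ^ (n / 4))⁻¹
  have h4 : (K + K ^ 2 * (Λ + β)) * (q : ℝ) ^ (a + 2) ≤ 3 * K ^ 2 := by
    have h5 := mul_le_mul_of_nonneg_left h2 (sq_nonneg K)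
    have h6 := mul_le_mul_of_nonneg_left h3 (sq_nonneg K)
    linarith
  have h5 : (K + K ^ 2 * (Λ + β)) * (q : ℝ) ^ a ≤ K ^ 2 := by
    rw [pow_add, ← mul_assoc] at h4
    have h6 : (4 : ℝ) ≤ (q : ℝ) ^ 2 := by nlinarith
    have h7 : 0 ≤ (K + K ^ 2 * (Λ + β)) * (q : ℝ) ^ a := by positivity
    nlinarith
  rw [mul_pow, inv_pow, ← pow_mul, ← div_eq_mul_inv, le_div_iff₀ (by positivity), mul_assoc,
    ← pow_add, mul_comm (n / 1000) 2]
  exact h5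

theorem card_avoid_rankOnePower_mul_le {n d : ℕ} (hV : finrank F V = n) (hd : d.Prime)
    (hn : (4 * n) ^ 2000 ≤ Fintype.card F ^ d)
    (hdn : 2000 * (d + 5) ^ 2 ≤ n) (hn' : 2 ^ 17 ≤ n)
    {G : Subgroup (V ≃ₗ[F] V)} (hG : (LinearEquiv.det (R := F) (M := V)).ker ≤ G) {k : ℕ}
    (hk : Fintype.card F ^ 2 ^ 17 ≤ k) :
    ((Finset.univ.filter fun z : G × (Fin k → G) => ∀ u : Fin (n / 2 ^ 16) → Fin k,
      ((z.1 * ((List.ofFn u).map z.2).prod : G) : V ≃ₗ[F] V) ∉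
        rankOnePower F V (Fintype.card F ^ d - 1)).card : ℝ) *
      (Fintype.card F : ℝ) ^ (n / 500) ≤ Nat.card G * Fintype.card (Fin k → G) := by
  subst hV
  have := normal_of_ker_det_le hG
  obtain ⟨N, hN⟩ : ∃ N, N = (LinearEquiv.det (R := F) (M := V)).ker := ⟨_, rfl⟩
  have hNn : N.Normal := hN ▸ inferInstance
  set q := Fintype.card F with hqdef
  set n := finrank F V with hndef
  set ℓ := n / 2 ^ 16 with hℓ
  have hq2 : 2 ≤ q := Fintype.one_lt_card
  have hq0 : (0 : ℝ) < q := by exact_mod_cast (by omega : 0 < q)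
  have hmain := card_avoid_mul_le (Γ := V ≃ₗ[F] V) (N := N) (G := G) (hN ▸ hG)
    (S := rankOnePower F V (q ^ d - 1)) (conj_mem_rankOnePower _)
    (p := ((q : ℝ) ^ (n / 1000))⁻¹) (Λ := ((q : ℝ) ^ (n / 4))⁻¹)
    (β := (1 + 2 * (2 * ℓ * 63) * (q : ℝ) ^ (2 * ℓ * 63)) / (q : ℝ) ^ (n / 64))
    (by positivity) (by positivity) (by positivity)
    (fun g => hN ▸ inv_le_cosetDensity hd hn hdn g)
    (good := fun h => Nat.card (badSet 64 h) ≤ q ^ (n / 64))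
    (fun h hh f hf hf0 => abs_sum_mul_translate_le
      (fun μ w hw0 hw hμ => abs_eigenvalue_le (by omega) hh (by subst hN; convert hw0) hw hμ)
      hf hf0)
    (U := Fin ℓ → Fin k) (X := Fin k → G) (fun u x => ((List.ofFn u).map x).prod) (by
      intro u v huv
      have h := card_wordQuotient_mul_le (F := F) (V := V) (G := G) (J := 63)
        (fun g hg => hG hg) (q ^ (n / 64)) ℓ (u := List.ofFn u) (v := List.ofFn v)
        (by simp) (by simp) (fun h => huv (List.ofFn_injective h)) (by omega)
      have h' : (Finset.univ.filter fun x : Fin k → G => ¬ Nat.card (badSet 64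
          ((((List.ofFn u).map x).prod⁻¹ * ((List.ofFn v).map x).prod : G) : V ≃ₗ[F] V)) ≤
            q ^ (n / 64)).card * q ^ (n / 64) ≤
          (1 + 2 * (2 * ℓ * 63) * q ^ (2 * ℓ * 63)) * Fintype.card (Fin k → G) := by
        refine (Nat.mul_le_mul_right _ (Finset.card_le_card fun x hx => ?_)).trans
          (h.trans (le_of_eq ?_))
        · simpa [wordQuotient] using hx
        · congr!
      rw [div_mul_eq_mul_div, le_div_iff₀ (by positivity)]
      norm_cast
      convert h')
  have hK : (q : ℝ) ^ n ≤ (Fintype.card (Fin ℓ → Fin k) : ℝ) := by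
    rw [Fintype.card_fun, Fintype.card_fin, Fintype.card_fin]
    have : q ^ n ≤ k ^ ℓ := calc
      q ^ n ≤ q ^ (2 ^ 17 * ℓ) := Nat.pow_le_pow_right (by omega) (by omega)
      _ = (q ^ 2 ^ 17) ^ ℓ := pow_mul _ _ _
      _ ≤ k ^ ℓ := Nat.pow_le_pow_left hk _
    exact_mod_cast this
  have hexp := failure_exponent_le hq2 hn' hℓ hK
  set K : ℝ := (Fintype.card (Fin ℓ → Fin k) : ℝ) with hKdef
  have hKpos : 0 < K := lt_of_lt_of_le (by positivity) hK
  set T : ℝ := (Nat.card G : ℝ) * Fintype.card (Fin k → G) with hT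
  have hT0 : 0 ≤ T := by positivity
  refine le_of_mul_le_mul_right ?_ (by positivity : 0 < (K * ((q : ℝ) ^ (n / 1000))⁻¹) ^ 2)
  have h1 := mul_le_mul_of_nonneg_right hmain (by positivity : 0 ≤ (q : ℝ) ^ (n / 500))
  have h2 := mul_le_mul_of_nonneg_left hexp hT0
  rw [mul_right_comm]
  refine h1.trans ?_
  rw [mul_assoc]
  exact h2

end Assembly

end TransvectionWords

namespace TransvectionWords

open Module

section FreeGroupNorm

variable {α : Type*} [DecidableEq α]

theorem norm_pow_le (w : FreeGroup α) (m : ℕ) : (w ^ m).norm ≤ m * w.norm := by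
  induction m with
  | zero => simp
  | succ m ih =>
    rw [pow_succ]
    have := FreeGroup.norm_mul_le (w ^ m) w
    linarith

theorem norm_prod_map_of_le {β : Type*} (f : β → α) (l : List β) :
    (l.map fun i => FreeGroup.of (f i)).prod.norm ≤ l.length := by
  induction l with
  | nil => simp
  | cons a l ih =>
    rw [List.map_cons, List.prod_cons, List.length_cons]
    have := FreeGroup.norm_mul_le (FreeGroup.of (f a)) (l.map fun i => FreeGroup.of (f i)).prod
    rw [FreeGroup.norm_of] at this
    omega

/-- The word `(ξ₀ ξ_{l₁} ⋯ ξ_{lᵣ}) ^ m`, where `l` lists indices shifted by one. -/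
def powerWord {k : ℕ} (l : List (Fin k)) (m : ℕ) : FreeGroup (Fin (k + 1)) :=
  (FreeGroup.of 0 * (l.map fun i => FreeGroup.of i.succ).prod) ^ m

theorem norm_powerWord_le {k : ℕ} (l : List (Fin k)) (m : ℕ) :
    (powerWord l m).norm ≤ m * (l.length + 1) := by
  refine (norm_pow_le _ _).trans (Nat.mul_le_mul_left _ ?_)
  have h := FreeGroup.norm_mul_le (FreeGroup.of 0) (l.map fun i => FreeGroup.of i.succ).prod
  rw [FreeGroup.norm_of] at h
  have := norm_prod_map_of_le Fin.succ l
  omega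

theorem lift_powerWord {H : Type*} [Group H] {k : ℕ} (x : Fin (k + 1) → H) (l : List (Fin k))
    (m : ℕ) :
    FreeGroup.lift x (powerWord l m) = (x 0 * (l.map fun i => x i.succ).prod) ^ m := by
  simp [powerWord, map_list_prod, Function.comp_def]

end FreeGroupNorm

section Matrices

variable {F : Type} [Field F] {n : ℕ}

/-- Invertible matrices as linear automorphisms of `Fin n → F`. -/
noncomputable def glEquiv (n : ℕ) (F : Type) [Field F] :
    GL (Fin n) F ≃* ((Fin n → F) ≃ₗ[F] (Fin n → F)) :=
  Matrix.GeneralLinearGroup.toLin.trans (LinearMap.GeneralLinearGroup.generalLinearEquiv _ _)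

theorem coe_glEquiv (g : GL (Fin n) F) :
    (glEquiv n F g : (Fin n → F) →ₗ[F] (Fin n → F)) =
      Matrix.toLin' (g : Matrix (Fin n) (Fin n) F) := by
  refine LinearMap.ext fun v => ?_
  rfl

theorem det_glEquiv (g : GL (Fin n) F) :
    (LinearEquiv.det (glEquiv n F g) : F) = (g : Matrix (Fin n) (Fin n) F).det := by
  rw [LinearEquiv.coe_det, coe_glEquiv, LinearMap.det_toLin']

theorem rank_sub_one (g : GL (Fin n) F) :
    ((g : Matrix (Fin n) (Fin n) F) - 1).rank =
      finrank F (LinearMap.range ((glEquiv n F g : (Fin n → F) →ₗ[F] (Fin n → F)) - 1)) := by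
  have h : (Matrix.toLin' (g : Matrix (Fin n) (Fin n) F) - 1 : (Fin n → F) →ₗ[F] (Fin n → F)) =
      Matrix.toLin' ((g : Matrix (Fin n) (Fin n) F) - 1) := by
    rw [map_sub, Matrix.toLin'_one]
    rfl
  rw [coe_glEquiv, h]
  rfl

theorem isTransvection_pow_of_mem [Fintype F] {d : ℕ} {g : GL (Fin n) F}
    (hg : glEquiv n F g ∈ rankOnePower F (Fin n → F) (Fintype.card F ^ d - 1)) :
    IsTransvection ((g ^ (Fintype.card F ^ d - 1) : GL (Fin n) F) : Matrix (Fin n) (Fin n) F) := by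
  refine ⟨?_, ?_⟩
  · have hne : (g : Matrix (Fin n) (Fin n) F).det ≠ 0 := g.det_ne_zero
    rw [Units.val_pow_eq_pow_val, Matrix.det_pow]
    have h1 := FiniteField.pow_card_pow d (g : Matrix (Fin n) (Fin n) F).det
    refine mul_right_cancel₀ hne ?_
    rw [← pow_succ, one_mul, Nat.sub_add_cancel (Nat.one_le_pow _ _ Fintype.card_pos)]
    exact h1
  · rw [rank_sub_one, map_pow]
    exact hg

theorem ker_det_le_map {G : Subgroup (GL (Fin n) F)}
    (hG : ∀ A : Matrix.SpecialLinearGroup (Fin n) F, Matrix.SpecialLinearGroup.toGL A ∈ G) :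
    (LinearEquiv.det (R := F) (M := Fin n → F)).ker ≤ G.map (glEquiv n F).toMonoidHom := by
  intro y hy
  obtain ⟨g, rfl⟩ := (glEquiv n F).surjective y
  have hdet : (g : Matrix (Fin n) (Fin n) F).det = 1 := by
    rw [← det_glEquiv, MonoidHom.mem_ker.1 hy, Units.val_one]
  refine ⟨g, ?_, rfl⟩
  have : Matrix.SpecialLinearGroup.toGL ⟨(g : Matrix (Fin n) (Fin n) F), hdet⟩ = g :=
    Units.ext rfl
  exact this ▸ hG _

theorem card_not_exists_word_mul_le [Fintype F] {d : ℕ} (hd : d.Prime)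
    (hn : (4 * n) ^ 2000 ≤ Fintype.card F ^ d) (hdn : 2000 * (d + 5) ^ 2 ≤ n)
    (hn' : 2 ^ 17 ≤ n) {G : Subgroup (GL (Fin n) F)}
    (hG : ∀ A : Matrix.SpecialLinearGroup (Fin n) F, Matrix.SpecialLinearGroup.toGL A ∈ G) {k : ℕ}
    (hk : Fintype.card F ^ 2 ^ 17 ≤ k) :
    (Nat.card {x : Fin (k + 1) → G // ¬ ∃ w : FreeGroup (Fin (k + 1)),
      w.norm ≤ (Fintype.card F ^ d - 1) * (n / 2 ^ 16 + 1) ∧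
        IsTransvection (((FreeGroup.lift x w : G) : GL (Fin n) F) :
          Matrix (Fin n) (Fin n) F)} : ℝ) *
      (Fintype.card F : ℝ) ^ (n / 500) ≤ (Nat.card G : ℝ) ^ (k + 1) := by
  classical
  let _ : Fintype (GL (Fin n) F) := Fintype.ofFinite _
  let _ : Fintype ((Fin n → F) ≃ₗ[F] (Fin n → F)) := Fintype.ofEquiv _ (glEquiv n F).toEquiv
  have hmain := card_avoid_rankOnePower_mul_le (F := F) (V := Fin n → F) (by simp) hd
    hn hdn hn' (ker_det_le_map hG) hk
  set G' := G.map (glEquiv n F).toMonoidHom with hG'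
  let e : G ≃* G' := (glEquiv n F).subgroupMap G
  have he : ∀ g : G, (e g : (Fin n → F) ≃ₗ[F] (Fin n → F)) = glEquiv n F g := fun g => rfl
  have hcard : Nat.card G' = Nat.card G := (Nat.card_congr e.toEquiv).symm
  have htotal : (Nat.card G' : ℝ) * Fintype.card (Fin k → G') = (Nat.card G : ℝ) ^ (k + 1) := by
    rw [← Nat.card_eq_fintype_card, Nat.card_fun, Nat.card_fin, hcard]
    push_cast
    ring
  rw [htotal] at hmain
  refine le_trans (mul_le_mul_of_nonneg_right ?_ (by positivity)) hmain
  rw [← Fintype.card_subtype, Nat.cast_le, ← Nat.card_eq_fintype_card (α := {z : _ // _})]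
  refine Nat.card_le_card_of_injective (fun x => ⟨(e (x.1 0), fun i => e (x.1 i.succ)), ?_⟩) ?_
  · intro u hu
    refine x.2 ⟨powerWord (List.ofFn u) (Fintype.card F ^ d - 1), ?_, ?_⟩
    · simpa using norm_powerWord_le (List.ofFn u) (Fintype.card F ^ d - 1)
    · rw [lift_powerWord]
      refine isTransvection_pow_of_mem ?_
      rw [← he, map_mul, map_list_prod, List.map_map]
      exact hu
  · intro x y hxy
    simp only [Subtype.mk.injEq, Prod.mk.injEq, EmbeddingLike.apply_eq_iff_eq] at hxy
    refine Subtype.ext (funext fun i => ?_)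
    refine Fin.cases hxy.1 (fun i => ?_) i
    exact e.injective (congrFun hxy.2 i)

end Matrices

end TransvectionWords

/-- **Finding a transvection as a short word in `q^C` random generators**
(linear case of Theorem 6.3). There are absolute constants `c, C > 0` such that
for every finite field `F_q`, every `n > C`, every group `G` with
`SL_n(q) ≤ G ≤ GL_n(q)` and every `k > q^C`: for uniformly random
`x_0, x_1, …, x_k ∈ G`, with probability at least `1 - q^{-c·n}` there is a word
`w ∈ F_{k+1}` of reduced length at most `q²·n^C` with `w(x_0, …, x_k)` a
transvection. -/
theorem stmt2 :
    ∃ c C : ℝ, 0 < c ∧ 0 < C ∧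
      ∀ (F : Type) [Field F] [Fintype F] (n : ℕ), C < (n : ℝ) →
        ∀ G : Subgroup (GL (Fin n) F),
          (∀ A : Matrix.SpecialLinearGroup (Fin n) F,
              Matrix.SpecialLinearGroup.toGL A ∈ G) →
          ∀ k : ℕ, ((Fintype.card F : ℝ) ^ (C : ℝ) < (k : ℝ)) →
            (1 : ℝ) - (Fintype.card F : ℝ) ^ (-(c * n)) ≤
              (Nat.card {x : Fin (k + 1) → ↥G //
                  ∃ w : FreeGroup (Fin (k + 1)),
                    (w.norm : ℝ) ≤ (Fintype.card F : ℝ) ^ 2 * (n : ℝ) ^ (C : ℝ) ∧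
                    IsTransvection
                      (((FreeGroup.lift x w : ↥G) :
                          GL (Fin n) F) : Matrix (Fin n) (Fin n) F)} : ℝ) /
                (Nat.card ↥G : ℝ) ^ (k + 1) := by
  classical
  obtain ⟨N₀, hN₀⟩ := Filter.eventually_atTop.1 TransvectionWords.eventually_exists_prime
  refine ⟨1 / 1000, ((N₀ + 2 ^ 17 : ℕ) : ℝ), by norm_num, by positivity, ?_⟩
  intro F _ _ n hn G hG k hk
  rw [Real.rpow_natCast] at hk
  have hn : N₀ + 2 ^ 17 < n := by exact_mod_cast hn
  have hq2 : 2 ≤ Fintype.card F := Fintype.one_lt_card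
  set q := Fintype.card F with hq
  have hk : q ^ 2 ^ 17 ≤ k :=
    (Nat.pow_le_pow_right (by omega) (by omega)).trans
      (by exact_mod_cast hk.le : q ^ (N₀ + 2 ^ 17) ≤ k)
  obtain ⟨d, hd, hd1, hd2, hd3⟩ := hN₀ n (by omega) q hq2
  have hmain := TransvectionWords.card_not_exists_word_mul_le hd hd1 hd2 (by omega) hG hk
  have hGpos : (0 : ℝ) < (Nat.card G : ℝ) ^ (k + 1) := by
    have : 0 < Nat.card G := Nat.card_pos
    positivity
  have hword : (q ^ d - 1) * (n / 2 ^ 16 + 1) ≤ q ^ 2 * n ^ (N₀ + 2 ^ 17) := calc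
    (q ^ d - 1) * (n / 2 ^ 16 + 1) ≤ (q ^ 2 * (4 * n) ^ 8000) * n :=
      Nat.mul_le_mul ((Nat.sub_le _ _).trans hd3) (by omega)
    _ ≤ (q ^ 2 * (n ^ 2) ^ 8000) * n := by
      gcongr
      nlinarith
    _ = q ^ 2 * n ^ (16000 + 1) := by rw [← pow_mul, mul_assoc, ← pow_succ]
    _ ≤ _ := Nat.mul_le_mul_left _ (Nat.pow_le_pow_right (by omega) (by omega))
  set P : (Fin (k + 1) → G) → Prop := fun x => ∃ w : FreeGroup (Fin (k + 1)),
    (w.norm : ℝ) ≤ (q : ℝ) ^ 2 * (n : ℝ) ^ ((N₀ + 2 ^ 17 : ℕ) : ℝ) ∧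
    IsTransvection (((FreeGroup.lift x w : G) : GL (Fin n) F) : Matrix (Fin n) (Fin n) F) with hP
  have hfail : Nat.card {x // ¬ P x} ≤ Nat.card {x : Fin (k + 1) → G //
      ¬ ∃ w : FreeGroup (Fin (k + 1)), w.norm ≤ (q ^ d - 1) * (n / 2 ^ 16 + 1) ∧
        IsTransvection (((FreeGroup.lift x w : G) : GL (Fin n) F) :
          Matrix (Fin n) (Fin n) F)} := by
    refine Nat.card_le_card_of_injective (Subtype.map id ?_)
      (Subtype.map_injective _ Function.injective_id)
    rintro x hx ⟨w, hw, ht⟩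
    refine hx ⟨w, ?_, ht⟩
    rw [Real.rpow_natCast]
    exact_mod_cast hw.trans hword
  have hsum : Nat.card {x // P x} + Nat.card {x // ¬ P x} = Nat.card G ^ (k + 1) := by
    rw [← Nat.card_sum, Nat.card_congr (Equiv.sumCompl P), Nat.card_fun, Nat.card_fin]
  have hexp : (q : ℝ) ^ (1 / 1000 * n : ℝ) ≤ (q : ℝ) ^ (n / 500) := by
    rw [← Real.rpow_natCast]
    refine Real.rpow_le_rpow_of_exponent_le (by exact_mod_cast (by omega : 1 ≤ q)) ?_
    have : n ≤ 1000 * (n / 500) := by omega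
    have : (n : ℝ) ≤ 1000 * ((n / 500 : ℕ) : ℝ) := by exact_mod_cast this
    linarith
  have hqpos : (0 : ℝ) < (q : ℝ) ^ (1 / 1000 * n : ℝ) :=
    Real.rpow_pos_of_pos (by exact_mod_cast (by omega : 0 < q)) _
  have hbad : (Nat.card {x // ¬ P x} : ℝ) * (q : ℝ) ^ (1 / 1000 * n : ℝ) ≤
      (Nat.card G : ℝ) ^ (k + 1) :=
    (mul_le_mul (by exact_mod_cast hfail) hexp hqpos.le (Nat.cast_nonneg _)).trans hmain
  have hsum' : (Nat.card {x // P x} : ℝ) + (Nat.card {x // ¬ P x} : ℝ) =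
      (Nat.card G : ℝ) ^ (k + 1) := by exact_mod_cast hsum
  rw [Real.rpow_neg (Nat.cast_nonneg _), le_div_iff₀ hGpos, sub_mul, one_mul, ← hsum',
    sub_le_iff_le_add, add_le_add_iff_left, hsum', inv_mul_eq_div, le_div_iff₀ hqpos]
  exact hbad
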